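/- For every n ≥ 3, the pure braid group P_n — the kernel of the surjective homomorphism from the braid group B_n onto the symmetric group Sym(n) sending each Artin generator σᵢ to the transposition (i, i+1) — satisfies the strong generic free group property with respect to every finite generating set. -/

import Mathlib

open Filter Set

/-- The ball of radius `m` in a group with respect to a set `S`: the elements expressible as
a product of at most `m` elements of `S ∪ S⁻¹`. -/
def wordBall {G : Type*} [Group G] (S : Set G) (m : ℕ) : Set G :=
  {g | ∃ l : List G, l.length ≤ m ∧ (∀ x ∈ l, x ∈ S ∨ x⁻¹ ∈ S) ∧ l.prod = g}

/-- A tuple `(g₁, …, gₙ)` is a free basis tuple if the induced homomorphism from the free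
group of rank `n` sending the `i`-th free generator to `gᵢ` is injective. -/
def IsFreeBasisTuple {G : Type*} [Group G] {n : ℕ} (x : Fin n → G) : Prop :=
  Function.Injective (FreeGroup.lift x)

/-- A group has the strong generic free group property with respect to a generating set `S`
if for every `n ≥ 1` the proportion of free basis `n`-tuples in the ball of radius `m`
tends to `1` as `m → ∞`. -/
def StrongGenericFreeGroupProperty {G : Type*} [Group G] (S : Set G) : Prop :=
  ∀ n : ℕ, 1 ≤ n →
    Filter.Tendsto
      (fun m : ℕ =>
        ({x : Fin n → G | (∀ i, x i ∈ wordBall S m) ∧ IsFreeBasisTuple x}.ncard : ℝ) /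
          ((wordBall S m).ncard : ℝ) ^ n)
      Filter.atTop (nhds 1)

/-- A group has the strong generic free group property with respect to every finite
generating set. -/
def HasStrongGenericFreeGroupProperty (G : Type*) [Group G] : Prop :=
  ∀ S : Set G, S.Finite → Subgroup.closure S = ⊤ → StrongGenericFreeGroupProperty S

/-- The Artin relators of the braid group on `n` strands. -/
def braidRels (n : ℕ) : Set (FreeGroup (Fin (n - 1))) :=
  {r | (∃ i j : Fin (n - 1), 1 < ((i : ℤ) - (j : ℤ)).natAbs ∧
          r = FreeGroup.of i * FreeGroup.of j * (FreeGroup.of j * FreeGroup.of i)⁻¹) ∨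
       (∃ i j : Fin (n - 1), (j : ℕ) = (i : ℕ) + 1 ∧
          r = FreeGroup.of i * FreeGroup.of j * FreeGroup.of i *
            (FreeGroup.of j * FreeGroup.of i * FreeGroup.of j)⁻¹)}

/-- The braid group on `n` strands, given by the Artin presentation. -/
def BraidGroup (n : ℕ) : Type :=
  PresentedGroup (braidRels n)

instance (n : ℕ) : Group (BraidGroup n) := by
  unfold BraidGroup; infer_instance

/-- `i` separates from `ξ` earlier than `j` does on the way from `ξ` to `η`. -/
def AxisBefore {I Ω : Type*} (d : I → Ω → Ω → ℕ) (κ : ℕ) (i j : I) (ξ η : Ω) : Prop :=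
  (∀ ζ, κ < d j ζ ξ → ∀ ω, d i ζ ω = d i η ω) ∧ (∀ ζ, κ < d i ζ η → ∀ ω, d j ζ ω = d j ξ ω)

/-- An equivariant family of coarse pseudo-distances on `Ω` indexed by `I`, any two of which
are linearly ordered between two points that are far apart for both. -/
structure AxisSystem (G Ω I : Type*) [Group G] [MulAction G Ω] [MulAction G I] where
  d : I → Ω → Ω → ℕ
  κ : ℕ
  T₀ : ℕ
  dist_comm : ∀ i ξ η, d i ξ η = d i η ξ
  dist_tri : ∀ i ξ η ζ, d i ξ ζ ≤ d i ξ η + d i η ζ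
  self_le : ∀ i ξ, d i ξ ξ ≤ κ
  smul_eq : ∀ (g : G) i ξ η, d (g • i) (g • ξ) (g • η) = d i ξ η
  unbounded : ∀ i ξ K, ∃ ζ, K < d i ξ ζ
  finite_ge : ∀ ξ η, {i | T₀ ≤ d i ξ η}.Finite
  before_or : ∀ i j ξ η, i ≠ j → κ < d i ξ η → κ < d j ξ η →
    AxisBefore d κ i j ξ η ∨ AxisBefore d κ j i ξ η

namespace AxisSystem

variable {G Ω I : Type*} [Group G] [MulAction G Ω] [MulAction G I] (A : AxisSystem G Ω I)

/-- Precedence of indices on the way from `ξ` to `η`. -/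
abbrev Before (i j : I) (ξ η : Ω) : Prop := AxisBefore A.d A.κ i j ξ η

variable {A}

theorem Before.swap {i j : I} {ξ η : Ω} (h : A.Before i j ξ η) : A.Before j i η ξ :=
  ⟨h.2, h.1⟩

theorem before_smul_iff (g : G) {i j : I} {ξ η : Ω} :
    A.Before (g • i) (g • j) (g • ξ) (g • η) ↔ A.Before i j ξ η := by
  constructor
  · rintro ⟨h1, h2⟩
    refine ⟨fun ζ hζ ω => ?_, fun ζ hζ ω => ?_⟩
    · have := h1 (g • ζ) (by rwa [A.smul_eq]) (g • ω)
      rwa [A.smul_eq, A.smul_eq] at this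
    · have := h2 (g • ζ) (by rwa [A.smul_eq]) (g • ω)
      rwa [A.smul_eq, A.smul_eq] at this
  · rintro ⟨h1, h2⟩
    refine ⟨fun ζ hζ ω => ?_, fun ζ hζ ω => ?_⟩
    · obtain ⟨ζ, rfl⟩ := MulAction.surjective g ζ
      obtain ⟨ω, rfl⟩ := MulAction.surjective g ω
      simp only [A.smul_eq] at hζ ⊢
      exact h1 ζ hζ ω
    · obtain ⟨ζ, rfl⟩ := MulAction.surjective g ζ
      obtain ⟨ω, rfl⟩ := MulAction.surjective g ω
      simp only [A.smul_eq] at hζ ⊢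
      exact h2 ζ hζ ω

theorem exists_far (i : I) (ξ η : Ω) (K : ℕ) : ∃ ζ, K < A.d i ζ ξ ∧ K < A.d i ζ η := by
  obtain ⟨ζ, hζ⟩ := A.unbounded i ξ (K + A.d i ξ η)
  refine ⟨ζ, by rw [A.dist_comm]; omega, ?_⟩
  have := A.dist_tri i ξ η ζ
  rw [A.dist_comm i ζ η]; omega

theorem Before.asymm {i j : I} {ξ η : Ω} (hi : A.κ < A.d i ξ η)
    (h : A.Before i j ξ η) : ¬ A.Before j i ξ η := by
  intro h'
  obtain ⟨ζ, h1, h2⟩ := A.exists_far j ξ η A.κ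
  have e1 := h.1 ζ h1 η
  have e2 := h'.2 ζ h2 η
  have := A.self_le i η
  omega

theorem Before.irrefl {i : I} {ξ η : Ω} (hi : A.κ < A.d i ξ η) : ¬ A.Before i i ξ η :=
  fun h => h.asymm hi h

theorem Before.trans {i j k : I} {ξ η : Ω} (hi : A.κ < A.d i ξ η) (hk : A.κ < A.d k ξ η)
    (h : A.Before i j ξ η) (h' : A.Before j k ξ η) : A.Before i k ξ η := by
  rcases eq_or_ne i k with rfl | hik
  · exact absurd h' (h.asymm hi)
  rcases A.before_or i k ξ η hik hi hk with h0 | h0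
  · exact h0
  exfalso
  obtain ⟨ζ, h1, h2⟩ := A.exists_far i ξ η A.κ
  have e1 := h0.1 ζ h1 ξ
  have hk' : A.κ < A.d k ζ ξ := by rw [e1, A.dist_comm]; exact hk
  by_cases hj : A.κ < A.d j ξ η
  · have e2 := h'.1 ζ hk' ξ
    have hj' : A.κ < A.d j ζ ξ := by rw [e2, A.dist_comm]; exact hj
    have e3 := h.1 ζ hj' η
    have := A.self_le i η
    omega
  · have e2 := h'.1 ζ hk' 
    have e4 := h.2 ζ h2
    obtain ⟨ω, hω, hω'⟩ := A.exists_far j ξ η A.κ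
    have e5 := h.1 ω hω
    have e6 := h'.2 ω hω' 
    have e7 := h0.2 ω (by rw [e6 η]; exact hk) ξ
    have := e5 ξ
    have e8 := A.self_le i ξ
    rw [A.dist_comm] at hi
    omega

theorem three_bad {i j k : I} {ξ η ζ : Ω} (hij : i ≠ j) (hik : i ≠ k) (hjk : j ≠ k)
    (hi : 2 * A.κ < A.d i ξ η) (hj : 2 * A.κ < A.d j ξ η) (hk : 2 * A.κ < A.d k ξ η)
    (bi : (¬ ∀ ω, A.d i ζ ω = A.d i ξ ω) ∧ ¬ ∀ ω, A.d i ζ ω = A.d i η ω)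
    (bj : (¬ ∀ ω, A.d j ζ ω = A.d j ξ ω) ∧ ¬ ∀ ω, A.d j ζ ω = A.d j η ω)
    (bk : (¬ ∀ ω, A.d k ζ ω = A.d k ξ ω) ∧ ¬ ∀ ω, A.d k ζ ω = A.d k η ω) : False := by
  have key : ∀ {a b c : I}, 2 * A.κ < A.d b ξ η → A.Before a b ξ η → A.Before b c ξ η →
      (¬ ∀ ω, A.d a ζ ω = A.d a η ω) → (¬ ∀ ω, A.d c ζ ω = A.d c ξ ω) → False := by
    intro a b c hb h1 h2 ba bc
    have e1 : A.d b ζ ξ ≤ A.κ := by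
      by_contra hcon
      exact ba (h1.1 ζ (by omega))
    have e2 : A.d b ζ η ≤ A.κ := by
      by_contra hcon
      exact bc (h2.2 ζ (by omega))
    have := A.dist_tri b ξ ζ η
    rw [A.dist_comm b ξ ζ] at this
    omega
  rcases A.before_or i j ξ η hij (by omega) (by omega) with h1 | h1 <;>
  rcases A.before_or i k ξ η hik (by omega) (by omega) with h2 | h2 <;>
  rcases A.before_or j k ξ η hjk (by omega) (by omega) with h3 | h3
  · exact key hj h1 h3 bi.2 bk.1
  · exact key hk h2 h3 bi.2 bj.1
  · exact key hi h2 h1 bk.2 bj.1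
  · exact key hi h2 h1 bk.2 bj.1
  · exact key hi h1 h2 bj.2 bk.1
  · exact key hi h1 h2 bj.2 bk.1
  · exact key hk h3 h2 bj.2 bi.1
  · exact key hj h3 h1 bk.2 bi.1

variable (A)

open Classical in
/-- The set of indices for which `ξ` and `η` are at distance at least `T`. -/
noncomputable def R (T : ℕ) (ξ η : Ω) : Finset I :=
  if h : {i | T ≤ A.d i ξ η}.Finite then h.toFinset else ∅

variable {A}

theorem mem_R {T : ℕ} (hT : A.T₀ ≤ T) {ξ η : Ω} {i : I} :
    i ∈ A.R T ξ η ↔ T ≤ A.d i ξ η := by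
  have h : {i | T ≤ A.d i ξ η}.Finite :=
    (A.finite_ge ξ η).subset fun i hi => le_trans hT hi
  simp [R, h]

theorem R_comm {T : ℕ} (hT : A.T₀ ≤ T) (ξ η : Ω) : A.R T ξ η = A.R T η ξ := by
  ext i
  rw [mem_R hT, mem_R hT, A.dist_comm]

theorem card_le_two_of_not_three {α : Type*} (s : Finset α)
    (h : ∀ a ∈ s, ∀ b ∈ s, ∀ c ∈ s, a ≠ b → a ≠ c → b ≠ c → False) : s.card ≤ 2 := by
  by_contra hc
  obtain ⟨a, b, c, ha, hb, hc, hab, hac, hbc⟩ := Finset.two_lt_card_iff.1 (not_le.1 hc)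
  exact h a ha b hb c hc hab hac hbc

open Classical in
theorem card_bad_le_two {T : ℕ} (hT : A.T₀ ≤ T) (hT' : 2 * A.κ < T) (ξ η ζ : Ω) :
    ((A.R T ξ η).filter fun i =>
      (¬ ∀ ω, A.d i ζ ω = A.d i ξ ω) ∧ ¬ ∀ ω, A.d i ζ ω = A.d i η ω).card ≤ 2 := by
  refine card_le_two_of_not_three _ fun a ha b hb c hc hab hac hbc => ?_
  simp only [Finset.mem_filter, mem_R hT] at ha hb hc
  exact three_bad hab hac hbc (by omega) (by omega) (by omega) ha.2 hb.2 hc.2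

end AxisSystem

namespace AxisSystem

variable {G Ω I : Type*} [Group G] [MulAction G Ω] [MulAction G I] {A : AxisSystem G Ω I}

theorem smul_mem_R (T : ℕ) (hT : A.T₀ ≤ T) (g : G) {i : I} {ξ η : Ω} :
    g • i ∈ A.R T (g • ξ) (g • η) ↔ i ∈ A.R T ξ η := by
  rw [mem_R hT, mem_R hT, A.smul_eq]

theorem card_R_smul (T : ℕ) (hT : A.T₀ ≤ T) (g : G) (ξ η : Ω) :
    (A.R T (g • ξ) (g • η)).card = (A.R T ξ η).card := by
  symm
  refine Finset.card_bij (fun i _ => g • i) (fun i hi => (smul_mem_R T hT g).2 hi)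
    (fun i _ j _ h => MulAction.injective g h) fun j hj => ⟨g⁻¹ • j, ?_, smul_inv_smul g j⟩
  rw [← smul_mem_R T hT g, smul_inv_smul]
  exact hj

/-- Indices that separate two points of one side of `i` look the same from far along `i`. -/
theorem eq_of_far {i ρ : I} (hne : i ≠ ρ) {a c q d : Ω} (hac : 2 * A.κ < A.d ρ a c)
    (haq : A.κ < A.d i a q) (hcq : A.κ < A.d i c q) (hda : A.κ < A.d i d a)
    (hdc : A.κ < A.d i d c) (ω : Ω) : A.d ρ d ω = A.d ρ q ω := by
  have key : ∀ {a c : Ω}, 2 * A.κ < A.d ρ a c → A.κ < A.d i a q → A.κ < A.d i c q →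
      A.κ < A.d i d a → A.κ < A.d ρ a q → A.d ρ d ω = A.d ρ q ω := by
    intro a c hac haq hcq hda h
    rcases A.before_or i ρ a q hne haq h with h1 | h1
    · have := h1.2 c hcq a
      have h2 := A.self_le ρ a
      rw [A.dist_comm ρ c a] at this
      omega
    · exact h1.1 d hda ω
  have ht := A.dist_tri ρ a q c
  rw [A.dist_comm ρ q c] at ht
  rcases Nat.lt_or_ge A.κ (A.d ρ a q) with h | h
  · exact key hac haq hcq hda h
  · exact key (by rwa [A.dist_comm]) hcq haq hdc (by omega)

theorem before_of_near {i ρ : I} (hne : i ≠ ρ) {a c d : Ω} (hac : A.κ < A.d ρ a c)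
    (hda : A.κ < A.d i d a) (hdc : A.κ < A.d i d c) (hρ : A.κ < A.d ρ a d) :
    A.Before ρ i a d := by
  rcases A.before_or i ρ a d hne (by rwa [A.dist_comm]) hρ with h1 | h1
  · have := h1.2 c (by rwa [A.dist_comm]) a
    have h2 := A.self_le ρ a
    rw [A.dist_comm ρ c a] at this
    omega
  · exact h1

open Classical in
/-- The indices of `A.R T ξ η` preceding `i`. -/
noncomputable def bef (A : AxisSystem G Ω I) (T : ℕ) (i : I) (ξ η : Ω) : Finset I :=
  (A.R T ξ η).filter fun j => A.Before j i ξ η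

theorem mem_bef {T : ℕ} (hT : A.T₀ ≤ T) {i j : I} {ξ η : Ω} :
    j ∈ A.bef T i ξ η ↔ T ≤ A.d j ξ η ∧ A.Before j i ξ η := by
  classical
  simp [bef, mem_R hT]

theorem card_filter_le_of_injOn {α : Type*} (s : Finset α) (f : α → ℕ) (hf : Set.InjOn f s)
    (M N : ℕ) (h : ∀ a ∈ s, M ≤ 2 * f a + N ∧ 2 * f a ≤ M + N) : s.card ≤ N + 1 := by
  have : s.card = (s.image f).card := (Finset.card_image_of_injOn hf).symm
  rw [this]
  calc (s.image f).card ≤ (Finset.Icc ((M - N + 1) / 2) ((M + N) / 2)).card := by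
        refine Finset.card_le_card fun x hx => ?_
        obtain ⟨a, ha, rfl⟩ := Finset.mem_image.1 hx
        have := h a ha
        rw [Finset.mem_Icc]; omega
    _ ≤ N + 1 := by rw [Nat.card_Icc]; omega

variable {T : ℕ} (hT : A.T₀ ≤ T) (hκ : 2 * A.κ < T)
include hT hκ

theorem bef_card_lt {i j : I} {ξ η : Ω} (hi : T ≤ A.d i ξ η) (hj : T ≤ A.d j ξ η)
    (h : A.Before i j ξ η) : (A.bef T i ξ η).card < (A.bef T j ξ η).card := by
  refine Finset.card_lt_card ⟨fun k hk => ?_, fun hs => ?_⟩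
  · rw [mem_bef hT] at hk ⊢
    exact ⟨hk.1, hk.2.trans (by omega) (by omega) h⟩
  · have : i ∈ A.bef T j ξ η := (mem_bef hT).2 ⟨hi, h⟩
    exact Before.irrefl (by omega) ((mem_bef hT).1 (hs this)).2

theorem bef_card_injOn (ξ η : Ω) :
    Set.InjOn (fun i => (A.bef T i ξ η).card) (A.R T ξ η) := by
  intro i hi j hj hij
  rw [Finset.mem_coe, mem_R hT] at hi hj
  by_contra hne
  simp only at hij
  rcases A.before_or i j ξ η hne (by omega) (by omega) with h | h
  · have := bef_card_lt hT hκ hi hj h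
    omega
  · have := bef_card_lt hT hκ hj hi h
    omega

theorem bef_add_bef {i : I} {ξ η : Ω} (hi : T ≤ A.d i ξ η) :
    (A.bef T i ξ η).card + (A.bef T i η ξ).card + 1 = (A.R T ξ η).card := by
  classical
  have hd : Disjoint (A.bef T i ξ η) (A.bef T i η ξ) := by
    rw [Finset.disjoint_left]
    intro k hk hk'
    rw [mem_bef hT] at hk hk'
    exact hk.2.asymm (by omega) hk'.2.swap
  have hni : i ∉ A.bef T i ξ η ∪ A.bef T i η ξ := by
    rw [Finset.mem_union, mem_bef hT, mem_bef hT]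
    rintro (h | h)
    · exact Before.irrefl (by omega) h.2
    · exact Before.irrefl (by omega) h.2
  rw [← Finset.card_union_of_disjoint hd, ← Finset.card_insert_of_notMem hni]
  congr 1
  ext k
  rw [Finset.mem_insert, Finset.mem_union, mem_bef hT, mem_bef hT, mem_R hT]
  constructor
  · rintro (rfl | h | h)
    · exact hi
    · exact h.1
    · rw [A.dist_comm]; exact h.1
  · intro hk
    rcases eq_or_ne k i with h | h
    · exact Or.inl h
    rcases A.before_or k i ξ η h (by omega) (by omega) with h1 | h1
    · exact Or.inr (Or.inl ⟨hk, h1⟩)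
    · exact Or.inr (Or.inr ⟨by rw [A.dist_comm]; exact hk, Before.swap h1⟩)

theorem bef_le_aft {i : I} {g : G} (hg : g • i = i) {a c : Ω} (h1 : A.κ < A.d i a (g • a))
    (h2 : T ≤ A.d i a (g • c)) :
    (A.bef T i a (g • c)).card ≤ (A.bef T i (g • c) a).card + (A.R T a c).card + 2 := by
  classical
  set d := g • c with hd
  set bad := (A.R T a d).filter fun ρ =>
      (¬ ∀ ω, A.d ρ c ω = A.d ρ a ω) ∧ ¬ ∀ ω, A.d ρ c ω = A.d ρ d ω with hbad
  have hb : bad.card ≤ 2 := card_bad_le_two hT hκ a d c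
  set good := (A.bef T i a d).filter fun ρ => ∀ ω, A.d ρ c ω = A.d ρ a ω with hgood
  have hsub : A.bef T i a d ⊆ good ∪ A.R T a c ∪ bad := by
    intro ρ hρ
    have hρ' := (mem_bef hT).1 hρ
    simp only [Finset.mem_union, hgood, hbad, Finset.mem_filter, mem_R hT]
    by_cases e1 : ∀ ω, A.d ρ c ω = A.d ρ a ω
    · exact Or.inl (Or.inl ⟨hρ, e1⟩)
    by_cases e2 : ∀ ω, A.d ρ c ω = A.d ρ d ω
    · refine Or.inl (Or.inr ?_)
      rw [A.dist_comm, e2 a, A.dist_comm]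
      exact hρ'.1
    · exact Or.inr ⟨hρ'.1, e1, e2⟩
  have hgi : g⁻¹ • i = i := by rw [inv_smul_eq_iff, hg]
  have hgood_le : good.card ≤ (A.bef T i d a).card := by
    refine Finset.card_le_card_of_injOn (fun ρ => g • ρ) ?_ (MulAction.injective g).injOn
    intro ρ hρ
    simp only [hgood, Finset.coe_filter, Set.mem_ofPred_eq, mem_bef hT] at hρ
    obtain ⟨⟨hρ1, hρ2⟩, hρ3⟩ := hρ
    have hne : ρ ≠ i := by
      rintro rfl
      exact Before.irrefl (by omega) hρ2
    have hgne : g • ρ ≠ i := by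
      intro h
      apply hne
      rw [← hgi, ← h, inv_smul_smul]
    have hfar : A.κ < A.d i (g⁻¹ • a) a := by
      rw [← A.smul_eq g, hg, smul_inv_smul]; exact h1
    have hmem : T ≤ A.d (g • ρ) d a := by
      have e := hρ2.1 (g⁻¹ • a) hfar c
      rw [← A.smul_eq g⁻¹, inv_smul_smul, hd, inv_smul_smul, A.dist_comm, e, A.dist_comm, hρ3]
      exact hρ1
    refine (mem_bef hT).2 ⟨hmem, ?_⟩
    rcases A.before_or (g • ρ) i d a hgne (by omega) (by rw [A.dist_comm]; omega) with h | h
    · exact h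
    exfalso
    obtain ⟨ζ, hζ1, hζ2⟩ := A.exists_far i a (g⁻¹ • a) A.κ
    have e1 := hρ2.1 ζ hζ1 c
    have e2 := h.2 (g • ζ) (by rw [← A.smul_eq g⁻¹, hgi, inv_smul_smul]; exact hζ2) (g • c)
    rw [A.smul_eq, hd, A.smul_eq, e1, A.dist_comm, hρ3] at e2
    have := A.self_le ρ c
    omega
  calc (A.bef T i a d).card ≤ (good ∪ A.R T a c ∪ bad).card := Finset.card_le_card hsub
    _ ≤ good.card + (A.R T a c).card + bad.card :=
      (Finset.card_union_le _ _).trans (Nat.add_le_add_right (Finset.card_union_le _ _) _)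
    _ ≤ _ := by omega

theorem aft_le_bef {i : I} {g : G} (hg : g • i = i) {a c : Ω} (h1 : A.κ < A.d i c (g • c))
    (h2 : T ≤ A.d i a (g • c)) :
    (A.bef T i (g • c) a).card ≤ (A.bef T i a (g • c)).card + (A.R T a c).card + 2 := by
  have hgi : g⁻¹ • i = i := by rw [inv_smul_eq_iff, hg]
  have := bef_le_aft hT hκ (i := i) (g := g⁻¹) hgi (a := g • c) (c := g • a)
    (by rw [inv_smul_smul, A.dist_comm]; exact h1)
    (by rw [inv_smul_smul, A.dist_comm]; exact h2)
  rwa [inv_smul_smul, card_R_smul T hT, R_comm hT c a] at this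

open Classical in
theorem card_R_inter_le {T' : ℕ} (hT' : A.κ < T') (hTT : A.T₀ ≤ T') (o ξ ζ : Ω) :
    (A.R T o ξ ∩ A.R T' o ζ).card ≤ (A.R T o ξ ∩ A.R T o ζ).card + 2 := by
  have hsub : A.R T o ξ ∩ A.R T' o ζ ⊆ (A.R T o ξ ∩ A.R T o ζ) ∪ ((A.R T o ξ).filter fun i =>
      (¬ ∀ ω, A.d i ζ ω = A.d i o ω) ∧ ¬ ∀ ω, A.d i ζ ω = A.d i ξ ω) := by
    intro i hi
    simp only [Finset.mem_inter, Finset.mem_union, Finset.mem_filter, mem_R hT, mem_R hTT] at hi ⊢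
    by_cases e1 : ∀ ω, A.d i ζ ω = A.d i o ω
    · have := e1 o
      have := A.self_le i o
      have := A.dist_comm i o ζ
      omega
    by_cases e2 : ∀ ω, A.d i ζ ω = A.d i ξ ω
    · left
      refine ⟨hi.1, ?_⟩
      rw [A.dist_comm, e2, A.dist_comm]
      exact hi.1
    · exact Or.inr ⟨hi.1, e1, e2⟩
  exact (Finset.card_le_card hsub).trans ((Finset.card_union_le _ _).trans
    (Nat.add_le_add_left (card_bad_le_two hT hκ o ξ ζ) _))

/-- At most two indices that are far for `o, ξ` are only partially crossed by `ζ`. -/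
theorem card_partial_le_two {T' T'' : ℕ} (h1 : A.κ < T') (h2 : T'' < T)
    (o ξ ζ : Ω) (s : Finset I) (hs : s ⊆ A.R T o ξ)
    (hs' : ∀ i ∈ s, T' ≤ A.d i o ζ ∧ A.d i o ζ ≤ T'') : s.card ≤ 2 := by
  classical
  refine (Finset.card_le_card fun i hi => ?_).trans (card_bad_le_two hT hκ o ξ ζ)
  rw [Finset.mem_filter]
  refine ⟨hs hi, fun e => ?_, fun e => ?_⟩
  · have := e o
    have := A.self_le i o
    have := A.dist_comm i o ζ
    have := (hs' i hi).1
    omega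
  · have := e o
    have h3 := (mem_R hT).1 (hs hi)
    rw [A.dist_comm] at h3
    have := A.dist_comm i o ζ
    have := (hs' i hi).2
    omega

end AxisSystem

/-- Finite balls of a group, with geodesic-like paths to each element. -/
structure BallSystem (G : Type*) [Group G] where
  B : ℕ → Finset G
  one_mem : ∀ m, 1 ∈ B m
  mul_mem : ∀ {a b x y}, x ∈ B a → y ∈ B b → x * y ∈ B (a + b)
  inv_mem : ∀ {a x}, x ∈ B a → x⁻¹ ∈ B a
  exists_mem : ∀ g, ∃ m, g ∈ B m
  mono : Monotone B
  path : ∀ m x, x ∈ B m → ∃ p : ℕ → G, p 0 = 1 ∧ p m = x ∧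
    (∀ j, (p j)⁻¹ * p (j + 1) ∈ B 1) ∧ ∀ j ≤ m, p j ∈ B j ∧ (p j)⁻¹ * x ∈ B (m - j)

namespace BallSystem

variable {G : Type*} [Group G] (Bs : BallSystem G)

theorem card_pos (m : ℕ) : 0 < (Bs.B m).card := Finset.card_pos.2 ⟨1, Bs.one_mem m⟩

open Classical in
theorem card_add_le (a b : ℕ) : (Bs.B (a + b)).card ≤ (Bs.B a).card * (Bs.B b).card := by
  have hsub : Bs.B (a + b) ⊆ ((Bs.B a) ×ˢ (Bs.B b)).image fun q => q.1 * q.2 := by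
    intro x hx
    obtain ⟨p, -, -, -, h⟩ := Bs.path _ _ hx
    obtain ⟨h1, h2⟩ := h a (by omega)
    rw [Finset.mem_image]
    refine ⟨(p a, (p a)⁻¹ * x), ?_, by simp⟩
    rw [Finset.mem_product]
    exact ⟨h1, by simpa using h2⟩
  exact (Finset.card_le_card hsub).trans (Finset.card_image_le.trans
    (Finset.card_product _ _).le)

theorem exists_finset_mem (s : Finset G) : ∃ m, ∀ g ∈ s, g ∈ Bs.B m := by
  classical
  induction s using Finset.induction_on with
  | empty => exact ⟨0, by simp⟩
  | insert a s ha ih =>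
    obtain ⟨m, hm⟩ := ih
    obtain ⟨m', hm'⟩ := Bs.exists_mem a
    refine ⟨max m m', fun g hg => ?_⟩
    rcases Finset.mem_insert.1 hg with rfl | hg
    · exact Bs.mono (le_max_right _ _) hm'
    · exact Bs.mono (le_max_left _ _) (hm g hg)

theorem conj_mem {m c : ℕ} {x : G} {p : ℕ → G}
    (hp : ∀ j ≤ m, p j ∈ Bs.B j ∧ (p j)⁻¹ * x ∈ Bs.B (m - j)) {j : ℕ} (hj : j ≤ m) {φ : G}
    (hφ : φ ∈ Bs.B c) : p j * φ * (p j)⁻¹ * x ∈ Bs.B (m + c) := by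
  have := Bs.mul_mem (Bs.mul_mem (hp j hj).1 hφ) (hp j hj).2
  rw [show j + c + (m - j) = m + c by omega] at this
  rwa [mul_assoc _ _ x]

end BallSystem

namespace AxisSystem

variable {G Ω I : Type*} [Group G] [MulAction G Ω] [MulAction G I]

/-- A finite supply of indices whose translations can be inserted into group elements. -/
structure Inserter (A : AxisSystem G Ω I) (Bs : BallSystem G) where
  o : Ω
  el : I → G
  U : Finset I
  (c₁ s C₀ C₁ h k c : ℕ)
  el_smul : ∀ g i, el (g • i) = g * el i * g⁻¹
  el_fix : ∀ i, el i • i = i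
  el_far : ∀ i ξ n, n ≤ A.d i ξ (el i ^ n • ξ)
  near : ∀ ξ, ∀ e ∈ U, ∀ e' ∈ U, e ≠ e' → A.d e o ξ ≤ c₁ ∨ A.d e' o ξ ≤ c₁
  three_le : 3 ≤ U.card
  lip : ∀ g ∈ Bs.B 1, ∀ i, A.d i o (g • o) ≤ C₀
  lip_el : ∀ e ∈ U, ∀ i, A.d i o (el e ^ s • o) ≤ C₁
  el_mem : ∀ e ∈ U, el e ^ k ∈ Bs.B c
  s_gt : A.κ + c₁ < s
  h_gt : A.κ + C₀ + C₁ + c₁ + A.T₀ < h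
  k_gt : 4 * h + 2 * c₁ + C₁ + C₀ + 4 * A.κ + s < k

namespace Inserter

variable {A : AxisSystem G Ω I} {Bs : BallSystem G} (P : Inserter A Bs)

/-- The threshold above which an index counts as crossed. -/
abbrev T : ℕ := 4 * P.h

theorem T₀_le : A.T₀ ≤ P.T := by have := P.h_gt; simp only [T]; omega

theorem two_κ_lt : 2 * A.κ < P.T := by have := P.h_gt; simp only [T]; omega

/-- The indices crossed by `x`. -/
noncomputable abbrev Rx (x : G) : Finset I := A.R P.T P.o (x • P.o)

theorem mem_Rx {x : G} {i : I} : i ∈ P.Rx x ↔ P.T ≤ A.d i P.o (x • P.o) := mem_R P.T₀_le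

theorem smul_mem_Rx {x : G} {i : I} : x • i ∈ P.Rx x ↔ i ∈ P.Rx x⁻¹ := by
  rw [mem_Rx, mem_Rx, A.dist_comm, ← A.smul_eq x⁻¹, inv_smul_smul, inv_smul_smul]

/-- `e` may be inserted at the prefix `y` of `x`. -/
def Permitted (y x : G) (e : I) : Prop :=
  e ∈ P.U ∧ A.d e P.o (y⁻¹ • P.o) ≤ P.c₁ ∧ A.d e P.o (y⁻¹ • x • P.o) ≤ P.c₁

open Classical in
theorem card_not_permitted (y x : G) : (P.U.filter fun e => ¬ P.Permitted y x e).card ≤ 2 := by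
  have hsub : (P.U.filter fun e => ¬ P.Permitted y x e) ⊆
      (P.U.filter fun e => P.c₁ < A.d e P.o (y⁻¹ • P.o)) ∪
        P.U.filter fun e => P.c₁ < A.d e P.o (y⁻¹ • x • P.o) := by
    intro e he
    rw [Finset.mem_filter] at he
    rw [Finset.mem_union, Finset.mem_filter, Finset.mem_filter]
    by_contra hcon
    apply he.2
    refine ⟨he.1, ?_, ?_⟩
    · by_contra h
      exact hcon (Or.inl ⟨he.1, by omega⟩)
    · by_contra h
      exact hcon (Or.inr ⟨he.1, by omega⟩)
  have h1 : ∀ ξ, (P.U.filter fun e => P.c₁ < A.d e P.o ξ).card ≤ 1 := by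
    intro ξ
    rw [Finset.card_le_one]
    intro a ha b hb
    simp only [Finset.mem_filter] at ha hb
    by_contra hne
    rcases P.near ξ a ha.1 b hb.1 hne with h | h <;> omega
  refine (Finset.card_le_card hsub).trans ((Finset.card_union_le _ _).trans ?_)
  have := h1 (y⁻¹ • P.o)
  have := h1 (y⁻¹ • x • P.o)
  omega

theorem exists_permitted (y x : G) : ∃ e, P.Permitted y x e := by
  classical
  by_contra hcon
  push Not at hcon
  have := P.card_not_permitted y x
  rw [Finset.filter_true_of_mem fun e _ => hcon e] at this
  have := P.three_le
  omega

theorem pow_fix (i : I) (n : ℕ) : P.el i ^ n • i = i := by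
  induction n with
  | zero => simp
  | succ n ih => rw [pow_succ, mul_smul, P.el_fix, ih]

theorem pow_inv_fix (i : I) (n : ℕ) : (P.el i ^ n)⁻¹ • i = i := by
  rw [inv_smul_eq_iff, P.pow_fix]

theorem le_dist_pow (i : I) (a b : Ω) (n : ℕ) : n ≤ A.d i a (P.el i ^ n • b) + A.d i a b := by
  have h1 := P.el_far i a n
  have h2 := A.dist_tri i a (P.el i ^ n • b) (P.el i ^ n • a)
  have h3 := A.smul_eq (P.el i ^ n) i b a
  rw [P.pow_fix, A.dist_comm i b a] at h3
  omega

theorem le_dist_pow_inv (i : I) (a b : Ω) (n : ℕ) :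
    n ≤ A.d i a ((P.el i ^ n)⁻¹ • b) + A.d i a b := by
  have h1 := P.le_dist_pow i b a n
  have h3 := A.smul_eq (P.el i ^ n)⁻¹ i (P.el i ^ n • a) b
  rw [P.pow_inv_fix, inv_smul_smul] at h3
  rw [h3, A.dist_comm i _ b, A.dist_comm i a b]
  exact h1

theorem el_smul_pow (y : G) (e : I) (n : ℕ) : P.el (y • e) ^ n = y * P.el e ^ n * y⁻¹ := by
  rw [P.el_smul, conj_pow]

variable {P}

theorem Permitted.dist_left {y x : G} {e : I} (h : P.Permitted y x e) :
    A.d (y • e) (y • P.o) P.o ≤ P.c₁ := by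
  have := A.smul_eq y e P.o (y⁻¹ • P.o)
  rw [smul_inv_smul] at this
  rw [this]; exact h.2.1

theorem Permitted.dist_right {y x : G} {e : I} (h : P.Permitted y x e) :
    A.d (y • e) (y • P.o) (x • P.o) ≤ P.c₁ := by
  have := A.smul_eq y e P.o (y⁻¹ • x • P.o)
  rw [smul_inv_smul] at this
  rw [this]; exact h.2.2

theorem Permitted.dist_le {y x : G} {e : I} (h : P.Permitted y x e) :
    A.d (y • e) P.o (x • P.o) ≤ 2 * P.c₁ := by
  have h1 := h.dist_left
  have h2 := h.dist_right
  have h3 := A.dist_tri (y • e) P.o (y • P.o) (x • P.o)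
  rw [A.dist_comm _ P.o (y • P.o)] at h3
  omega

theorem Permitted.dist_step {y x : G} {e : I} (h : P.Permitted y x e) (ρ : I) :
    A.d ρ (y • P.o) (P.el (y • e) ^ P.s • y • P.o) ≤ P.C₁ := by
  rw [P.el_smul_pow, ← A.smul_eq y⁻¹, inv_smul_smul, smul_smul, smul_smul]
  convert P.lip_el e h.1 (y⁻¹ • ρ) using 3
  group

theorem Permitted.dist_step_inv {y x : G} {e : I} (h : P.Permitted y x e) (ρ : I) :
    A.d ρ (y • P.o) ((P.el (y • e) ^ P.s)⁻¹ • y • P.o) ≤ P.C₁ := by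
  have := h.dist_step (P.el (y • e) ^ P.s • ρ)
  rwa [A.dist_comm, ← A.smul_eq (P.el (y • e) ^ P.s)⁻¹, inv_smul_smul, inv_smul_smul] at this

/-- The element obtained from `x` by inserting a long translation along `e` at `y`. -/
noncomputable abbrev ins (P : Inserter A Bs) (y x : G) (e : I) : G := P.el (y • e) ^ P.k * x

theorem Permitted.ne_of_crossed {y x : G} {e ρ : I} (h : P.Permitted y x e)
    (hρ : P.T ≤ A.d ρ P.o (x • P.o)) : y • e ≠ ρ := by
  rintro rfl
  have := h.dist_le
  have := P.h_gt
  simp only [T] at hρ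
  omega

theorem Permitted.far {y x : G} {e : I} (h : P.Permitted y x e) :
    P.k ≤ A.d (y • e) P.o (P.ins y x e • P.o) + 2 * P.c₁ := by
  have h1 := P.le_dist_pow (y • e) P.o (x • P.o) P.k
  have h2 := h.dist_le
  rw [mul_smul]
  omega

theorem ins_far (y x : G) (e : I) :
    P.k ≤ A.d (y • e) (x • P.o) (P.ins y x e • P.o) + A.κ := by
  have h1 := P.le_dist_pow (y • e) (x • P.o) (x • P.o) P.k
  have h2 := A.self_le (y • e) (x • P.o)
  rw [mul_smul]
  omega

theorem Permitted.eq_far {y x : G} {e ρ : I} (h : P.Permitted y x e)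
    (hρ : P.T ≤ A.d ρ P.o (x • P.o)) (ω : Ω) :
    A.d ρ (P.ins y x e • P.o) ω = A.d ρ (P.el (y • e) ^ P.s • y • P.o) ω := by
  have h0 := P.two_κ_lt
  have h1 := P.le_dist_pow (y • e) P.o (y • P.o) P.s
  have h2 := P.le_dist_pow (y • e) (x • P.o) (y • P.o) P.s
  have h3 := h.dist_left
  have h4 := h.dist_right
  have h5 := P.s_gt
  have h6 := P.k_gt
  have h7 := h.far
  have h8 := ins_far (P := P) y x e
  rw [A.dist_comm] at h3
  rw [A.dist_comm] at h4
  refine eq_of_far (h.ne_of_crossed hρ) (a := P.o) (c := x • P.o) (by omega) (by omega) (by omega)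
    ?_ ?_ ω
  · rw [A.dist_comm]; omega
  · rw [A.dist_comm]; omega

theorem Permitted.eq_far_inv {y x : G} {e ρ : I} (h : P.Permitted y x e)
    (hρ : P.T ≤ A.d ρ P.o (x • P.o)) (ω : Ω) :
    A.d ρ ((P.el (y • e) ^ P.k)⁻¹ • P.o) ω = A.d ρ ((P.el (y • e) ^ P.s)⁻¹ • y • P.o) ω := by
  have h0 := P.two_κ_lt
  have h1 := P.le_dist_pow_inv (y • e) P.o (y • P.o) P.s
  have h2 := P.le_dist_pow_inv (y • e) (x • P.o) (y • P.o) P.s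
  have h3 := h.dist_left
  have h4 := h.dist_right
  have h5 := P.s_gt
  have h6 := P.k_gt
  have h7 := P.le_dist_pow_inv (y • e) P.o P.o P.k
  have h8 := P.le_dist_pow_inv (y • e) (x • P.o) P.o P.k
  have h9 := h.dist_le
  have h10 := A.self_le (y • e) P.o
  rw [A.dist_comm _ (x • P.o) P.o] at h8
  rw [A.dist_comm] at h3
  rw [A.dist_comm] at h4
  refine eq_of_far (h.ne_of_crossed hρ) (a := P.o) (c := x • P.o) (by omega) (by omega) (by omega)
    ?_ ?_ ω
  · rw [A.dist_comm]; omega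
  · rw [A.dist_comm]; omega

theorem Permitted.near_far {y x : G} {e ρ : I} (h : P.Permitted y x e)
    (hρ : P.T ≤ A.d ρ P.o (x • P.o)) (ω : Ω) :
    A.d ρ ω (P.ins y x e • P.o) ≤ A.d ρ ω (y • P.o) + P.C₁ ∧
      A.d ρ ω (y • P.o) ≤ A.d ρ ω (P.ins y x e • P.o) + P.C₁ := by
  rw [A.dist_comm ρ ω (P.ins y x e • P.o), h.eq_far hρ,
    A.dist_comm ρ (P.el (y • e) ^ P.s • y • P.o) ω]
  have h1 := h.dist_step ρ
  have h2 := A.dist_tri ρ ω (y • P.o) (P.el (y • e) ^ P.s • y • P.o)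
  have h3 := A.dist_tri ρ ω (P.el (y • e) ^ P.s • y • P.o) (y • P.o)
  rw [A.dist_comm ρ (P.el (y • e) ^ P.s • y • P.o) (y • P.o)] at h3
  omega

theorem Permitted.near_far_inv {y x : G} {e ρ : I} (h : P.Permitted y x e)
    (hρ : P.T ≤ A.d ρ P.o (x • P.o)) (ω : Ω) :
    A.d ρ ω (y • P.o) ≤ A.d ρ ω ((P.el (y • e) ^ P.k)⁻¹ • P.o) + P.C₁ := by
  rw [A.dist_comm ρ ω ((P.el (y • e) ^ P.k)⁻¹ • P.o), h.eq_far_inv hρ,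
    A.dist_comm ρ ((P.el (y • e) ^ P.s)⁻¹ • y • P.o) ω]
  have h1 := h.dist_step_inv ρ
  have h3 := A.dist_tri ρ ω ((P.el (y • e) ^ P.s)⁻¹ • y • P.o) (y • P.o)
  rw [A.dist_comm ρ ((P.el (y • e) ^ P.s)⁻¹ • y • P.o) (y • P.o)] at h3
  omega

end Inserter

end AxisSystem

namespace AxisSystem.Inserter

variable {G Ω I : Type*} [Group G] [MulAction G Ω] [MulAction G I]
  {A : AxisSystem G Ω I} {Bs : BallSystem G} (P : Inserter A Bs)

/-- `x'` is obtained from `x` by an insertion halfway through the crossing of `ρ`. -/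
def HalfIns (x : G) (ρ : I) (x' : G) : Prop :=
  ∃ y y' e, P.Permitted y x e ∧ x' = P.ins y x e ∧ y⁻¹ * y' ∈ Bs.B 1 ∧
    A.d ρ P.o (y • P.o) ≤ P.h ∧ P.h < A.d ρ P.o (y' • P.o)

theorem dist_le_of_step {y y' : G} (h : y⁻¹ * y' ∈ Bs.B 1) (ρ : I) :
    A.d ρ (y • P.o) (y' • P.o) ≤ P.C₀ := by
  have := P.lip _ h (y⁻¹ • ρ)
  rwa [← A.smul_eq y, smul_inv_smul, smul_smul, mul_inv_cancel_left] at this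

variable {P}

theorem HalfIns.bounds {x x' : G} {ρ : I} (H : P.HalfIns x ρ x')
    (hρ : P.T ≤ A.d ρ P.o (x • P.o)) :
    P.h < A.d ρ P.o (x' • P.o) + P.C₀ + P.C₁ ∧ A.d ρ P.o (x' • P.o) ≤ P.h + P.C₁ := by
  obtain ⟨y, y', e, hp, rfl, hy, h1, h2⟩ := H
  have h3 := P.dist_le_of_step hy ρ
  have h4 := hp.near_far hρ P.o
  have h5 := A.dist_tri ρ P.o (y • P.o) (y' • P.o)
  omega

theorem HalfIns.unique {x₁ x₂ x' : G} {ρ : I} (H₁ : P.HalfIns x₁ ρ x') (H₂ : P.HalfIns x₂ ρ x')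
    (hρ₁ : P.T ≤ A.d ρ P.o (x₁ • P.o)) (hρ₂ : P.T ≤ A.d ρ P.o (x₂ • P.o)) : x₁ = x₂ := by
  have hb := H₁.bounds hρ₁
  have key : ∀ {x₁ x₂ y₁ y₂ y₂' : G} {e₁ e₂ : I}, P.T ≤ A.d ρ P.o (x₁ • P.o) →
      P.Permitted y₁ x₁ e₁ → P.Permitted y₂ x₂ e₂ →
      x' = P.ins y₁ x₁ e₁ → x' = P.ins y₂ x₂ e₂ → y₂⁻¹ * y₂' ∈ Bs.B 1 →
      A.d ρ P.o (y₂ • P.o) ≤ P.h → P.h < A.d ρ P.o (y₂' • P.o) →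
      A.Before (y₁ • e₁) (y₂ • e₂) P.o (x' • P.o) → False := by
    intro x₁ x₂ y₁ y₂ y₂' e₁ e₂ hρ p₁ p₂ hx₁ hx₂ hs hle hlt hbef
    have hT := P.two_κ_lt
    have hk := P.k_gt
    have hh := P.h_gt
    have hs' := P.s_gt
    have f1 := p₁.far
    have f2 := ins_far (P := P) y₁ x₁ e₁
    rw [← hx₁] at f1 f2
    have hbρ : A.Before ρ (y₁ • e₁) P.o (x' • P.o) := by
      refine before_of_near (p₁.ne_of_crossed hρ) (c := x₁ • P.o) (by omega) ?_ ?_ (by omega)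
      · rw [A.dist_comm]; omega
      · rw [A.dist_comm]; omega
    have g1 := P.le_dist_pow (y₂ • e₂) P.o (y₂ • P.o) P.s
    have g2 := p₂.dist_left
    rw [A.dist_comm] at g2
    have g3 := hbef.1 (P.el (y₂ • e₂) ^ P.s • y₂ • P.o) (by rw [A.dist_comm]; omega) P.o
    have g4 := p₂.dist_step (y₁ • e₁)
    have g5 := A.dist_tri (y₁ • e₁) P.o (y₂ • P.o) (P.el (y₂ • e₂) ^ P.s • y₂ • P.o)
    rw [A.dist_comm, A.dist_comm _ (x' • P.o)] at g3
    have g6 := P.dist_le_of_step hs (y₁ • e₁)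
    have g7 := A.dist_tri (y₁ • e₁) P.o (y₂' • P.o) (y₂ • P.o)
    rw [A.dist_comm _ (y₂' • P.o)] at g7
    have e1 := hbρ.1 (y₂ • P.o) (by rw [A.dist_comm]; omega) P.o
    have e2 := hbρ.1 (y₂' • P.o) (by rw [A.dist_comm]; omega) P.o
    rw [A.dist_comm ρ _ P.o] at e1 e2
    omega
  have hT := P.two_κ_lt
  have hk := P.k_gt
  have hh := P.h_gt
  obtain ⟨y₁, y₁', e₁, p₁, hx₁, hs₁, a₁, b₁⟩ := H₁
  obtain ⟨y₂, y₂', e₂, p₂, hx₂, hs₂, a₂, b₂⟩ := H₂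
  have f1 := p₁.far
  have f2 := p₂.far
  rw [← hx₁] at f1
  rw [← hx₂] at f2
  by_cases hne : y₁ • e₁ = y₂ • e₂
  · rw [hx₁, ins, ins, hne] at hx₂
    exact mul_left_cancel hx₂
  rcases A.before_or _ _ P.o (x' • P.o) hne (by omega) (by omega) with h | h
  · exact (key hρ₁ p₁ p₂ hx₁ hx₂ hs₂ a₂ b₂ h).elim
  · exact (key hρ₂ p₂ p₁ hx₂ hx₁ hs₁ a₁ b₁ h).elim

variable (P)

theorem exists_crossing {f : ℕ → ℕ} {m h : ℕ} (h0 : f 0 ≤ h) (hm : h < f m) :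
    ∃ j < m, f j ≤ h ∧ h < f (j + 1) := by
  induction m with
  | zero => omega
  | succ m ih =>
    rcases Nat.lt_or_ge h (f m) with h1 | h1
    · obtain ⟨j, hj, h2⟩ := ih h1
      exact ⟨j, by omega, h2⟩
    · exact ⟨m, by omega, h1, hm⟩

theorem exists_halfIns {m : ℕ} {x : G} (hx : x ∈ Bs.B m) {ρ : I}
    (hρ : P.T ≤ A.d ρ P.o (x • P.o)) : ∃ x' ∈ Bs.B (m + P.c), P.HalfIns x ρ x' := by
  obtain ⟨p, p0, pm, pstep, pmem⟩ := Bs.path m x hx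
  have hT := P.two_κ_lt
  have hh := P.h_gt
  have h0 := A.self_le ρ P.o
  simp only [T] at hρ
  obtain ⟨j, hj, h1, h2⟩ := exists_crossing (f := fun j => A.d ρ P.o (p j • P.o)) (m := m)
    (h := P.h) (by simp only [p0, one_smul]; omega) (by simp only [pm]; omega)
  obtain ⟨e, he⟩ := P.exists_permitted (p j) x
  refine ⟨_, ?_, p j, p (j + 1), e, he, rfl, pstep j, h1, h2⟩
  rw [ins, P.el_smul_pow]
  exact Bs.conj_mem pmem hj.le (P.el_mem e he.1)

theorem card_mul_le {m L : ℕ} (bad : Finset G) (hbad : bad ⊆ Bs.B m) (W : G → Finset I)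
    (hW : ∀ x ∈ bad, W x ⊆ P.Rx x) (hL : ∀ x ∈ bad, L ≤ (W x).card)
    (htwo : ∀ x' (s : Finset I), (∀ ρ ∈ s, ∃ x ∈ bad, ρ ∈ W x ∧ P.HalfIns x ρ x') → s.card ≤ 2) :
    bad.card * L ≤ 2 * (Bs.B P.c).card * (Bs.B m).card := by
  classical
  have hex : ∀ q : (_ : G) × I, q ∈ bad.sigma W → ∃ x' ∈ Bs.B (m + P.c), P.HalfIns q.1 q.2 x' := by
    intro q hq
    rw [Finset.mem_sigma] at hq
    exact P.exists_halfIns (hbad hq.1) (P.mem_Rx.1 (hW _ hq.1 hq.2))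
  choose! F hF1 hF2 using hex
  have h1 : (bad.sigma W).card ≤ 2 * ((bad.sigma W).image F).card := by
    refine Finset.card_le_mul_card_image _ _ fun x' hx' => ?_
    have hinj : Set.InjOn (fun q : (_ : G) × I => q.2)
        ((bad.sigma W).filter fun q => F q = x' : Finset _) := by
      rintro ⟨x₁, ρ₁⟩ hq₁ ⟨x₂, ρ₂⟩ hq₂ (h : ρ₁ = ρ₂)
      subst h
      rw [Finset.mem_coe, Finset.mem_filter] at hq₁ hq₂
      have e1 := hF2 _ hq₁.1
      have e2 := hF2 _ hq₂.1
      rw [hq₁.2] at e1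
      rw [hq₂.2] at e2
      have m1 := Finset.mem_sigma.1 hq₁.1
      have m2 := Finset.mem_sigma.1 hq₂.1
      have := e1.unique e2 (P.mem_Rx.1 (hW _ m1.1 m1.2)) (P.mem_Rx.1 (hW _ m2.1 m2.2))
      simp only at this
      rw [this]
    rw [← Finset.card_image_of_injOn hinj]
    refine htwo x' _ fun ρ hρ => ?_
    obtain ⟨q, hq, rfl⟩ := Finset.mem_image.1 hρ
    rw [Finset.mem_filter] at hq
    have m1 := Finset.mem_sigma.1 hq.1
    exact ⟨q.1, m1.1, m1.2, hq.2 ▸ hF2 _ hq.1⟩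
  have h2 : ((bad.sigma W).image F).card ≤ (Bs.B (m + P.c)).card := by
    refine Finset.card_le_card fun y hy => ?_
    obtain ⟨q, hq, rfl⟩ := Finset.mem_image.1 hy
    exact hF1 q hq
  have h3 := Bs.card_add_le m P.c
  have h4 : bad.card * L ≤ (bad.sigma W).card := by
    rw [Finset.card_sigma, ← smul_eq_mul]
    exact Finset.card_nsmul_le_sum _ _ _ hL
  calc bad.card * L ≤ 2 * ((Bs.B m).card * (Bs.B P.c).card) := by omega
    _ = _ := by ring

open Classical in
theorem card_inter_le (m L : ℕ) (w : G) :
    ((Bs.B m).filter fun x => L ≤ (P.Rx x ∩ P.Rx w).card).card * L ≤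
      2 * (Bs.B P.c).card * (Bs.B m).card := by
  refine P.card_mul_le _ (Finset.filter_subset _ _) (fun x => P.Rx x ∩ P.Rx w)
    (fun x _ => Finset.inter_subset_left) (fun x hx => (Finset.mem_filter.1 hx).2) ?_
  intro x' s hs
  have hh := P.h_gt
  refine card_partial_le_two (T' := A.κ + 1) (T'' := P.h + P.C₁) P.T₀_le P.two_κ_lt
    (by omega) (by simp only [T]; omega) P.o (w • P.o) (x' • P.o) s ?_ ?_
  · intro ρ hρ
    obtain ⟨x, -, h, -⟩ := hs ρ hρ
    exact (Finset.mem_inter.1 h).2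
  · intro ρ hρ
    obtain ⟨x, -, h, h'⟩ := hs ρ hρ
    have := h'.bounds (P.mem_Rx.1 (Finset.mem_inter.1 h).1)
    omega

/-- The indices crossed by both `x` and `x⁻¹` form an initial segment. -/
theorem mem_inter_of_before {x : G} {ρ ρ' : I} (h2 : ρ ∈ P.Rx x⁻¹)
    (h3 : ρ' ∈ P.Rx x) (h : A.Before ρ' ρ P.o (x • P.o)) : ρ' ∈ P.Rx x⁻¹ := by
  rw [mem_Rx] at *
  have hT := P.two_κ_lt
  have := h.1 (x⁻¹ • P.o) (by rw [A.dist_comm]; omega) P.o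
  rw [A.dist_comm, this, A.dist_comm]
  exact h3

theorem before_inv_of_before {x : G} {ρ ρ' : I} (h1 : ρ ∈ P.Rx x) (h2 : ρ ∈ P.Rx x⁻¹)
    (h3 : ρ' ∈ P.Rx x) (h : A.Before ρ' ρ P.o (x • P.o)) :
    A.Before ρ' ρ P.o (x⁻¹ • P.o) := by
  have h4 := P.mem_inter_of_before h2 h3 h
  rw [mem_Rx] at *
  have hT := P.two_κ_lt
  have hne : ρ' ≠ ρ := by
    rintro rfl
    exact Before.irrefl (by omega) h
  rcases A.before_or ρ' ρ P.o (x⁻¹ • P.o) hne (by omega) (by omega) with h' | h'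
  · exact h'
  exfalso
  obtain ⟨ζ, z1, z2⟩ := A.exists_far ρ' P.o (x • P.o) A.κ
  have e1 := h'.1 ζ z1 P.o
  rw [A.dist_comm _ (x⁻¹ • P.o)] at e1
  have e2 := h.1 ζ (by omega) (x • P.o)
  have := A.self_le ρ' (x • P.o)
  omega

theorem bef_eq_bef_inv {x : G} {ρ : I} (h1 : ρ ∈ P.Rx x) (h2 : ρ ∈ P.Rx x⁻¹) :
    A.bef P.T ρ P.o (x • P.o) = A.bef P.T ρ P.o (x⁻¹ • P.o) := by
  ext ρ'
  rw [mem_bef P.T₀_le, mem_bef P.T₀_le, ← P.mem_Rx, ← P.mem_Rx]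
  constructor
  · rintro ⟨h3, h4⟩
    exact ⟨P.mem_inter_of_before h2 h3 h4, P.before_inv_of_before h1 h2 h3 h4⟩
  · rintro ⟨h3, h4⟩
    have h5 := P.mem_inter_of_before (by rwa [inv_inv]) h3 h4
    have h6 := P.before_inv_of_before h2 (by rwa [inv_inv]) h3 h4
    rw [inv_inv] at h5 h6
    exact ⟨h5, h6⟩

theorem card_bef_smul {x : G} {ρ : I} :
    (A.bef P.T (x • ρ) (x • P.o) P.o).card = (A.bef P.T ρ P.o (x⁻¹ • P.o)).card := by
  symm
  refine Finset.card_bij (fun i _ => x • i) (fun i hi => ?_)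
    (fun i _ j _ h => MulAction.injective x h) fun j hj => ⟨x⁻¹ • j, ?_, smul_inv_smul x j⟩
  · rw [mem_bef P.T₀_le] at hi ⊢
    rw [← before_smul_iff x, ← A.smul_eq x, smul_inv_smul] at hi
    exact hi
  · rw [mem_bef P.T₀_le] at hj ⊢
    rw [← before_smul_iff x⁻¹, ← A.smul_eq x⁻¹, inv_smul_smul, inv_smul_smul] at hj
    exact hj

theorem before_smul_of_card {x : G} {L : ℕ} {ρ : I} (h1 : ρ ∈ P.Rx x) (h2 : ρ ∈ P.Rx x⁻¹)
    (hL : (A.bef P.T ρ P.o (x • P.o)).card < L) (hN : 2 * L ≤ (P.Rx x).card) :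
    A.Before ρ (x • ρ) P.o (x • P.o) := by
  have hT := P.two_κ_lt
  have h3 := P.smul_mem_Rx.2 h2
  simp only [Rx] at hN
  have c1 := P.card_bef_smul (x := x) (ρ := ρ)
  rw [← P.bef_eq_bef_inv h1 h2] at c1
  rw [mem_Rx] at h1 h3
  have c2 := bef_add_bef P.T₀_le hT h3
  have hlt : (A.bef P.T ρ P.o (x • P.o)).card < (A.bef P.T (x • ρ) P.o (x • P.o)).card := by
    omega
  rcases eq_or_ne ρ (x • ρ) with he | he
  · rw [← he] at hlt; omega
  rcases A.before_or ρ (x • ρ) P.o (x • P.o) he (by omega) (by omega) with h | h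
  · exact h
  · have := bef_card_lt P.T₀_le hT h3 h1 h
    omega

open Classical in
theorem card_inter_inv_le (m L : ℕ) :
    ((Bs.B m).filter fun x => 2 * L ≤ (P.Rx x).card ∧ L ≤ (P.Rx x ∩ P.Rx x⁻¹).card).card * L ≤
      2 * (Bs.B P.c).card * (Bs.B m).card := by
  have hT := P.two_κ_lt
  refine P.card_mul_le _ (Finset.filter_subset _ _)
    (fun x => (P.Rx x ∩ P.Rx x⁻¹).filter fun ρ => (A.bef P.T ρ P.o (x • P.o)).card < L)
    (fun x _ => (Finset.filter_subset _ _).trans Finset.inter_subset_left) (fun x hx => ?_) ?_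
  · rw [Finset.mem_filter] at hx
    have hinj : Set.InjOn (fun i => (A.bef P.T i P.o (x • P.o)).card)
        (P.Rx x ∩ P.Rx x⁻¹ : Finset I) :=
      (bef_card_injOn P.T₀_le hT P.o (x • P.o)).mono
        (Finset.coe_subset.2 Finset.inter_subset_left)
    have himg : (P.Rx x ∩ P.Rx x⁻¹).image (fun i => (A.bef P.T i P.o (x • P.o)).card) =
        Finset.range (P.Rx x ∩ P.Rx x⁻¹).card := by
      refine Finset.eq_of_subset_of_card_le (fun n hn => ?_) ?_
      · obtain ⟨i, hi, rfl⟩ := Finset.mem_image.1 hn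
        rw [Finset.mem_range]
        have hi' := Finset.mem_inter.1 hi
        refine Finset.card_lt_card ⟨fun k hk => ?_, fun hs => ?_⟩
        · rw [mem_bef P.T₀_le, ← P.mem_Rx] at hk
          exact Finset.mem_inter.2 ⟨hk.1, P.mem_inter_of_before hi'.2 hk.1 hk.2⟩
        · have := (mem_bef P.T₀_le).1 (hs hi)
          exact Before.irrefl (by omega) this.2
      · rw [Finset.card_range, Finset.card_image_of_injOn hinj]
    calc L = (Finset.range L).card := (Finset.card_range L).symm
      _ ≤ (((P.Rx x ∩ P.Rx x⁻¹).filter fun ρ => (A.bef P.T ρ P.o (x • P.o)).card < L).image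
          (fun i => (A.bef P.T i P.o (x • P.o)).card)).card := by
        refine Finset.card_le_card fun n hn => ?_
        rw [Finset.mem_range] at hn
        have : n ∈ (P.Rx x ∩ P.Rx x⁻¹).image (fun i => (A.bef P.T i P.o (x • P.o)).card) := by
          rw [himg, Finset.mem_range]
          exact hn.trans_le hx.2.2
        obtain ⟨i, hi, rfl⟩ := Finset.mem_image.1 this
        exact Finset.mem_image_of_mem _ (Finset.mem_filter.2 ⟨hi, hn⟩)
      _ ≤ _ := Finset.card_image_le
  · intro x' s hs
    have hh := P.h_gt
    have hk := P.k_gt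
    refine card_partial_le_two (A := A) (T := P.T - P.C₁) (T' := A.κ + 1) (T'' := P.h + P.C₁)
      (by simp only [T]; omega) (by simp only [T]; omega) (by omega) (by simp only [T]; omega)
      P.o (x'⁻¹ • P.o) (x' • P.o) s ?_ ?_
    · intro ρ hρ
      obtain ⟨x, hx, hρx, y, y', e, hp, rfl, hy, ha, hb⟩ := hs ρ hρ
      rw [Finset.mem_filter] at hx hρx
      rw [Finset.mem_inter] at hρx
      have hbef := P.before_smul_of_card hρx.1.1 hρx.1.2 hρx.2 hx.2.1
      have h1 := P.mem_Rx.1 hρx.1.1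
      have h2 := P.mem_Rx.1 (P.smul_mem_Rx.2 hρx.1.2)
      rw [mem_R (A := A) (by simp only [T]; omega), ← A.smul_eq x, mul_inv_rev, mul_smul,
        smul_inv_smul]
      have h3 := hp.near_far_inv h2 (x • P.o)
      have h4 := A.dist_tri ρ P.o (y • P.o) (x • P.o)
      have h5 := hbef.2 (y • P.o) (by simp only [T] at h1; omega) (x • P.o)
      rw [A.dist_comm] at h5
      simp only [T] at h2 ⊢
      omega
    · intro ρ hρ
      obtain ⟨x, hx, hρx, h'⟩ := hs ρ hρ
      have := h'.bounds (P.mem_Rx.1 (Finset.mem_inter.1 (Finset.mem_filter.1 hρx).1).1)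
      omega

end AxisSystem.Inserter

theorem exists_eq_of_step_le_one {ν : ℕ → ℕ} (h0 : ν 0 = 0) (hs : ∀ j, ν (j + 1) ≤ ν j + 1)
    {m v : ℕ} (hv : v ≤ ν m) : ∃ j ≤ m, ν j = v := by
  induction m with
  | zero => exact ⟨0, le_rfl, by omega⟩
  | succ m ih =>
    by_cases h : v ≤ ν m
    · obtain ⟨j, hj, e⟩ := ih h
      exact ⟨j, by omega, e⟩
    · exact ⟨m + 1, le_rfl, by have := hs m; omega⟩

namespace BallSystem

variable {G : Type*} [Group G] (Bs : BallSystem G)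

theorem pow_mem {l : ℕ} {a : G} (ha : a ∈ Bs.B l) (i : ℕ) : a ^ i ∈ Bs.B (l * i) := by
  induction i with
  | zero => simpa using Bs.one_mem 0
  | succ i ih =>
    rw [pow_succ, Nat.mul_succ]
    exact Bs.mul_mem ih ha

theorem eventually_linear_le {a b : G}
    (hab : Function.Injective fun q : ℕ × ℕ => a ^ q.1 * b ^ q.2) (K : ℕ) :
    ∀ᶠ m in atTop, K * (m + 1) ≤ (Bs.B m).card := by
  classical
  obtain ⟨la, ha⟩ := Bs.exists_mem a
  obtain ⟨lb, hb⟩ := Bs.exists_mem b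
  set l := la + lb + 1 with hl
  have ha' : a ∈ Bs.B l := Bs.mono (by omega) ha
  have hb' : b ∈ Bs.B l := Bs.mono (by omega) hb
  filter_upwards [Filter.eventually_ge_atTop (K * (2 * l) ^ 2)] with m hm
  set n := m / (2 * l) with hn
  have h1 : (n + 1) * (n + 1) ≤ (Bs.B m).card := by
    have hsub : ((Finset.range (n + 1) ×ˢ Finset.range (n + 1)).image
        fun q : ℕ × ℕ => a ^ q.1 * b ^ q.2) ⊆ Bs.B m := by
      intro x hx
      obtain ⟨⟨i, j⟩, hq, rfl⟩ := Finset.mem_image.1 hx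
      rw [Finset.mem_product, Finset.mem_range, Finset.mem_range] at hq
      simp only at hq ⊢
      refine Bs.mono ?_ (Bs.mul_mem (Bs.pow_mem ha' i) (Bs.pow_mem hb' j))
      have h2 : (2 * l) * n ≤ m := Nat.mul_div_le m (2 * l)
      have h3 : l * i ≤ l * n := Nat.mul_le_mul_left _ (by omega)
      have h4 : l * j ≤ l * n := Nat.mul_le_mul_left _ (by omega)
      have h5 : 2 * l * n = 2 * (l * n) := by ring
      omega
    have := Finset.card_le_card hsub
    rwa [Finset.card_image_of_injective _ hab, Finset.card_product, Finset.card_range] at this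
  have h2 : m + 1 ≤ (2 * l) * (n + 1) := by
    have := Nat.lt_mul_div_succ m (show 0 < 2 * l by omega)
    simpa [hn] using this
  have h3 : 0 < (2 * l) ^ 2 := by positivity
  refine le_of_mul_le_mul_left ?_ h3
  calc (2 * l) ^ 2 * (K * (m + 1)) = (K * (2 * l) ^ 2) * (m + 1) := by ring
    _ ≤ (m + 1) * (m + 1) := Nat.mul_le_mul_right _ (by omega)
    _ ≤ ((2 * l) * (n + 1)) * ((2 * l) * (n + 1)) := Nat.mul_le_mul h2 h2
    _ = (2 * l) ^ 2 * ((n + 1) * (n + 1)) := by ring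
    _ ≤ _ := Nat.mul_le_mul_left _ h1

variable (χ : G → ℤ) (hχ : ∀ g h, χ (g * h) = χ g + χ h)
include hχ

theorem exists_lipschitz : ∃ Λ : ℕ, ∀ m, ∀ x ∈ Bs.B m, |χ x| ≤ Λ * m := by
  have h1 : χ 1 = 0 := by have := hχ 1 1; rw [mul_one] at this; omega
  refine ⟨(Bs.B 1).sup fun x => (χ x).natAbs, fun m x hx => ?_⟩
  set Λ := (Bs.B 1).sup fun x => (χ x).natAbs with hΛ
  obtain ⟨p, p0, pm, pstep, -⟩ := Bs.path m x hx
  have key : ∀ j : ℕ, |χ (p j)| ≤ Λ * j := by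
    intro j
    induction j with
    | zero => simp [p0, h1]
    | succ j ih =>
      have e : χ (p (j + 1)) = χ (p j) + χ ((p j)⁻¹ * p (j + 1)) := by
        rw [← hχ, mul_inv_cancel_left]
      have h2 : (χ ((p j)⁻¹ * p (j + 1))).natAbs ≤ Λ :=
        Finset.le_sup (f := fun x => (χ x).natAbs) (pstep j)
      have h3 : |χ ((p j)⁻¹ * p (j + 1))| ≤ Λ := by
        rw [Int.abs_eq_natAbs]; exact_mod_cast h2
      rw [e]
      refine (abs_add_le _ _).trans ?_
      push_cast
      linarith
  rw [← pm]
  exact key m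

open Classical in
theorem card_near_subgroup_le {C : Subgroup G} (hC : Set.InjOn χ C) :
    ∃ Λ : ℕ, ∀ m Q, ((Bs.B m).filter fun x => ∃ b ∈ Bs.B Q, b⁻¹ * x ∈ C).card ≤
      (Bs.B Q).card * (2 * (Λ * (Q + m)) + 1) := by
  obtain ⟨Λ, hΛ⟩ := Bs.exists_lipschitz χ hχ
  refine ⟨Λ, fun m Q => ?_⟩
  have hsub : ((Bs.B m).filter fun x => ∃ b ∈ Bs.B Q, b⁻¹ * x ∈ C) ⊆
      ((Bs.B Q) ×ˢ ((Bs.B (Q + m)).filter fun x => x ∈ C)).image fun q => q.1 * q.2 := by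
    intro x hx
    rw [Finset.mem_filter] at hx
    obtain ⟨hx, b, hb, hbx⟩ := hx
    rw [Finset.mem_image]
    refine ⟨(b, b⁻¹ * x), ?_, by simp⟩
    rw [Finset.mem_product, Finset.mem_filter]
    exact ⟨hb, Bs.mul_mem (Bs.inv_mem hb) hx, hbx⟩
  have h2 : ((Bs.B (Q + m)).filter fun x => x ∈ C).card ≤ 2 * (Λ * (Q + m)) + 1 := by
    have := Finset.card_le_card_of_injOn (s := (Bs.B (Q + m)).filter fun x => x ∈ C)
      (t := Finset.Icc (-(Λ * (Q + m) : ℤ)) (Λ * (Q + m))) χ (fun x hx => ?_)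
      (hC.mono fun x hx => (Finset.mem_filter.1 hx).2)
    · rw [Int.card_Icc] at this
      refine this.trans ?_
      have : ((Λ : ℤ) * (Q + m) + 1 - -((Λ : ℤ) * (Q + m))) =
          ((2 * (Λ * (Q + m)) + 1 : ℕ) : ℤ) := by
        push_cast; ring
      rw [this, Int.toNat_natCast]
    · have := hΛ _ x (Finset.mem_filter.1 hx).1
      rw [Finset.mem_coe, Finset.mem_Icc, ← abs_le]
      exact_mod_cast this
  exact (Finset.card_le_card hsub).trans (Finset.card_image_le.trans
    ((Finset.card_product _ _).le.trans (Nat.mul_le_mul_left _ h2)))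

end BallSystem

namespace AxisSystem.Inserter

variable {G Ω I : Type*} [Group G] [MulAction G Ω] [MulAction G I]
  {A : AxisSystem G Ω I} {Bs : BallSystem G} (P : Inserter A Bs)

theorem card_candidates_le {M₀ : ℕ} (x' : G) (s : Finset I)
    (hs : ∀ i ∈ s, ∃ x y e, (P.Rx x).card ≤ M₀ ∧ P.Permitted y x e ∧ i = y • e ∧
      x' = P.ins y x e) : s.card ≤ M₀ + 3 := by
  have hT := P.two_κ_lt
  have hT₀ := P.T₀_le
  have hk := P.k_gt
  have hmem : ∀ i ∈ s, P.T ≤ A.d i P.o (x' • P.o) := by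
    intro i hi
    obtain ⟨x, y, e, -, hp, rfl, rfl⟩ := hs i hi
    have := hp.far
    simp only [T]
    omega
  refine card_filter_le_of_injOn s (fun i => (A.bef P.T i P.o (x' • P.o)).card)
    ((bef_card_injOn hT₀ hT P.o (x' • P.o)).mono fun i hi => ?_) ((P.Rx x').card - 1) (M₀ + 2)
    fun i hi => ?_
  · exact P.mem_Rx.2 (hmem i hi)
  · have h1 := bef_add_bef hT₀ hT (hmem i hi)
    have h2 := hmem i hi
    obtain ⟨x, y, e, hM, hp, rfl, rfl⟩ := hs i hi
    have f1 := P.le_dist_pow (y • e) P.o P.o P.k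
    have f2 := A.self_le (y • e) P.o
    have f3 := P.le_dist_pow (y • e) (x • P.o) (x • P.o) P.k
    have f4 := A.self_le (y • e) (x • P.o)
    rw [ins, mul_smul] at h1 h2 ⊢
    have b1 := bef_le_aft hT₀ hT (P.pow_fix (y • e) P.k) (by omega) h2
    have b2 := aft_le_bef hT₀ hT (P.pow_fix (y • e) P.k) (a := P.o) (c := x • P.o) (by omega) h2
    simp only [Rx, mul_smul] at hM ⊢
    omega

theorem card_many_le {m D M₀ : ℕ} (bad : Finset G) (W : G → Finset I)
    (hM : ∀ x ∈ bad, (P.Rx x).card ≤ M₀) (hD : ∀ x ∈ bad, D ≤ (W x).card)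
    (hW : ∀ x ∈ bad, ∀ i ∈ W x, ∃ y e, P.Permitted y x e ∧ i = y • e ∧
      P.ins y x e ∈ Bs.B (m + P.c)) :
    bad.card * D ≤ (M₀ + 3) * (Bs.B P.c).card * (Bs.B m).card := by
  classical
  set F : ((_ : G) × I) → G := fun q => P.el q.2 ^ P.k * q.1 with hF
  have h1 : (bad.sigma W).card ≤ (M₀ + 3) * ((bad.sigma W).image F).card := by
    refine Finset.card_le_mul_card_image _ _ fun x' hx' => ?_
    have hinj : Set.InjOn (fun q : (_ : G) × I => q.2)
        ((bad.sigma W).filter fun q => F q = x' : Finset _) := by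
      rintro ⟨x₁, ρ₁⟩ hq₁ ⟨x₂, ρ₂⟩ hq₂ (h : ρ₁ = ρ₂)
      subst h
      rw [Finset.mem_coe, Finset.mem_filter] at hq₁ hq₂
      have := mul_left_cancel (hq₁.2.trans hq₂.2.symm)
      simp only at this
      rw [this]
    rw [← Finset.card_image_of_injOn hinj]
    refine P.card_candidates_le x' _ fun ρ hρ => ?_
    obtain ⟨q, hq, rfl⟩ := Finset.mem_image.1 hρ
    rw [Finset.mem_filter, Finset.mem_sigma] at hq
    obtain ⟨y, e, hp, he, -⟩ := hW _ hq.1.1 _ hq.1.2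
    exact ⟨q.1, y, e, hM _ hq.1.1, hp, he, by rw [ins, ← he]; exact hq.2.symm⟩
  have h2 : ((bad.sigma W).image F).card ≤ (Bs.B (m + P.c)).card := by
    refine Finset.card_le_card fun y hy => ?_
    obtain ⟨q, hq, rfl⟩ := Finset.mem_image.1 hy
    rw [Finset.mem_sigma] at hq
    obtain ⟨y, e, -, he, hmem⟩ := hW _ hq.1 _ hq.2
    rw [ins, ← he] at hmem
    exact hmem
  have h3 := Bs.card_add_le m P.c
  have h4 : bad.card * D ≤ (bad.sigma W).card := by
    rw [Finset.card_sigma, ← smul_eq_mul]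
    exact Finset.card_nsmul_le_sum _ _ _ hD
  calc bad.card * D ≤ (M₀ + 3) * ((bad.sigma W).image F).card := h4.trans h1
    _ ≤ (M₀ + 3) * ((Bs.B m).card * (Bs.B P.c).card) := Nat.mul_le_mul_left _ (h2.trans h3)
    _ = _ := by ring

open Classical in
theorem near_subgroup_of_few {C : Subgroup G} [C.Normal]
    (hC : ∀ g : G, ∀ V ⊆ P.U, (P.U \ V).card ≤ 2 → (∀ e ∈ V, g • e = e) → g ∈ C)
    {m D : ℕ} {x : G} {p : ℕ → G} (p0 : p 0 = 1) (pm : p m = x)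
    (pstep : ∀ j, (p j)⁻¹ * p (j + 1) ∈ Bs.B 1) (s : Finset I) (hs : s.card < D)
    (hps : ∀ j ≤ m, ∀ e, P.Permitted (p j) x e → p j • e ∈ s) :
    ∃ b ∈ Bs.B (D ^ P.U.card), b⁻¹ * x ∈ C := by
  have hex : ∀ g : G, ∃ l, ∃ b ∈ Bs.B l, b⁻¹ * g ∈ C := fun g => by
    obtain ⟨l, hl⟩ := Bs.exists_mem g
    exact ⟨l, g, hl, by simp⟩
  let ν : ℕ → ℕ := fun j => Nat.find (hex (p j))
  have ν0 : ν 0 = 0 := by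
    rw [Nat.find_eq_zero]
    exact ⟨1, Bs.one_mem 0, by simp [p0]⟩
  have νstep : ∀ j, ν (j + 1) ≤ ν j + 1 := by
    intro j
    obtain ⟨b, hb, hbC⟩ := Nat.find_spec (hex (p j))
    refine Nat.find_min' _ ⟨b * ((p j)⁻¹ * p (j + 1)), Bs.mul_mem hb (pstep j), ?_⟩
    have := Subgroup.Normal.conj_mem ‹C.Normal› _ hbC ((p j)⁻¹ * p (j + 1))⁻¹
    convert this using 1
    group
  have νeq : ∀ j j', (p j)⁻¹ * p j' ∈ C → ν j' ≤ ν j := by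
    intro j j' h
    obtain ⟨b, hb, hbC⟩ := Nat.find_spec (hex (p j))
    refine Nat.find_min' _ ⟨b, hb, ?_⟩
    have := C.mul_mem hbC h
    rwa [mul_assoc, mul_inv_cancel_left] at this
  let Φ : ℕ → (P.U → Option I) := fun j e =>
    if P.Permitted (p j) x e then some (p j • (e : I)) else none
  have Φeq : ∀ j j', Φ j = Φ j' → (p j)⁻¹ * p j' ∈ C := by
    intro j j' h
    refine hC _ (P.U.filter fun e => P.Permitted (p j) x e) (Finset.filter_subset _ _) ?_ ?_
    · refine le_trans (Finset.card_le_card fun e he => ?_) (P.card_not_permitted (p j) x)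
      rw [Finset.mem_sdiff, Finset.mem_filter] at he
      rw [Finset.mem_filter]
      exact ⟨he.1, fun h' => he.2 ⟨he.1, h'⟩⟩
    · intro e he
      rw [Finset.mem_filter] at he
      have := congrFun h ⟨e, he.1⟩
      simp only [Φ, he.2, if_true] at this
      split_ifs at this
      rw [Option.some_inj] at this
      rw [mul_smul, ← this, inv_smul_smul]
  have Φmem : ∀ j ≤ m, Φ j ∈ Fintype.piFinset fun _ : P.U => s.insertNone := by
    intro j hj
    rw [Fintype.mem_piFinset]
    intro e
    simp only [Φ]
    split_ifs with h
    · rw [Finset.some_mem_insertNone]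
      exact hps j hj e h
    · exact Finset.none_mem_insertNone
  have hval : ∀ v ≤ ν m, ∃ j ≤ m, ν j = v := by
    exact fun v hv => exists_eq_of_step_le_one ν0 νstep hv
  have hcard : ν m + 1 ≤ D ^ P.U.card := by
    choose! J hJ1 hJ2 using hval
    calc ν m + 1 = (Finset.range (ν m + 1)).card := (Finset.card_range _).symm
      _ ≤ (Fintype.piFinset fun _ : P.U => s.insertNone).card := by
        refine Finset.card_le_card_of_injOn (fun v => Φ (J v)) ?_ ?_
        · intro v hv
          exact Φmem _ (hJ1 v (by simpa [Nat.lt_succ_iff] using hv))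
        · intro v hv w hw h
          rw [Finset.mem_coe, Finset.mem_range, Nat.lt_succ_iff] at hv hw
          have h1 := νeq _ _ (Φeq _ _ h)
          have h2 := νeq _ _ (Φeq _ _ h.symm)
          rw [hJ2 v hv, hJ2 w hw] at h1 h2
          omega
      _ = (s.card + 1) ^ P.U.card := by
        simp [Fintype.card_piFinset, Finset.card_insertNone]
      _ ≤ D ^ P.U.card := Nat.pow_le_pow_left hs _
  obtain ⟨b, hb, hbC⟩ := Nat.find_spec (hex (p m))
  rw [pm] at hbC
  exact ⟨b, Bs.mono (by simp only [ν] at hcard; omega) hb, hbC⟩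

open Classical in
theorem eventually_few {C : Subgroup G} [C.Normal]
    (hC : ∀ g : G, ∀ V ⊆ P.U, (P.U \ V).card ≤ 2 → (∀ e ∈ V, g • e = e) → g ∈ C)
    (χ : G → ℤ) (hχ : ∀ g h, χ (g * h) = χ g + χ h) (hχC : Set.InjOn χ C) {a b : G}
    (hab : Function.Injective fun q : ℕ × ℕ => a ^ q.1 * b ^ q.2) (M₀ K : ℕ) :
    ∀ᶠ m in atTop, K * ((Bs.B m).filter fun x => (P.Rx x).card ≤ M₀).card ≤ (Bs.B m).card := by
  obtain ⟨Λ, hΛ⟩ := Bs.card_near_subgroup_le χ hχ hχC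
  set D := 2 * K * ((M₀ + 3) * (Bs.B P.c).card) + 1 with hD
  set Q := D ^ P.U.card with hQ
  filter_upwards [Bs.eventually_linear_le hab (2 * K * ((Bs.B Q).card * (2 * (Λ * (Q + 1)) + 1)))]
    with m hm
  have hpath : ∀ x ∈ Bs.B m, ∃ p : ℕ → G, p 0 = 1 ∧ p m = x ∧
    (∀ j, (p j)⁻¹ * p (j + 1) ∈ Bs.B 1) ∧ ∀ j ≤ m, p j ∈ Bs.B j ∧ (p j)⁻¹ * x ∈ Bs.B (m - j) :=
    fun x hx => Bs.path m x hx
  choose! p p0 pm pstep pmem using hpath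
  let W : G → Finset I := fun x => (((Finset.range (m + 1)) ×ˢ P.U).filter
    fun q => P.Permitted (p x q.1) x q.2).image fun q => p x q.1 • q.2
  set bad := (Bs.B m).filter fun x => (P.Rx x).card ≤ M₀ with hbad
  set bad₁ := bad.filter fun x => D ≤ (W x).card with hbad₁
  set near := (Bs.B m).filter fun x => ∃ b ∈ Bs.B Q, b⁻¹ * x ∈ C with hnear
  have hsub : bad ⊆ bad₁ ∪ near := by
    intro x hx
    rw [Finset.mem_union]
    have hx' := Finset.mem_filter.1 hx
    by_cases h : D ≤ (W x).card
    · exact Or.inl (Finset.mem_filter.2 ⟨hx, h⟩)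
    · refine Or.inr (Finset.mem_filter.2 ⟨hx'.1, ?_⟩)
      refine P.near_subgroup_of_few hC (p0 x hx'.1) (pm x hx'.1) (pstep x hx'.1) (W x)
        (not_le.1 h) ?_
      intro j hj e he
      exact Finset.mem_image.2 ⟨(j, e), Finset.mem_filter.2 ⟨Finset.mem_product.2
        ⟨Finset.mem_range.2 (by omega), he.1⟩, he⟩, rfl⟩
  have h1 : bad₁.card * D ≤ (M₀ + 3) * (Bs.B P.c).card * (Bs.B m).card := by
    refine P.card_many_le bad₁ W (fun x hx => ?_) (fun x hx => (Finset.mem_filter.1 hx).2) ?_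
    · exact (Finset.mem_filter.1 (Finset.mem_filter.1 hx).1).2
    · intro x hx i hi
      have hx' := (Finset.mem_filter.1 (Finset.mem_filter.1 hx).1).1
      obtain ⟨⟨j, e⟩, hq, rfl⟩ := Finset.mem_image.1 hi
      rw [Finset.mem_filter, Finset.mem_product, Finset.mem_range] at hq
      refine ⟨_, _, hq.2, rfl, ?_⟩
      rw [ins, P.el_smul_pow]
      exact Bs.conj_mem (pmem x hx') (by simp only at hq; omega) (P.el_mem e hq.1.2)
  have h2 : near.card ≤ (Bs.B Q).card * (2 * (Λ * (Q + m)) + 1) := hΛ m Q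
  have h3 : bad.card ≤ bad₁.card + near.card :=
    (Finset.card_le_card hsub).trans (Finset.card_union_le _ _)
  have h4 : 2 * K * bad₁.card ≤ (Bs.B m).card := by
    have hpos : 0 < (M₀ + 3) * (Bs.B P.c).card := Nat.mul_pos (by omega) (Bs.card_pos _)
    refine le_of_mul_le_mul_left ?_ hpos
    calc (M₀ + 3) * (Bs.B P.c).card * (2 * K * bad₁.card)
        = bad₁.card * (2 * K * ((M₀ + 3) * (Bs.B P.c).card)) := by ring
      _ ≤ bad₁.card * D := Nat.mul_le_mul_left _ (by omega)
      _ ≤ _ := h1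
  have h5 : 2 * K * near.card ≤ (Bs.B m).card := by
    refine le_trans ?_ hm
    rw [mul_assoc (2 * K)]
    refine Nat.mul_le_mul_left _ (h2.trans ?_)
    rw [mul_assoc]
    refine Nat.mul_le_mul_left _ ?_
    nlinarith [Nat.zero_le (Λ * Q * m)]
  have h6 : K * bad.card ≤ K * (bad₁.card + near.card) := Nat.mul_le_mul_left _ h3
  nlinarith

end AxisSystem.Inserter

namespace AxisSystem.Inserter

variable {G : Type} {Ω I : Type*} [Group G] [MulAction G Ω] [MulAction G I]
  {A : AxisSystem G Ω I} {Bs : BallSystem G} (P : Inserter A Bs)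

/-- The element attached to a letter: a generator or its inverse. -/
def signed {n : ℕ} (x : Fin n → G) (z : Fin n × Bool) : G := if z.2 then x z.1 else (x z.1)⁻¹

theorem disjoint_far {ρ ρ' : I} {u u' : G} (h1 : ρ ∈ P.Rx u) (h1' : ρ' ∈ P.Rx u')
    (h2 : A.d ρ P.o (u' • P.o) < 2 * P.h) (h2' : A.d ρ' P.o (u • P.o) < 2 * P.h) :
    Disjoint {ξ | 2 * P.h ≤ A.d ρ P.o ξ} {ξ | 2 * P.h ≤ A.d ρ' P.o ξ} := by
  rw [Set.disjoint_left]
  intro ξ (hξ : 2 * P.h ≤ A.d ρ P.o ξ) (hξ' : 2 * P.h ≤ A.d ρ' P.o ξ)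
  rw [mem_Rx] at h1 h1'
  have hh := P.h_gt
  simp only [T] at h1 h1'
  have hne : ρ ≠ ρ' := by rintro rfl; omega
  have key : ∀ {ρ ρ' : I} {u' : G}, 2 * P.h ≤ A.d ρ P.o ξ → A.d ρ P.o (u' • P.o) < 2 * P.h →
      4 * P.h ≤ A.d ρ' P.o (u' • P.o) → A.Before ρ ρ' P.o ξ → False := by
    intro ρ ρ' u' a b c hb
    have := hb.1 (u' • P.o) (by rw [A.dist_comm]; omega) P.o
    rw [A.dist_comm, A.dist_comm ρ ξ] at this
    omega
  rcases A.before_or ρ ρ' P.o ξ hne (by omega) (by omega) with h | h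
  · exact key hξ h2 h1' h
  · exact key hξ' h2' h1 h

open Classical in
theorem exists_avoiding {ι : Type*} (Z₁ Z₂ : Finset ι) (f : ι → G) {x : G} {L : ℕ}
    (h₁ : ∀ z ∈ Z₁, (P.Rx x ∩ P.Rx (f z)).card ≤ L)
    (h₂ : ∀ z ∈ Z₂, (P.Rx x⁻¹ ∩ P.Rx (f z)).card ≤ L)
    (hx : (Z₁.card + Z₂.card) * (L + 2) < (P.Rx x).card) :
    ∃ r ∈ P.Rx x, (∀ z ∈ Z₁, A.d r P.o (f z • P.o) < 2 * P.h) ∧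
      ∀ z ∈ Z₂, A.d (x⁻¹ • r) P.o (f z • P.o) < 2 * P.h := by
  by_contra hcon
  push Not at hcon
  have hh := P.h_gt
  have hT := P.two_κ_lt
  have hT' : A.T₀ ≤ 2 * P.h := by omega
  have hsub : P.Rx x ⊆ (Z₁.biUnion fun z => P.Rx x ∩ A.R (2 * P.h) P.o (f z • P.o)) ∪
      Z₂.biUnion fun z => (P.Rx x⁻¹ ∩ A.R (2 * P.h) P.o (f z • P.o)).image fun r => x • r := by
    intro r hr
    rw [Finset.mem_union, Finset.mem_biUnion, Finset.mem_biUnion]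
    by_cases h : ∀ z ∈ Z₁, A.d r P.o (f z • P.o) < 2 * P.h
    · obtain ⟨z, hz, hz'⟩ := hcon r hr h
      refine Or.inr ⟨z, hz, Finset.mem_image.2 ⟨x⁻¹ • r, ?_, smul_inv_smul x r⟩⟩
      rw [Finset.mem_inter, mem_R hT']
      exact ⟨by rw [← P.smul_mem_Rx, smul_inv_smul]; exact hr, hz'⟩
    · push Not at h
      obtain ⟨z, hz, hz'⟩ := h
      exact Or.inl ⟨z, hz, by rw [Finset.mem_inter, mem_R hT']; exact ⟨hr, hz'⟩⟩
  have c1 := Finset.card_biUnion_le_card_mul Z₁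
    (fun z => P.Rx x ∩ A.R (2 * P.h) P.o (f z • P.o)) (L + 2) fun z hz =>
      (card_R_inter_le P.T₀_le hT (by omega) hT' _ _ _).trans (Nat.add_le_add_right (h₁ z hz) 2)
  have c2 := Finset.card_biUnion_le_card_mul Z₂
    (fun z => (P.Rx x⁻¹ ∩ A.R (2 * P.h) P.o (f z • P.o)).image fun r => x • r) (L + 2) fun z hz =>
      Finset.card_image_le.trans
        ((card_R_inter_le P.T₀_le hT (by omega) hT' _ _ _).trans (Nat.add_le_add_right (h₂ z hz) 2))
  have c3 := (Finset.card_le_card hsub).trans (Finset.card_union_le _ _)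
  rw [add_mul] at hx
  omega

open Classical in
theorem isFreeBasisTuple {n : ℕ} (hn : 2 ≤ n) (x : Fin n → G) {L : ℕ}
    (hL : ∀ z z', z ≠ z' → (P.Rx (signed x z) ∩ P.Rx (signed x z')).card ≤ L)
    (hx : ∀ i, 4 * n * (L + 2) < (P.Rx (x i)).card) : IsFreeBasisTuple x := by
  have hex : ∀ i, ∃ r ∈ P.Rx (x i),
      (∀ z, z ≠ (i, true) → A.d r P.o (signed x z • P.o) < 2 * P.h) ∧
      ∀ z, z ≠ (i, false) → A.d ((x i)⁻¹ • r) P.o (signed x z • P.o) < 2 * P.h := by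
    intro i
    have hc : ∀ w : Fin n × Bool, (Finset.univ.filter fun z => z ≠ w).card ≤ 2 * n := by
      intro w
      refine (Finset.card_filter_le _ _).trans ?_
      simp [mul_comm]
    have := P.exists_avoiding (Finset.univ.filter fun z => z ≠ (i, true))
      (Finset.univ.filter fun z => z ≠ (i, false)) (signed x) (x := x i) (L := L)
      (fun z hz => hL (i, true) z (Finset.mem_filter.1 hz).2.symm)
      (fun z hz => hL (i, false) z (Finset.mem_filter.1 hz).2.symm)
      (lt_of_le_of_lt (Nat.mul_le_mul_right _
        (by have := hc (i, true); have := hc (i, false); omega)) (hx i))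
    simpa using this
  choose r hr h1 h2 using hex
  have hr' : ∀ i, (x i)⁻¹ • r i ∈ P.Rx (x i)⁻¹ := fun i => by
    rw [← P.smul_mem_Rx, smul_inv_smul]; exact hr i
  have st : ∀ i, signed x (i, true) = x i := fun i => rfl
  have sf : ∀ i, signed x (i, false) = (x i)⁻¹ := fun i => rfl
  have : Nontrivial (Fin n) := Fin.nontrivial_iff_two_le.2 hn
  refine FreeGroup.injective_lift_of_ping_pong x (fun i => {ξ | 2 * P.h ≤ A.d (r i) P.o ξ})
    (fun i => {ξ | 2 * P.h ≤ A.d ((x i)⁻¹ • r i) P.o ξ}) ?_ ?_ ?_ ?_ ?_ ?_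
  · intro i
    refine ⟨x i • P.o, ?_⟩
    have := P.mem_Rx.1 (hr i)
    simp only [T] at this
    simp only [Set.mem_ofPred_eq]
    omega
  · intro i j hij
    exact P.disjoint_far (hr i) (hr j) (st j ▸ h1 i (j, true) (by simp [hij.symm]))
      (st i ▸ h1 j (i, true) (by simp [hij]))
  · intro i j hij
    exact P.disjoint_far (hr' i) (hr' j) (sf j ▸ h2 i (j, false) (by simp [hij.symm]))
      (sf i ▸ h2 j (i, false) (by simp [hij]))
  · intro i j
    exact P.disjoint_far (hr i) (hr' j) (sf j ▸ h1 i (j, false) (by simp))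
      (st i ▸ h2 j (i, true) (by simp))
  · intro i
    rw [Set.smul_set_subset_iff]
    intro ξ hξ
    have hξ' : A.d ((x i)⁻¹ • r i) P.o ξ < 2 * P.h := by simpa using hξ
    have e1 := P.mem_Rx.1 (hr i)
    rw [← A.smul_eq (x i), smul_inv_smul] at hξ'
    have e2 := A.dist_tri (r i) P.o (x i • ξ) (x i • P.o)
    rw [A.dist_comm (r i) (x i • ξ)] at e2
    simp only [T] at e1
    simp only [Set.mem_ofPred_eq]
    omega
  · intro i
    rw [Set.smul_set_subset_iff]
    intro ξ hξ
    have hξ' : A.d (r i) P.o ξ < 2 * P.h := by simpa using hξ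
    have e1 := P.mem_Rx.1 (hr' i)
    rw [← A.smul_eq (x i)⁻¹] at hξ'
    have e2 := A.dist_tri ((x i)⁻¹ • r i) P.o ((x i)⁻¹ • ξ) ((x i)⁻¹ • P.o)
    rw [A.dist_comm ((x i)⁻¹ • r i) ((x i)⁻¹ • ξ)] at e2
    simp only [T] at e1
    simp only [Pi.inv_apply, Set.mem_ofPred_eq]
    omega

end AxisSystem.Inserter

open Classical in
theorem card_piFinset_filter_le {G : Type*} {n : ℕ} (B : Finset G) (hB : 0 < B.card) (i : Fin n)
    (p : (Fin n → G) → Prop) (K : ℕ)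
    (h : ∀ x, K * (B.filter fun u => p (Function.update x i u)).card ≤ B.card) :
    K * ((Fintype.piFinset fun _ : Fin n => B).filter p).card ≤ B.card ^ n := by
  rcases Nat.eq_zero_or_pos K with rfl | hK
  · simp
  set N := B.card / K with hN
  set s := (Fintype.piFinset fun _ : Fin n => B).filter p with hs
  set f : (Fin n → G) × G → (Fin n → G) := fun q => Function.update q.1 i q.2 with hf
  have h1 : (s ×ˢ B).card ≤ N * ((s ×ˢ B).image f).card := by
    refine Finset.card_le_mul_card_image _ _ fun y hy => ?_
    have hsub : ((s ×ˢ B).filter fun q => f q = y).card ≤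
        (B.filter fun u => p (Function.update y i u)).card := by
      refine Finset.card_le_card_of_injOn (fun q => q.1 i) ?_ ?_
      · intro q hq
        rw [Finset.mem_coe, Finset.mem_filter, Finset.mem_product, hs, Finset.mem_filter,
          Fintype.mem_piFinset] at hq
        rw [Finset.mem_coe, Finset.mem_filter, ← hq.2]
        refine ⟨hq.1.1.1 i, ?_⟩
        simpa [hf] using hq.1.1.2
      · intro q hq q' hq' e
        rw [Finset.mem_coe, Finset.mem_filter] at hq hq'
        have e' := hq.2.trans hq'.2.symm
        have e2 : q.2 = q'.2 := by
          have := congrFun e' i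
          simpa [hf] using this
        refine Prod.ext ?_ e2
        funext j
        by_cases hj : j = i
        · subst hj; exact e
        · have := congrFun e' j
          simpa [hf, hj] using this
    refine hsub.trans ?_
    rw [Nat.le_div_iff_mul_le hK, mul_comm]
    exact h y
  have h2 : ((s ×ˢ B).image f).card ≤ B.card ^ n := by
    have : (s ×ˢ B).image f ⊆ Fintype.piFinset fun _ : Fin n => B := by
      intro y hy
      obtain ⟨q, hq, rfl⟩ := Finset.mem_image.1 hy
      rw [Finset.mem_product, hs, Finset.mem_filter, Fintype.mem_piFinset] at hq
      rw [Fintype.mem_piFinset]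
      intro j
      by_cases hj : j = i
      · subst hj; simpa [hf] using hq.2
      · simpa [hf, hj] using hq.1.1 j
    refine (Finset.card_le_card this).trans ?_
    simp
  rw [Finset.card_product] at h1
  have h3 : N * K ≤ B.card := Nat.div_mul_le_self _ _
  refine le_of_mul_le_mul_right ?_ hB
  calc K * s.card * B.card = K * (s.card * B.card) := by ring
    _ ≤ K * (N * B.card ^ n) := Nat.mul_le_mul_left _ (h1.trans (Nat.mul_le_mul_left _ h2))
    _ = N * K * B.card ^ n := by ring
    _ ≤ B.card * B.card ^ n := Nat.mul_le_mul_right _ h3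
    _ = B.card ^ n * B.card := by ring

namespace AxisSystem.Inserter

variable {G : Type} {Ω I : Type*} [Group G] [MulAction G Ω] [MulAction G I]
  {A : AxisSystem G Ω I} {Bs : BallSystem G} (P : Inserter A Bs)

open Classical in
theorem card_filter_signed (m : ℕ) (q : G → Prop) (b : Bool) :
    ((Bs.B m).filter fun u => q (if b then u else u⁻¹)).card = ((Bs.B m).filter q).card := by
  cases b with
  | true => simp
  | false =>
    refine Finset.card_bij (fun u _ => u⁻¹) (fun u hu => ?_) (fun u _ v _ h => inv_injective h)
      fun u hu => ⟨u⁻¹, ?_, inv_inv u⟩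
    · simp only [Finset.mem_filter] at hu ⊢
      exact ⟨Bs.inv_mem hu.1, by simpa using hu.2⟩
    · simp only [Finset.mem_filter] at hu ⊢
      exact ⟨Bs.inv_mem hu.1, by simpa using hu.2⟩

open Classical in
theorem eventually_card_not_free_le {C : Subgroup G} [C.Normal]
    (hC : ∀ g : G, ∀ V ⊆ P.U, (P.U \ V).card ≤ 2 → (∀ e ∈ V, g • e = e) → g ∈ C)
    (χ : G → ℤ) (hχ : ∀ g h, χ (g * h) = χ g + χ h) (hχC : Set.InjOn χ C) {a b : G}
    (hab : Function.Injective fun q : ℕ × ℕ => a ^ q.1 * b ^ q.2) {n : ℕ} (hn : 2 ≤ n) (K : ℕ) :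
    ∀ᶠ m in atTop, K * ((Fintype.piFinset fun _ : Fin n => Bs.B m).filter fun x =>
      ¬ IsFreeBasisTuple x).card ≤ (Bs.B m).card ^ n := by
  set E := Fin n ⊕ (Fin n × Bool) × (Fin n × Bool) with hE
  set K' := K * Fintype.card E with hK'
  set L := 2 * (Bs.B P.c).card * K' with hL
  filter_upwards [P.eventually_few hC χ hχ hχC hab (4 * n * (L + 2)) K'] with m hm
  obtain ⟨ev, ev₁, ev₂⟩ : ∃ ev : E → (Fin n → G) → Prop,
      (∀ i x, ev (Sum.inl i) x ↔ (P.Rx (x i)).card ≤ 4 * n * (L + 2)) ∧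
      ∀ z x, ev (Sum.inr z) x ↔ z.1 ≠ z.2 ∧ 2 * L ≤ (P.Rx (x z.1.1)).card ∧
        L ≤ (P.Rx (signed x z.1) ∩ P.Rx (signed x z.2)).card :=
    ⟨Sum.elim (fun i x => (P.Rx (x i)).card ≤ 4 * n * (L + 2))
      fun z x => z.1 ≠ z.2 ∧ 2 * L ≤ (P.Rx (x z.1.1)).card ∧
        L ≤ (P.Rx (signed x z.1) ∩ P.Rx (signed x z.2)).card,
      fun _ _ => Iff.rfl, fun _ _ => Iff.rfl⟩
  have hsub : ((Fintype.piFinset fun _ : Fin n => Bs.B m).filter fun x => ¬ IsFreeBasisTuple x) ⊆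
      Finset.univ.biUnion fun e : E =>
        (Fintype.piFinset fun _ : Fin n => Bs.B m).filter (ev e) := by
    intro x hx
    rw [Finset.mem_filter] at hx
    rw [Finset.mem_biUnion]
    by_contra hcon
    push Not at hcon
    have hcon' : ∀ e : E, ¬ ev e x := fun e he =>
      hcon e (Finset.mem_univ _) (Finset.mem_filter.2 ⟨hx.1, he⟩)
    have hlarge : ∀ i, 4 * n * (L + 2) < (P.Rx (x i)).card := fun i => by
      have := hcon' (Sum.inl i)
      simpa [ev₁] using this
    refine hx.2 (P.isFreeBasisTuple hn x (L := L) (fun z z' hzz => ?_) hlarge)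
    by_contra hlt
    refine hcon' (Sum.inr (z, z')) ((ev₂ _ _).2 ⟨hzz, ?_, by simpa using (not_le.1 hlt).le⟩)
    have := hlarge z.1
    nlinarith
  have hLK : 0 < 2 * (Bs.B P.c).card := Nat.mul_pos two_pos (Bs.card_pos _)
  have hcancel : ∀ t : ℕ, t * L ≤ 2 * (Bs.B P.c).card * (Bs.B m).card →
      K' * t ≤ (Bs.B m).card := by
    intro t ht
    refine le_of_mul_le_mul_left ?_ hLK
    calc 2 * (Bs.B P.c).card * (K' * t) = t * L := by rw [hL]; ring
      _ ≤ _ := ht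
  have hev : ∀ e : E, K' * ((Fintype.piFinset fun _ : Fin n => Bs.B m).filter (ev e)).card ≤
      (Bs.B m).card ^ n := by
    rintro (i | ⟨⟨i, s⟩, ⟨j, t⟩⟩)
    · refine card_piFinset_filter_le _ (Bs.card_pos m) i _ _ fun x => ?_
      simpa [ev₁] using hm
    · refine card_piFinset_filter_le _ (Bs.card_pos m) i _ _ fun x => hcancel _ ?_
      by_cases hij : j = i
      · subst hij
        refine le_trans (Nat.mul_le_mul_right _ (Finset.card_le_card ?_))
          (P.card_inter_inv_le m L)
        intro u hu
        rw [Finset.mem_filter] at hu ⊢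
        refine ⟨hu.1, ?_⟩
        have h3 := (ev₂ _ _).1 hu.2
        simp only [signed, Function.update_self, ne_eq, Prod.mk.injEq, true_and] at h3
        refine ⟨h3.2.1, ?_⟩
        cases s <;> cases t <;> simp_all [Finset.inter_comm]
      · refine le_trans (Nat.mul_le_mul_right _ ?_) (P.card_inter_le m L (signed x (j, t)))
        rw [← card_filter_signed m _ s]
        refine Finset.card_le_card fun u hu => ?_
        rw [Finset.mem_filter] at hu ⊢
        refine ⟨hu.1, ?_⟩
        have h3 := ((ev₂ _ _).1 hu.2).2.2
        cases s <;> simpa [signed, hij] using h3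
  have hsum : ((Fintype.piFinset fun _ : Fin n => Bs.B m).filter fun x =>
      ¬ IsFreeBasisTuple x).card ≤ ∑ e : E,
        ((Fintype.piFinset fun _ : Fin n => Bs.B m).filter (ev e)).card :=
    (Finset.card_le_card hsub).trans Finset.card_biUnion_le
  have hpos : 0 < Fintype.card E :=
    Fintype.card_pos_iff.2 ⟨Sum.inl ⟨0, by omega⟩⟩
  refine le_of_mul_le_mul_left ?_ hpos
  calc Fintype.card E * (K * _) = K' * _ := by rw [hK']; ring
    _ ≤ K' * _ := Nat.mul_le_mul_left _ hsum
    _ = ∑ e : E, K' * ((Fintype.piFinset fun _ : Fin n => Bs.B m).filter (ev e)).card :=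
        Finset.mul_sum _ _ _
    _ ≤ ∑ e : E, (Bs.B m).card ^ n := Finset.sum_le_sum fun e _ => hev e
    _ = Fintype.card E * (Bs.B m).card ^ n := by simp

end AxisSystem.Inserter

open Classical in
theorem strongGeneric_of_eventually {G : Type*} [Group G] {S : Set G} (B : ℕ → Finset G)
    (hB : ∀ m, (B m : Set G) = wordBall S m)
    (h : ∀ n, 2 ≤ n → ∀ K : ℕ, ∀ᶠ m in atTop, K * ((Fintype.piFinset fun _ : Fin n => B m).filter
      fun x => ¬ IsFreeBasisTuple x).card ≤ (B m).card ^ n) :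
    StrongGenericFreeGroupProperty S := by
  have hpos : ∀ m, 0 < (B m).card := fun m => Finset.card_pos.2 ⟨1, by
    rw [← Finset.mem_coe, hB]
    exact ⟨[], by simp, by simp, rfl⟩⟩
  have h1 : ∀ n, 1 ≤ n → ∀ K : ℕ, ∀ᶠ m in atTop, K * ((Fintype.piFinset fun _ : Fin n => B m).filter
      fun x => ¬ IsFreeBasisTuple x).card ≤ (B m).card ^ n := by
    intro n hn K
    rcases hn.lt_or_eq with hn | rfl
    · exact h n hn K
    filter_upwards [h 2 le_rfl K] with m hm
    refine le_of_mul_le_mul_right ?_ (hpos m)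
    calc _ = K * (((Fintype.piFinset fun _ : Fin 1 => B m).filter
      fun x => ¬ IsFreeBasisTuple x) ×ˢ B m).card := by rw [Finset.card_product, mul_assoc]
      _ ≤ _ := Nat.mul_le_mul_left _ (Finset.card_le_card_of_injOn
        (fun q => ![q.1 0, q.2]) ?_ ?_)
      _ ≤ _ := hm
      _ = _ := by ring
    · intro q hq
      rw [Finset.mem_coe, Finset.mem_product, Finset.mem_filter, Fintype.mem_piFinset] at hq
      rw [Finset.mem_coe, Finset.mem_filter, Fintype.mem_piFinset]
      refine ⟨fun i => ?_, fun hf => hq.1.2 ?_⟩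
      · fin_cases i
        · exact hq.1.1 0
        · exact hq.2
      · have e : FreeGroup.lift q.1 = (FreeGroup.lift ![q.1 0, q.2]).comp
            (FreeGroup.map fun _ : Fin 1 => (0 : Fin 2)) := by
          ext i
          have : i = 0 := Subsingleton.elim _ _
          subst this
          simp
        rw [IsFreeBasisTuple, e]
        exact hf.comp (FreeGroup.map_injective fun _ _ _ => Subsingleton.elim _ _)
    · intro q _ q' _ e
      have e0 := congrFun e 0
      have e1 := congrFun e 1
      refine Prod.ext (funext fun i => ?_) e1
      rw [Subsingleton.elim i 0]
      exact e0
  intro n hn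
  have hball : ∀ m, (wordBall S m).ncard = (B m).card := fun m => by
    rw [← hB, Set.ncard_coe_finset]
  have hgood : ∀ m, {x : Fin n → G | (∀ i, x i ∈ wordBall S m) ∧ IsFreeBasisTuple x}.ncard +
      ((Fintype.piFinset fun _ : Fin n => B m).filter fun x => ¬ IsFreeBasisTuple x).card =
      (B m).card ^ n := by
    intro m
    have : {x : Fin n → G | (∀ i, x i ∈ wordBall S m) ∧ IsFreeBasisTuple x} =
        ((Fintype.piFinset fun _ : Fin n => B m).filter fun x =>
          IsFreeBasisTuple x : Finset _) := by
      ext x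
      simp [← hB]
    rw [this, Set.ncard_coe_finset, Finset.card_filter_add_card_filter_not]
    simp
  rw [Metric.tendsto_atTop]
  intro ε hε
  obtain ⟨K, hK⟩ := exists_nat_gt ε⁻¹
  obtain ⟨M, hM⟩ := Filter.eventually_atTop.1 (h1 n hn K)
  refine ⟨M, fun m hm => ?_⟩
  have hb := hM m hm
  have hg := hgood m
  rw [hball]
  set good := {x : Fin n → G | (∀ i, x i ∈ wordBall S m) ∧ IsFreeBasisTuple x}.ncard
  set bad := ((Fintype.piFinset fun _ : Fin n => B m).filter fun x => ¬ IsFreeBasisTuple x).card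
  have hc : (0 : ℝ) < ((B m).card : ℝ) ^ n := by have := hpos m; positivity
  have hb' : (K : ℝ) * bad ≤ ((B m).card : ℝ) ^ n := by exact_mod_cast hb
  have hg' : (good : ℝ) + bad = ((B m).card : ℝ) ^ n := by exact_mod_cast hg
  have e : (good : ℝ) / ((B m).card : ℝ) ^ n - 1 = -(bad / ((B m).card : ℝ) ^ n) := by
    field_simp
    linarith
  have hKpos : (0 : ℝ) < K := lt_trans (by positivity) hK
  rw [Real.dist_eq, e, abs_neg, abs_of_nonneg (by positivity), div_lt_iff₀ hc]
  have h5 : 1 < ε * K := by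
    rw [inv_lt_iff_one_lt_mul₀ hε] at hK
    linarith
  by_contra hcon
  push Not at hcon
  have := mul_le_mul_of_nonneg_left hcon hKpos.le
  nlinarith

theorem wordBall_finite {G : Type*} [Group G] {S : Set G} (hS : S.Finite) (m : ℕ) :
    (wordBall S m).Finite := by
  have hT : (S ∪ S⁻¹).Finite := hS.union hS.inv
  have := hT.to_subtype
  refine ((List.finite_length_le (S ∪ S⁻¹ : Set G) m).image
    fun l => (l.map Subtype.val).prod).subset ?_
  rintro g ⟨l, hl, hlS, rfl⟩
  lift l to List (S ∪ S⁻¹ : Set G) using fun x hx => by simpa using hlS x hx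
  exact ⟨l, by simpa using hl, rfl⟩

/-- The balls of a finitely generated group. -/
noncomputable def BallSystem.ofGenerators {G : Type*} [Group G] {S : Set G} (hS : S.Finite)
    (hgen : Subgroup.closure S = ⊤) : BallSystem G where
  B m := (wordBall_finite hS m).toFinset
  one_mem m := by
    rw [Set.Finite.mem_toFinset]
    exact ⟨[], by simp, by simp, rfl⟩
  mul_mem := by
    intro a b x y hx hy
    rw [Set.Finite.mem_toFinset] at *
    obtain ⟨l, h1, h2, rfl⟩ := hx
    obtain ⟨l', h1', h2', rfl⟩ := hy
    refine ⟨l ++ l', by simp; omega, fun x hx => ?_, by simp⟩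
    rcases List.mem_append.1 hx with h | h
    · exact h2 x h
    · exact h2' x h
  inv_mem := by
    intro a x hx
    rw [Set.Finite.mem_toFinset] at *
    obtain ⟨l, h1, h2, rfl⟩ := hx
    refine ⟨(l.map (·⁻¹)).reverse, by simpa using h1, fun x hx => ?_, ?_⟩
    · rw [List.mem_reverse, List.mem_map] at hx
      obtain ⟨y, hy, rfl⟩ := hx
      rw [inv_inv]
      exact (h2 y hy).symm
    · rw [← List.prod_inv_reverse]
  exists_mem := by
    intro g
    have hg : g ∈ Subgroup.closure S := by rw [hgen]; trivial
    rw [← Subgroup.mem_toSubmonoid, Subgroup.closure_toSubmonoid] at hg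
    obtain ⟨l, hl, rfl⟩ := Submonoid.exists_list_of_mem_closure hg
    refine ⟨l.length, ?_⟩
    rw [Set.Finite.mem_toFinset]
    exact ⟨l, le_rfl, fun x hx => by simpa using hl x hx, rfl⟩
  mono := by
    intro a b hab x hx
    rw [Set.Finite.mem_toFinset] at *
    obtain ⟨l, h1, h2⟩ := hx
    exact ⟨l, h1.trans hab, h2⟩
  path := by
    intro m x hx
    rw [Set.Finite.mem_toFinset] at hx
    obtain ⟨l, h1, h2, rfl⟩ := hx
    refine ⟨fun j => (l.take j).prod, by simp, by simp [List.take_of_length_le h1], fun j => ?_,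
      fun j hj => ⟨?_, ?_⟩⟩
    · rw [Set.Finite.mem_toFinset]
      refine ⟨(l.drop j).take 1, by simp, fun x hx => h2 x ?_, ?_⟩
      · exact List.mem_of_mem_drop (List.mem_of_mem_take hx)
      · beta_reduce
        rw [List.take_add, List.prod_append, inv_mul_cancel_left]
    · rw [Set.Finite.mem_toFinset]
      exact ⟨l.take j, by simp, fun x hx => h2 x (List.mem_of_mem_take hx), rfl⟩
    · rw [Set.Finite.mem_toFinset]
      refine ⟨l.drop j, by simp; omega, fun x hx => h2 x (List.mem_of_mem_drop hx), ?_⟩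
      rw [eq_inv_mul_iff_mul_eq, List.prod_take_mul_prod_drop]

namespace AxisSystem

variable {G : Type} {Ω I : Type*} [Group G] [MulAction G Ω] [MulAction G I]
  (A : AxisSystem G Ω I)

theorem exists_dist_le (ξ η : Ω) : ∃ C, ∀ i, A.d i ξ η ≤ C := by
  refine ⟨A.T₀ + (A.finite_ge ξ η).toFinset.sup fun i => A.d i ξ η, fun i => ?_⟩
  by_cases h : A.T₀ ≤ A.d i ξ η
  · have : A.d i ξ η ≤ _ := Finset.le_sup (f := fun i => A.d i ξ η)
      ((A.finite_ge ξ η).mem_toFinset.2 h)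
    omega
  · omega

theorem exists_near (o : Ω) (U : Finset I) : ∃ c, ∀ ξ, ∀ e ∈ U, ∀ e' ∈ U, e ≠ e' →
    A.d e o ξ ≤ c ∨ A.d e' o ξ ≤ c := by
  choose ζ hζ using fun e => A.unbounded e o A.κ
  have hle : ∀ e ∈ U, ∀ e' ∈ U, A.d e o (ζ e') ≤ U.sup fun e => U.sup fun e' => A.d e o (ζ e') :=
    fun e he e' he' => (Finset.le_sup (f := fun e' => A.d e o (ζ e')) he').trans
      (Finset.le_sup (f := fun e => U.sup fun e' => A.d e o (ζ e')) he)
  refine ⟨A.κ + U.sup fun e => U.sup fun e' => A.d e o (ζ e'), fun ξ e he e' he' hne => ?_⟩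
  by_contra hcon
  push Not at hcon
  have key : ∀ {e e'}, e ∈ U → e' ∈ U → A.Before e e' o ξ →
      A.d e o ξ ≤ U.sup fun e => U.sup fun e' => A.d e o (ζ e') := by
    intro e e' he he' hb
    have := hb.1 (ζ e') (by rw [A.dist_comm]; exact hζ e') o
    rw [A.dist_comm, A.dist_comm e ξ] at this
    rw [← this]
    exact hle e he e' he'
  rcases A.before_or e e' o ξ hne (by omega) (by omega) with h | h
  · have := key he he' h
    omega
  · have := key he' he h
    omega

theorem strongGeneric (o : Ω) (el : I → G) (el_smul : ∀ g i, el (g • i) = g * el i * g⁻¹)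
    (el_fix : ∀ i, el i • i = i) (el_far : ∀ i ξ n, n ≤ A.d i ξ (el i ^ n • ξ))
    (U : Finset I) (hU : 3 ≤ U.card) (C : Subgroup G) [C.Normal]
    (hC : ∀ g : G, ∀ V ⊆ U, (∀ W : Finset I, (∀ i, i ∈ W ↔ i ∈ U ∧ i ∉ V) → W.card ≤ 2) →
      (∀ e ∈ V, g • e = e) → g ∈ C)
    (χ : G → ℤ) (hχ : ∀ g h, χ (g * h) = χ g + χ h) (hχC : Set.InjOn χ C) {a b : G}
    (hab : Function.Injective fun q : ℕ × ℕ => a ^ q.1 * b ^ q.2)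
    {S : Set G} (hS : S.Finite) (hgen : Subgroup.closure S = ⊤) :
    StrongGenericFreeGroupProperty S := by
  classical
  let Bs := BallSystem.ofGenerators hS hgen
  obtain ⟨c₁, hc₁⟩ := A.exists_near o U
  choose bd hbd using fun ξ => A.exists_dist_le o ξ
  have hsup : ∀ (s : Finset Ω), ∀ ξ ∈ s, ∀ i, A.d i o ξ ≤ s.sup bd :=
    fun s ξ hξ i => (hbd ξ i).trans (Finset.le_sup hξ)
  set s := A.κ + c₁ + 1 with hs
  set C₀ := ((Bs.B 1).image fun g => g • o).sup bd with hC₀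
  set C₁ := (U.image fun e => el e ^ s • o).sup bd with hC₁
  set h := A.κ + C₀ + C₁ + c₁ + A.T₀ + 1 with hh
  set k := 4 * h + 2 * c₁ + C₁ + C₀ + 4 * A.κ + s + 1 with hk
  obtain ⟨c, hc⟩ := Bs.exists_finset_mem (U.image fun e => el e ^ k)
  let P : Inserter A Bs :=
    { o := o, el := el, U := U, c₁ := c₁, s := s, C₀ := C₀, C₁ := C₁, h := h, k := k, c := c
      el_smul := el_smul
      el_fix := el_fix
      el_far := el_far
      near := hc₁
      three_le := hU
      lip := fun g hg i => hsup _ _ (Finset.mem_image_of_mem (fun g => g • o) hg) i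
      lip_el := fun e he i => hsup _ _ (Finset.mem_image_of_mem (fun e => el e ^ s • o) he) i
      el_mem := fun e he => hc _ (Finset.mem_image_of_mem _ he)
      s_gt := by omega
      h_gt := by omega
      k_gt := by omega }
  refine strongGeneric_of_eventually Bs.B (fun m => by simp [Bs, BallSystem.ofGenerators]) ?_
  intro n hn K
  refine P.eventually_card_not_free_le (C := C) (fun g V hV hcard hfix => ?_) χ hχ hχC hab hn K
  refine hC g V hV (fun W hW => ?_) hfix
  refine le_trans (Finset.card_le_card fun i hi => ?_) hcard
  rw [Finset.mem_sdiff]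
  exact (hW i).1 hi

end AxisSystem

/-- An equivariant family of pseudo-distances on `Ω` such that for any two indices, `Ω` splits into
a part that is small for the first index and a part that is small for the second. -/
structure CoarseSystem (G Ω I : Type*) [Group G] [MulAction G Ω] [MulAction G I] where
  d : I → Ω → Ω → ℕ
  θ : ℕ
  T₀ : ℕ
  dist_self : ∀ i ξ, d i ξ ξ = 0
  dist_comm : ∀ i ξ η, d i ξ η = d i η ξ
  dist_tri : ∀ i ξ η ζ, d i ξ ζ ≤ d i ξ η + d i η ζ
  smul_eq : ∀ (g : G) i ξ η, d (g • i) (g • ξ) (g • η) = d i ξ η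
  unbounded : ∀ i ξ K, ∃ ζ, K < d i ξ ζ
  finite_ge : ∀ ξ η, {i | T₀ ≤ d i ξ η}.Finite
  partition : ∀ i j, i ≠ j → ∃ Y : Set Ω,
    (∀ ξ ∉ Y, ∀ η ∉ Y, d i ξ η ≤ θ) ∧ ∀ ξ ∈ Y, ∀ η ∈ Y, d j ξ η ≤ θ

namespace CoarseSystem

variable {G Ω I : Type*} [Group G] [MulAction G Ω] [MulAction G I] (A : CoarseSystem G Ω I)

theorem exists_far (i : I) (ξ η : Ω) (K : ℕ) : ∃ ζ, K < A.d i ζ ξ ∧ K < A.d i ζ η := by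
  obtain ⟨ζ, hζ⟩ := A.unbounded i ξ (K + A.d i ξ η)
  refine ⟨ζ, by rw [A.dist_comm]; omega, ?_⟩
  have := A.dist_tri i ξ η ζ
  rw [A.dist_comm i ζ η]; omega

/-- A splitting of `Ω` into a `j`-small set and its `i`-small complement. -/
def Splits (i j : I) (Y : Set Ω) : Prop :=
  (∀ ξ ∉ Y, ∀ η ∉ Y, A.d i ξ η ≤ A.θ) ∧ ∀ ξ ∈ Y, ∀ η ∈ Y, A.d j ξ η ≤ A.θ

/-- The points at `j`-distance more than `M` from `Y`. -/
def deep (j : I) (Y : Set Ω) (M : ℕ) : Set Ω := {ξ | ∀ ζ ∈ Y, M < A.d j ξ ζ}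

variable {A}

theorem deep_mono {j : I} {Y : Set Ω} {M M' : ℕ} (h : M' ≤ M) : A.deep j Y M ⊆ A.deep j Y M' :=
  fun _ hξ ζ hζ => lt_of_le_of_lt h (hξ ζ hζ)

theorem notMem_of_deep {j : I} {Y : Set Ω} {M : ℕ} {ξ : Ω} (hξ : ξ ∈ A.deep j Y M) : ξ ∉ Y := by
  intro h
  have := hξ ξ h
  rw [A.dist_self] at this
  omega

theorem Splits.nonempty_inter {i j k : I} {Y Z : Set Ω} (h : A.Splits i j Y) (h' : A.Splits i k Z)
    (x : Ω) : (Y ∩ Z).Nonempty := by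
  by_contra hcon
  rw [Set.not_nonempty_iff_eq_empty, Set.eq_empty_iff_forall_notMem] at hcon
  have key : ∀ {j k : I} {Y Z : Set Ω}, A.Splits i j Y → A.Splits i k Z →
      (∀ y ∈ Y, y ∉ Z) → x ∉ Y → False := by
    intro j k Y Z h h' hd hx
    obtain ⟨η, hη, -⟩ := A.exists_far i x x A.θ
    obtain ⟨ζ, hζ, hζ'⟩ := A.exists_far i x η A.θ
    have e1 : η ∈ Y := by
      by_contra h1
      have := h.1 η h1 x hx
      omega
    have e2 : ζ ∈ Y := by
      by_contra h1
      have := h.1 ζ h1 x hx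
      omega
    have := h'.1 ζ (hd _ e2) η (hd _ e1)
    omega
  by_cases hx : x ∈ Y
  · exact key h' h (fun z hz hy => hcon z ⟨hy, hz⟩) fun hz => hcon x ⟨hx, hz⟩
  · exact key h h' (fun z hz hy => hcon z ⟨hz, hy⟩) hx

theorem Splits.exists_deep_far {i j : I} {Y : Set Ω} (h : A.Splits i j Y) (x : Ω) (M : ℕ) :
    ∃ η ∈ A.deep j Y M, M < A.d j η x := by
  obtain ⟨y, hy, -⟩ := h.nonempty_inter h x
  obtain ⟨η, h1, h2⟩ := A.exists_far j y x (M + A.θ)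
  refine ⟨η, fun ζ hζ => ?_, by omega⟩
  have := A.dist_tri j η ζ y
  have := h.2 ζ hζ y hy
  omega

theorem Splits.compare {i j k : I} (hjk : j ≠ k) {Y Z : Set Ω} (h : A.Splits i j Y)
    (h' : A.Splits i k Z) {x : Ω} (hx : x ∈ A.deep j Y A.θ) (hx' : x ∈ A.deep k Z A.θ) :
    (∀ η ∈ A.deep k Z A.θ, A.d j η x ≤ A.θ) ∨ ∀ η ∈ A.deep j Y A.θ, A.d k η x ≤ A.θ := by
  obtain ⟨a, ha, ha'⟩ := h.nonempty_inter h' x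
  obtain ⟨W, h1, h2⟩ := A.partition j k hjk
  have d1 := hx a ha
  have d2 := hx' a ha'
  by_cases hxW : x ∈ W
  · right
    intro η hη
    have haW : a ∉ W := fun haW => by have := h2 x hxW a haW; omega
    have d3 := hη a ha
    have hηW : η ∈ W := by
      by_contra hηW
      have := h1 η hηW a haW
      omega
    exact h2 η hηW x hxW
  · left
    intro η hη
    have haW : a ∈ W := by
      by_contra haW
      have := h1 x hxW a haW
      omega
    have d3 := hη a ha'
    have hηW : η ∉ W := fun hηW => by have := h2 η hηW a haW; omega
    exact h1 η hηW x hxW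

theorem deep_of_near {j : I} {Y : Set Ω} {M : ℕ} {x η : Ω} (hx : x ∈ A.deep j Y (M + A.θ))
    (h : A.d j η x ≤ A.θ) : η ∈ A.deep j Y M := by
  intro ζ hζ
  have := hx ζ hζ
  have := A.dist_tri j x η ζ
  rw [A.dist_comm j x η] at this
  omega

theorem exists_deepest {i : I} (Y : I → Set Ω) (hY : ∀ j, j ≠ i → A.Splits i j (Y j)) (j : ℕ → I)
    (hj : ∀ t, j t ≠ i) (x : ℕ → Ω) (n : ℕ) : ∀ a : ℕ,
    (∀ t, a ≤ t → t < a + n → x t ∈ A.deep (j t) (Y (j t)) (3 * A.θ) ∧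
      x t ∈ A.deep (j (t + 1)) (Y (j (t + 1))) (3 * A.θ)) →
    ∃ p, a ≤ p ∧ p ≤ a + n ∧ ∀ t, a ≤ t → t ≤ a + n →
      A.deep (j t) (Y (j t)) (3 * A.θ) ⊆ A.deep (j p) (Y (j p)) (2 * A.θ) := by
  induction n using Nat.strong_induction_on with
  | _ n ih =>
  intro a hx
  obtain ⟨p, hp, hmax⟩ := (Finset.Icc a (a + n)).exists_maximalFor
    (fun t => A.deep (j t) (Y (j t)) A.θ) ⟨a, by simp⟩
  rw [Finset.mem_Icc] at hp
  have step : ∀ q, a ≤ q → q ≤ a + n → ∀ y, y ∈ A.deep (j p) (Y (j p)) (3 * A.θ) →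
      y ∈ A.deep (j q) (Y (j q)) (2 * A.θ) →
      A.deep (j q) (Y (j q)) (2 * A.θ) ⊆ A.deep (j p) (Y (j p)) (2 * A.θ) := by
    intro q hq hq' y hy hy'
    rcases eq_or_ne (j p) (j q) with e | hne
    · rw [e]
    have e1 : A.deep (j q) (Y (j q)) (2 * A.θ) ⊆ A.deep (j q) (Y (j q)) A.θ :=
      deep_mono (by omega)
    rcases Splits.compare hne (hY _ (hj p)) (hY _ (hj q)) (deep_mono (by omega) hy) (e1 hy')
      with h | h
    · intro η hη
      refine deep_of_near (M := 2 * A.θ) (x := y) (deep_mono (by omega) hy) (h η (e1 hη))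
    · exfalso
      have hsub : A.deep (j p) (Y (j p)) A.θ ⊆ A.deep (j q) (Y (j q)) A.θ := fun η hη =>
        deep_of_near (M := A.θ) (x := y) (deep_mono (by omega) hy') (h η hη)
      have hsub' := hmax (Finset.mem_Icc.2 ⟨hq, hq'⟩) hsub
      obtain ⟨η, h1, h2⟩ := (hY _ (hj q)).exists_deep_far y A.θ
      have := h η (hsub' h1)
      omega
  refine ⟨p, hp.1, hp.2, fun t ht ht' => ?_⟩
  rcases lt_trichotomy t p with hlt | rfl | hlt
  · obtain ⟨q, hq, hq', hqt⟩ := ih (p - 1 - a) (by omega) a fun t h1 h2 => hx t h1 (by omega)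
    have h3 := hx (p - 1) (by omega) (by omega)
    rw [show p - 1 + 1 = p by omega] at h3
    exact (hqt t ht (by omega)).trans (step q hq (by omega) _ h3.2
      (hqt (p - 1) (by omega) (by omega) h3.1))
  · exact deep_mono (by omega)
  · obtain ⟨q, hq, hq', hqt⟩ := ih (a + n - (p + 1)) (by omega) (p + 1)
      fun t h1 h2 => hx t (by omega) (by omega)
    have h3 := hx p (by omega) (by omega)
    exact (hqt t (by omega) (by omega)).trans (step q (by omega) (by omega) _ h3.1
      (hqt (p + 1) (by omega) (by omega) h3.2))

variable (A)

/-- The points that `j` sees at distance more than `M` from everything far away for `i`. -/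
def core (i j : I) (M : ℕ) : Set Ω := {ξ | ∀ ζ, A.θ < A.d i ξ ζ → M < A.d j ξ ζ}

/-- Two points lie in a common core, seen from `i`. -/
def Link (i : I) (ξ η : Ω) : Prop :=
  ∃ j, j ≠ i ∧ ξ ∈ A.core i j (4 * A.θ) ∧ η ∈ A.core i j (4 * A.θ)

/-- The equivalence relation generated by links. -/
def Same (i : I) : Ω → Ω → Prop := Relation.ReflTransGen (A.Link i)

variable {A}

theorem Splits.core_subset {i j : I} {Y : Set Ω} (h : A.Splits i j Y) (M : ℕ) :
    A.core i j (M + A.θ) ⊆ A.deep j Y M := by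
  intro ξ hξ ζ hζ
  obtain ⟨η, hη, -⟩ := h.exists_deep_far ξ A.θ
  obtain ⟨ω, h1, h2⟩ := A.exists_far i η ξ A.θ
  have hω : ω ∈ Y := by
    by_contra hω
    have := h.1 ω hω η (notMem_of_deep hη)
    omega
  have := hξ ω (by rw [A.dist_comm]; exact h2)
  have := A.dist_tri j ξ ζ ω
  have := h.2 ζ hζ ω hω
  omega

theorem Link.symm {i : I} {ξ η : Ω} : A.Link i ξ η → A.Link i η ξ :=
  fun ⟨j, h, h1, h2⟩ => ⟨j, h, h2, h1⟩

theorem Same.symm {i : I} {ξ η : Ω} (h : A.Same i ξ η) : A.Same i η ξ := by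
  induction h with
  | refl => exact Relation.ReflTransGen.refl
  | tail _ h ih => exact Relation.ReflTransGen.head h.symm ih

theorem Same.trans {i : I} {ξ η ζ : Ω} (h : A.Same i ξ η) (h' : A.Same i η ζ) : A.Same i ξ ζ :=
  Relation.ReflTransGen.trans h h'

theorem Same.exists_chain {i : I} {ξ η : Ω} (h : A.Same i ξ η) : ξ = η ∨
    ∃ (n : ℕ) (j : ℕ → I) (x : ℕ → Ω), (∀ t, j t ≠ i) ∧
      (∀ t < n, x t ∈ A.core i (j t) (4 * A.θ) ∧ x t ∈ A.core i (j (t + 1)) (4 * A.θ)) ∧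
      ξ ∈ A.core i (j 0) (4 * A.θ) ∧ η ∈ A.core i (j n) (4 * A.θ) := by
  induction h with
  | refl => exact Or.inl rfl
  | @tail η' η h hl ih =>
    right
    obtain ⟨k, hk, h1, h2⟩ := hl
    rcases ih with rfl | ⟨n, j, x, hj, hx, h3, h4⟩
    · exact ⟨0, fun _ => k, fun _ => ξ, fun _ => hk, fun t ht => by omega, h1, h2⟩
    · refine ⟨n + 1, fun t => if t ≤ n then j t else k, fun t => if t < n then x t else η',
        fun t => ?_, fun t ht => ?_, ?_, ?_⟩
      · dsimp only
        split_ifs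
        · exact hj t
        · exact hk
      · rcases Nat.lt_succ_iff_lt_or_eq.1 ht with h | rfl
        · simpa [h, h.le, Nat.succ_le_of_lt h] using hx t h
        · simpa using ⟨h4, h1⟩
      · simpa using h3
      · simpa using h2

theorem Same.dist_le {i : I} {ξ η : Ω} (h : A.Same i ξ η) : A.d i ξ η ≤ A.θ := by
  classical
  rcases h.exists_chain with rfl | ⟨n, j, x, hj, hx, h3, h4⟩
  · rw [A.dist_self]; omega
  have hex : ∀ k, ∃ Y, k ≠ i → A.Splits i k Y := fun k => by
    by_cases hk : k = i
    · exact ⟨∅, fun h => absurd hk h⟩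
    · obtain ⟨Y, hY⟩ := A.partition i k (Ne.symm hk)
      exact ⟨Y, fun _ => hY⟩
  choose Y hY using hex
  have hsub : ∀ k, k ≠ i → A.core i k (4 * A.θ) ⊆ A.deep k (Y k) (3 * A.θ) := fun k hk => by
    have := (hY k hk).core_subset (3 * A.θ)
    rwa [show 3 * A.θ + A.θ = 4 * A.θ by ring] at this
  obtain ⟨p, -, -, hp⟩ := exists_deepest Y hY j hj x n 0 fun t _ ht =>
    ⟨hsub _ (hj t) (hx t (by omega)).1, hsub _ (hj _) (hx t (by omega)).2⟩
  exact (hY _ (hj p)).1 ξ (notMem_of_deep (hp 0 le_rfl (by omega) (hsub _ (hj 0) h3))) η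
    (notMem_of_deep (hp n (by omega) (by omega) (hsub _ (hj n) h4)))

theorem core_smul {g : G} {i j : I} {M : ℕ} {ξ : Ω} (h : ξ ∈ A.core i j M) :
    g • ξ ∈ A.core (g • i) (g • j) M := by
  intro ζ hζ
  obtain ⟨ζ, rfl⟩ := MulAction.surjective g ζ
  rw [A.smul_eq] at hζ ⊢
  exact h ζ hζ

theorem Same.smul {g : G} {i : I} {ξ η : Ω} (h : A.Same i ξ η) :
    A.Same (g • i) (g • ξ) (g • η) := by
  induction h with
  | refl => exact Relation.ReflTransGen.refl
  | tail _ h ih =>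
    obtain ⟨j, hj, h1, h2⟩ := h
    exact Relation.ReflTransGen.tail ih
      ⟨g • j, fun e => hj (MulAction.injective g e), core_smul h1, core_smul h2⟩

variable (A)

/-- The largest distance between points equivalent to two given ones. -/
noncomputable def exact (i : I) (ξ η : Ω) : ℕ :=
  sSup {t | ∃ ξ' η', A.Same i ξ ξ' ∧ A.Same i η η' ∧ t = A.d i ξ' η'}

variable {A}

theorem dist_le_of_same {i : I} {ξ η ξ' η' : Ω} (h : A.Same i ξ ξ') (h' : A.Same i η η') :
    A.d i ξ' η' ≤ A.d i ξ η + 2 * A.θ := by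
  have h1 := h.dist_le
  have h2 := h'.dist_le
  have h3 := A.dist_tri i ξ' ξ η'
  have h4 := A.dist_tri i ξ η η'
  rw [A.dist_comm i ξ' ξ] at h3
  omega

theorem le_exact {i : I} {ξ η ξ' η' : Ω} (h : A.Same i ξ ξ') (h' : A.Same i η η') :
    A.d i ξ' η' ≤ A.exact i ξ η := by
  refine le_csSup ⟨A.d i ξ η + 2 * A.θ, ?_⟩ ⟨ξ', η', h, h', rfl⟩
  rintro t ⟨ξ', η', h, h', rfl⟩
  exact dist_le_of_same h h'

theorem exact_le {i : I} {ξ η : Ω} {K : ℕ}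
    (h : ∀ ξ' η', A.Same i ξ ξ' → A.Same i η η' → A.d i ξ' η' ≤ K) : A.exact i ξ η ≤ K := by
  refine csSup_le ⟨_, ξ, η, Relation.ReflTransGen.refl, Relation.ReflTransGen.refl, rfl⟩ ?_
  rintro t ⟨ξ', η', h1, h2, rfl⟩
  exact h ξ' η' h1 h2

theorem dist_le_exact (i : I) (ξ η : Ω) : A.d i ξ η ≤ A.exact i ξ η :=
  le_exact Relation.ReflTransGen.refl Relation.ReflTransGen.refl

theorem exact_le_dist (i : I) (ξ η : Ω) : A.exact i ξ η ≤ A.d i ξ η + 2 * A.θ :=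
  exact_le fun _ _ => dist_le_of_same

theorem exact_congr {i : I} {ξ ξ' : Ω} (h : A.Same i ξ ξ') (η : Ω) :
    A.exact i ξ η = A.exact i ξ' η :=
  le_antisymm (exact_le fun _ _ h1 h2 => le_exact (h.symm.trans h1) h2)
    (exact_le fun _ _ h1 h2 => le_exact (h.trans h1) h2)

theorem exact_comm (i : I) (ξ η : Ω) : A.exact i ξ η = A.exact i η ξ := by
  have : ∀ ξ η, A.exact i ξ η ≤ A.exact i η ξ := fun ξ η =>
    exact_le fun ξ' η' h1 h2 => by rw [A.dist_comm]; exact le_exact h2 h1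
  exact le_antisymm (this _ _) (this _ _)

theorem exact_tri (i : I) (ξ η ζ : Ω) : A.exact i ξ ζ ≤ A.exact i ξ η + A.exact i η ζ :=
  exact_le fun ξ' ζ' h1 h2 => (A.dist_tri i ξ' η ζ').trans
    (Nat.add_le_add (le_exact h1 Relation.ReflTransGen.refl)
      (le_exact Relation.ReflTransGen.refl h2))

theorem exact_smul (g : G) (i : I) (ξ η : Ω) :
    A.exact (g • i) (g • ξ) (g • η) = A.exact i ξ η := by
  have : ∀ (g : G) i ξ η, A.exact i ξ η ≤ A.exact (g • i) (g • ξ) (g • η) := fun g i ξ η =>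
    exact_le fun ξ' η' h1 h2 => by rw [← A.smul_eq g]; exact le_exact h1.smul h2.smul
  refine le_antisymm ?_ (this _ _ _ _)
  have := this g⁻¹ (g • i) (g • ξ) (g • η)
  simpa using this

theorem Splits.before {i j : I} (hij : i ≠ j) {Z : Set Ω} (h : A.Splits i j Z) {ξ η : Ω}
    (hξ : ξ ∈ Z) (hη : η ∉ Z) (hi : 7 * A.θ < A.exact i ξ η) (hj : 7 * A.θ < A.exact j ξ η) :
    AxisBefore A.exact (7 * A.θ) i j ξ η := by
  have ei := exact_le_dist (A := A) i ξ η
  have ej := exact_le_dist (A := A) j ξ η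
  have hk : ∀ ζ, 5 * A.θ < A.d j ζ ξ → ζ ∈ A.core i j (4 * A.θ) := by
    intro ζ hζ ω hω
    have h1 : ζ ∉ Z := fun h1 => by have := h.2 ζ h1 ξ hξ; omega
    have h2 : ω ∈ Z := by
      by_contra h2
      have := h.1 ζ h1 ω h2
      omega
    have := h.2 ω h2 ξ hξ
    have := A.dist_tri j ζ ω ξ
    omega
  have hk' : ∀ ζ, 5 * A.θ < A.d i ζ η → ζ ∈ A.core j i (4 * A.θ) := by
    intro ζ hζ ω hω
    have h1 : ζ ∈ Z := by
      by_contra h1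
      have := h.1 ζ h1 η hη
      omega
    have h2 : ω ∉ Z := fun h2 => by
      have := h.2 ζ h1 ω h2
      omega
    have := h.1 ω h2 η hη
    have := A.dist_tri i ζ ω η
    omega
  refine ⟨fun ζ hζ ω =>
      exact_congr (Relation.ReflTransGen.single ⟨j, hij.symm, hk ζ ?_, hk η ?_⟩) ω,
    fun ζ hζ ω => exact_congr (Relation.ReflTransGen.single ⟨i, hij, hk' ζ ?_, hk' ξ ?_⟩) ω⟩
  · have := exact_le_dist (A := A) j ζ ξ
    omega
  · rw [A.dist_comm]; omega
  · have := exact_le_dist (A := A) i ζ η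
    omega
  · omega

variable (A)

/-- Passing to the largest distance between equivalent points gives exactly ordered axes. -/
noncomputable def toAxisSystem : AxisSystem G Ω I where
  d := A.exact
  κ := 7 * A.θ
  T₀ := A.T₀ + 2 * A.θ
  dist_comm := exact_comm
  dist_tri := exact_tri
  self_le i ξ := by
    have := exact_le_dist (A := A) i ξ ξ
    rw [A.dist_self] at this
    omega
  smul_eq := exact_smul
  unbounded i ξ K := by
    obtain ⟨ζ, hζ⟩ := A.unbounded i ξ K
    exact ⟨ζ, hζ.trans_le (dist_le_exact i ξ ζ)⟩
  finite_ge ξ η := (A.finite_ge ξ η).subset fun i hi => by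
    have := exact_le_dist (A := A) i ξ η
    simp only [Set.mem_ofPred_eq] at hi ⊢
    omega
  before_or i j ξ η hij hi hj := by
    obtain ⟨Z, hZ⟩ := A.partition i j hij
    have ei := exact_le_dist (A := A) i ξ η
    have ej := exact_le_dist (A := A) j ξ η
    by_cases hξ : ξ ∈ Z
    · by_cases hη : η ∈ Z
      · have := hZ.2 ξ hξ η hη
        omega
      · exact Or.inl (Splits.before hij hZ hξ hη hi hj)
    · by_cases hη : η ∈ Z
      · have hZ' : A.Splits j i Zᶜ :=
          ⟨fun a ha b hb => hZ.2 a (not_not.1 ha) b (not_not.1 hb), hZ.1⟩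
        exact Or.inr (Splits.before hij.symm hZ' hξ (not_not.2 hη) hj hi)
      · have := hZ.1 ξ hξ η hη
        omega

end CoarseSystem

namespace Slope

variable {N : ℕ}

/-- The inverse of a letter. -/
def bar (l : Fin N × Bool) : Fin N × Bool := (l.1, !l.2)

@[simp] theorem bar_bar (l : Fin N × Bool) : bar (bar l) = l := by simp [bar]

/-- The element of the free group represented by a letter. -/
def letter (l : Fin N × Bool) : FreeGroup (Fin N) := FreeGroup.mk [l]

theorem letter_true (i : Fin N) : letter (i, true) = FreeGroup.of i := rfl

theorem letter_bar (l : Fin N × Bool) : letter (bar l) = (letter l)⁻¹ := by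
  simp [letter, bar, FreeGroup.inv_mk, FreeGroup.invRev]

theorem letter_false (i : Fin N) : letter (i, false) = (FreeGroup.of i)⁻¹ := by
  rw [← letter_true, ← letter_bar]; rfl

/-- The position of a letter in the cyclic order, as an integer. -/
def code (l : Fin N × Bool) : ℤ := 2 * (l.1 : ℕ) + if l.2 then 0 else 1

theorem code_nonneg (l : Fin N × Bool) : 0 ≤ code l := by
  unfold code; split <;> positivity

theorem code_injective : Function.Injective (code : Fin N × Bool → ℤ) := by
  rintro ⟨i, b⟩ ⟨j, c⟩ h
  simp only [code] at h
  have : i = j ∧ b = c := by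
    cases b <;> cases c <;> simp at h ⊢ <;> omega
  rw [this.1, this.2]

/-- The centre of the interval of slopes of words starting with a given letter. -/
def center (l : Fin N × Bool) : ℚ := 3 * code l

/-- The Möbius transformation by which a generator acts. -/
def mobius (i : Fin N) : Equiv.Perm ℚ where
  toFun z := center (i, true) - (z - center (i, false))⁻¹
  invFun z := center (i, false) - (z - center (i, true))⁻¹
  left_inv z := by simp [inv_neg]
  right_inv z := by simp [inv_neg]

/-- The action of the free group by Möbius transformations. -/
def act : FreeGroup (Fin N) →* Equiv.Perm ℚ := FreeGroup.lift mobius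

/-- The slope of an element of the free group. -/
def slope (k : FreeGroup (Fin N)) : ℚ := act k (-10)

@[simp] theorem slope_one : slope (1 : FreeGroup (Fin N)) = -10 := by simp [slope]

theorem slope_letter_mul (l : Fin N × Bool) (k : FreeGroup (Fin N)) :
    slope (letter l * k) = center l - (slope k - center (bar l))⁻¹ := by
  obtain ⟨i, b⟩ := l
  cases b
  · rw [letter_false]
    simp only [slope, map_mul, map_inv, act, FreeGroup.lift_apply_of, Equiv.Perm.mul_apply]
    rfl
  · rw [letter_true]
    simp only [slope, map_mul, act, FreeGroup.lift_apply_of, Equiv.Perm.mul_apply]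
    rfl

/-- The elements whose reduced word starts with a given letter. -/
def D (l : Fin N × Bool) : Set (FreeGroup (Fin N)) := {k | |slope k - center l| < 1}

theorem mem_D {l : Fin N × Bool} {k : FreeGroup (Fin N)} :
    k ∈ D l ↔ center l - 1 < slope k ∧ slope k < center l + 1 := by
  unfold D
  rw [Set.mem_ofPred_eq, abs_lt]
  constructor <;> rintro ⟨h1, h2⟩ <;> constructor <;> linarith

theorem center_add_le {l l' : Fin N × Bool} (h : code l < code l') :
    center l + 3 ≤ center l' := by
  unfold center
  have : (code l : ℚ) + 1 ≤ code l' := by exact_mod_cast h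
  linarith

theorem abs_inv_lt_one {x : ℚ} (h : x < -1 ∨ 1 < x) : |x⁻¹| < 1 := by
  rw [abs_inv]
  apply inv_lt_one_of_one_lt₀
  rcases h with h | h
  · rw [abs_of_neg (by linarith)]; linarith
  · rw [abs_of_pos (by linarith)]; linarith

theorem letter_mul_mem_D {l : Fin N × Bool} {k : FreeGroup (Fin N)}
    (h : slope k < center (bar l) - 1 ∨ center (bar l) + 1 < slope k) :
    letter l * k ∈ D l := by
  unfold D
  rw [Set.mem_ofPred_eq, slope_letter_mul]
  have := abs_inv_lt_one (x := slope k - center (bar l)) (by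
    rcases h with h | h
    · left; linarith
    · right; linarith)
  rw [sub_right_comm, sub_self, zero_sub, abs_neg]
  exact this

theorem slope_one_lt (l : Fin N × Bool) : slope (1 : FreeGroup (Fin N)) < center l - 1 := by
  rw [slope_one]
  have : (0 : ℚ) ≤ code l := by exact_mod_cast code_nonneg l
  unfold center
  linarith

theorem one_notMem_D (l : Fin N × Bool) : (1 : FreeGroup (Fin N)) ∉ D l := by
  rw [mem_D]
  have := slope_one_lt l
  intro h
  linarith [h.1]

theorem out_of_mem_D {l l' : Fin N × Bool} {k : FreeGroup (Fin N)} (h : k ∈ D l) (hne : l ≠ l') :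
    slope k < center l' - 1 ∨ center l' + 1 < slope k := by
  rw [mem_D] at h
  rcases lt_trichotomy (code l) (code l') with h1 | h1 | h1
  · have := center_add_le h1
    left; linarith
  · exact absurd (code_injective h1) hne
  · have := center_add_le h1
    right; linarith

theorem mem_D_of_word (L : List (Fin N × Bool)) (l : Fin N × Bool)
    (h : FreeGroup.IsReduced (l :: L)) : FreeGroup.mk (l :: L) ∈ D l := by
  induction L generalizing l with
  | nil =>
    have := letter_mul_mem_D (l := l) (k := 1) (Or.inl (slope_one_lt _))
    rwa [mul_one] at this
  | cons m L ih =>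
    rw [FreeGroup.isReduced_cons_cons] at h
    have := ih m h.2
    have hml : m ≠ bar l := by
      rintro rfl
      have := h.1 rfl
      simp [bar] at this
    have key := letter_mul_mem_D (out_of_mem_D this hml)
    rw [letter, FreeGroup.mul_mk] at key
    exact key

/-- Every element is trivial or belongs to one of the classes `D l`, and can be peeled. -/
theorem exists_peel (k : FreeGroup (Fin N)) :
    k = 1 ∨ ∃ l k', k = letter l * k' ∧ k'.norm + 1 = k.norm ∧ k' ∉ D (bar l) ∧ k ∈ D l := by
  rcases hk : k.toWord with _ | ⟨l, L⟩
  · left; exact FreeGroup.toWord_eq_nil_iff.1 hk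
  · right
    have hred : FreeGroup.IsReduced (l :: L) := hk ▸ FreeGroup.isReduced_toWord
    have hkm : k = FreeGroup.mk (l :: L) := by rw [← hk, FreeGroup.mk_toWord]
    have hredL : FreeGroup.IsReduced L := List.IsChain.tail hred
    refine ⟨l, FreeGroup.mk L, hkm, ?_, ?_, hkm ▸ mem_D_of_word L l hred⟩
    · simp [FreeGroup.norm, hk, FreeGroup.toWord_mk, hredL.reduce_eq]
    · rcases L with _ | ⟨m, L⟩
      · exact one_notMem_D _
      · rw [FreeGroup.isReduced_cons_cons] at hred
        have hml : m ≠ bar l := by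
          rintro rfl
          have := hred.1 rfl
          simp [bar] at this
        intro h
        rw [mem_D] at h
        rcases out_of_mem_D (mem_D_of_word L m hred.2) hml with h' | h' <;> linarith [h.1, h.2]

theorem eq_one_or_mem_D (k : FreeGroup (Fin N)) : k = 1 ∨ ∃ l, k ∈ D l := by
  rcases exists_peel k with h | ⟨l, k', -, -, -, h⟩
  · exact Or.inl h
  · exact Or.inr ⟨l, h⟩

theorem out_of_notMem_D {l : Fin N × Bool} {k : FreeGroup (Fin N)} (h : k ∉ D l) :
    slope k < center l - 1 ∨ center l + 1 < slope k := by
  rcases eq_one_or_mem_D k with rfl | ⟨m, hm⟩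
  · exact Or.inl (slope_one_lt l)
  · exact out_of_mem_D hm (by rintro rfl; exact h hm)

theorem eq_of_mem_D {l l' : Fin N × Bool} {k : FreeGroup (Fin N)} (h : k ∈ D l) (h' : k ∈ D l') :
    l = l' := by
  by_contra hne
  rw [mem_D] at h'
  rcases out_of_mem_D h hne with h1 | h1 <;> linarith [h'.1, h'.2]

theorem letter_mul_mem_D_iff {l : Fin N × Bool} {k : FreeGroup (Fin N)} :
    letter l * k ∈ D l ↔ k ∉ D (bar l) := by
  constructor
  · intro h h'
    rcases exists_peel k with rfl | ⟨m, k', rfl, -, hk', hm⟩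
    · exact one_notMem_D _ h'
    · obtain rfl := eq_of_mem_D hm h'
      rw [letter_bar, mul_inv_cancel_left] at h
      rw [bar_bar] at hk'
      exact hk' h
  · intro h
    exact letter_mul_mem_D (out_of_notMem_D h)

theorem peel_induction {P : FreeGroup (Fin N) → Prop} (one : P 1)
    (mul : ∀ l k, k ∉ D (bar l) → P k → P (letter l * k)) (k : FreeGroup (Fin N)) : P k := by
  induction hn : k.norm using Nat.strong_induction_on generalizing k with
  | _ n ih =>
    rcases exists_peel k with rfl | ⟨l, k', rfl, h1, h2, -⟩
    · exact one
    · exact mul l k' h2 (ih k'.norm (by omega) k' rfl)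

theorem slope_lt_of_code_lt {l l' : Fin N × Bool} {a b : FreeGroup (Fin N)} (ha : a ∈ D l)
    (hb : b ∈ D l') (h : code l < code l') : slope a < slope b := by
  rw [mem_D] at ha hb
  have := center_add_le h
  linarith [ha.1, hb.1, ha.2]

theorem slope_one_lt_of_ne {k : FreeGroup (Fin N)} (h : k ≠ 1) :
    slope (1 : FreeGroup (Fin N)) < slope k := by
  rcases eq_one_or_mem_D k with rfl | ⟨m, hm⟩
  · exact absurd rfl h
  · rw [mem_D] at hm
    linarith [slope_one_lt m, hm.1]

theorem slope_injective : Function.Injective (slope : FreeGroup (Fin N) → ℚ) := by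
  intro k k' h
  have h1 : slope (k⁻¹ * k') = slope (1 : FreeGroup (Fin N)) := by
    simp only [slope] at h ⊢
    rw [map_mul, Equiv.Perm.mul_apply, ← h, ← Equiv.Perm.mul_apply, ← map_mul, inv_mul_cancel]
  by_contra hne
  have : k⁻¹ * k' ≠ 1 := by
    intro h2
    exact hne (inv_mul_eq_one.1 h2)
  have := slope_one_lt_of_ne this
  linarith

/-- The cyclic order of rational numbers. -/
def RCyc (x y z : ℚ) : Prop := (x < y ∧ y < z) ∨ (y < z ∧ z < x) ∨ (z < x ∧ x < y)

theorem rCyc_iff (x y z : ℚ) : RCyc x y z ↔ 0 < (x - y) * (y - z) * (z - x) := by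
  unfold RCyc
  constructor
  · rintro (⟨h1, h2⟩ | ⟨h1, h2⟩ | ⟨h1, h2⟩)
    · exact mul_pos (mul_pos_of_neg_of_neg (by linarith) (by linarith)) (by linarith)
    · rw [mul_assoc]
      exact mul_pos (by linarith) (mul_pos_of_neg_of_neg (by linarith) (by linarith))
    · rw [mul_right_comm]
      exact mul_pos (mul_pos_of_neg_of_neg (by linarith) (by linarith)) (by linarith)
  · intro h
    rcases lt_trichotomy x y with h1 | rfl | h1
    · rcases lt_trichotomy y z with h2 | rfl | h2
      · exact Or.inl ⟨h1, h2⟩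
      · simp at h
      · refine Or.inr (Or.inr ⟨?_, h1⟩)
        by_contra h3
        have : (x - y) * (y - z) < 0 := mul_neg_of_neg_of_pos (by linarith) (by linarith)
        nlinarith
    · simp at h
    · rcases lt_trichotomy y z with h2 | rfl | h2
      · refine Or.inr (Or.inl ⟨h2, ?_⟩)
        by_contra h3
        have : (x - y) * (y - z) < 0 := mul_neg_of_pos_of_neg (by linarith) (by linarith)
        nlinarith
      · simp at h
      · exfalso
        have : 0 < (x - y) * (y - z) := mul_pos (by linarith) (by linarith)
        nlinarith

/-- The cyclic order of the free group. -/
def Cyc (a b c : FreeGroup (Fin N)) : Prop := RCyc (slope a) (slope b) (slope c)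

theorem slope_ne_center (l : Fin N × Bool) (k : FreeGroup (Fin N)) : slope k ≠ center l := by
  intro h
  rcases exists_peel k with rfl | ⟨m, k', rfl, -, hk', hm⟩
  · linarith [slope_one_lt l]
  · have : letter m * k' ∈ D l := by rw [mem_D]; constructor <;> linarith
    obtain rfl := eq_of_mem_D hm this
    rw [slope_letter_mul] at h
    rcases out_of_notMem_D hk' with h' | h'
    · have : (slope k' - center (bar m))⁻¹ < 0 := inv_lt_zero.2 (by linarith)
      linarith
    · have : 0 < (slope k' - center (bar m))⁻¹ := inv_pos.2 (by linarith)
      linarith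

theorem cyc_letter_mul (l : Fin N × Bool) (a b c : FreeGroup (Fin N)) :
    Cyc (letter l * a) (letter l * b) (letter l * c) ↔ Cyc a b c := by
  unfold Cyc
  rw [rCyc_iff, rCyc_iff, slope_letter_mul, slope_letter_mul, slope_letter_mul]
  have ha := sub_ne_zero.2 (slope_ne_center (bar l) a)
  have hb := sub_ne_zero.2 (slope_ne_center (bar l) b)
  have hc := sub_ne_zero.2 (slope_ne_center (bar l) c)
  set x := slope a - center (bar l)
  set y := slope b - center (bar l)
  set z := slope c - center (bar l)
  have e1 : (slope a - slope b) * (slope b - slope c) * (slope c - slope a)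
      = (x - y) * (y - z) * (z - x) := by simp only [x, y, z]; ring
  have e2 : (center l - x⁻¹ - (center l - y⁻¹)) * (center l - y⁻¹ - (center l - z⁻¹)) *
      (center l - z⁻¹ - (center l - x⁻¹)) =
      ((x - y) * (y - z) * (z - x)) * ((x * y * z) ^ 2)⁻¹ := by
    field_simp
    ring
  rw [e1, e2]
  have : 0 < ((x * y * z) ^ 2)⁻¹ := by positivity
  constructor
  · intro h; exact pos_of_mul_pos_left h this.le
  · intro h; exact mul_pos h this

theorem cyc_mul (g a b c : FreeGroup (Fin N)) : Cyc (g * a) (g * b) (g * c) ↔ Cyc a b c := by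
  induction g using peel_induction generalizing a b c with
  | one => simp
  | mul l k _ ih => rw [mul_assoc, mul_assoc, mul_assoc, cyc_letter_mul, ih]

/-- The pairs `a, b` and `c, d` separate each other. -/
def RLink (a b c d : ℚ) : Prop :=
  (RCyc a c b ∧ RCyc b d a) ∨ (RCyc a d b ∧ RCyc b c a)

/-- The pairs `a, b` and `c, d` separate each other in the cyclic order. -/
def Link (a b c d : FreeGroup (Fin N)) : Prop :=
  (Cyc a c b ∧ Cyc b d a) ∨ (Cyc a d b ∧ Cyc b c a)

theorem link_iff {a b c d : FreeGroup (Fin N)} :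
    Link a b c d ↔ RLink (slope a) (slope b) (slope c) (slope d) := Iff.rfl

theorem link_mul (g a b c d : FreeGroup (Fin N)) :
    Link (g * a) (g * b) (g * c) (g * d) ↔ Link a b c d := by
  unfold Link; simp only [cyc_mul]

theorem link_swap {a b c d : FreeGroup (Fin N)} (h : Link a b c d) : Link b a d c := by
  rw [link_iff] at *; unfold RLink RCyc at *; grind

theorem link_symm {a b c d : FreeGroup (Fin N)} (h : Link a b c d) : Link c d a b := by
  rw [link_iff] at *; unfold RLink RCyc at *; grind

theorem not_link_self (a c d : FreeGroup (Fin N)) : ¬ Link a a c d := by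
  rw [link_iff] at *; unfold RLink RCyc at *; grind

theorem link_mid {a b c d : FreeGroup (Fin N)} (m : FreeGroup (Fin N)) (h : Link a b c d) :
    Link a m c d ∨ Link m b c d ∨ m = c ∨ m = d := by
  have h1 : m = c ↔ slope m = slope c := slope_injective.eq_iff.symm
  have h2 : m = d ↔ slope m = slope d := slope_injective.eq_iff.symm
  rw [h1, h2, link_iff, link_iff]
  rw [link_iff] at h
  unfold RLink RCyc at *
  grind

/-- A subset not separated from its complement by the cyclic order. -/
def Conv (V : Set (FreeGroup (Fin N))) : Prop :=
  ∀ a ∈ V, ∀ b ∈ V, ∀ c ∉ V, ∀ d ∉ V, ¬ Link a b c d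

theorem Conv.compl {V : Set (FreeGroup (Fin N))} (h : Conv V) : Conv Vᶜ := by
  intro a ha b hb c hc d hd hl
  exact h c (not_not.1 hc) d (not_not.1 hd) a ha b hb (link_symm hl)

theorem conv_D (l : Fin N × Bool) : Conv (D l) := by
  intro a ha b hb c hc d hd h
  have hc := out_of_notMem_D hc
  have hd := out_of_notMem_D hd
  rw [mem_D] at ha hb
  rw [link_iff] at h
  unfold RLink RCyc at h
  grind

theorem same_arc {v₁ v₂ v₃ x y : ℚ} (hv : RCyc v₁ v₂ v₃) (h1 : v₁ ≠ x) (h2 : v₂ ≠ x) (h3 : v₃ ≠ x)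
    (k1 : v₁ ≠ y) (k2 : v₂ ≠ y) (k3 : v₃ ≠ y) (b : ¬ RLink v₁ v₃ x y)
    (c : ¬ RLink v₂ v₃ x y) :
    (RCyc v₁ x v₂ ∧ RCyc v₁ y v₂) ∨ (RCyc v₂ x v₃ ∧ RCyc v₂ y v₃) ∨
      (RCyc v₃ x v₁ ∧ RCyc v₃ y v₁) := by
  unfold RLink RCyc at *
  grind

theorem rLink_of_arc {v₁ v₂ v₃ x : ℚ} (hv : RCyc v₁ v₂ v₃) (h : RCyc v₃ x v₁) :
    RLink v₂ x v₁ v₃ := by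
  unfold RLink RCyc at *
  grind

theorem arc_unique {v₁ v₂ v₃ x : ℚ} (hv : RCyc v₁ v₂ v₃) (h : RCyc v₃ x v₁) :
    ¬ RCyc v₁ x v₂ ∧ ¬ RCyc v₂ x v₃ := by
  unfold RCyc at *
  grind

theorem rCyc_rot {x y z : ℚ} (h : RCyc x y z) : RCyc y z x := by
  unfold RCyc at *; tauto

theorem rCyc_total {x y z : ℚ} (h1 : x ≠ y) (h2 : x ≠ z) (h3 : y ≠ z) :
    RCyc x y z ∨ RCyc z y x := by
  unfold RCyc; grind

theorem rLink_symm {a b c d : ℚ} (h : RLink a b c d) : RLink a b d c := by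
  unfold RLink at *; tauto

theorem rLink_swap {a b c d : ℚ} (h : RLink a b c d) : RLink b a c d :=
  h.elim (fun h => Or.inr ⟨h.2, h.1⟩)
    (fun h => Or.inl ⟨h.2, h.1⟩)

/-- Three disjoint convex sets cannot all cross a convex set. -/
theorem not_three_crossing {V J₁ J₂ J₃ : Set (FreeGroup (Fin N))} (hV : Conv V) (h₁ : Conv J₁)
    (h₂ : Conv J₂) (h₃ : Conv J₃) (d₁₂ : Disjoint J₁ J₂) (d₁₃ : Disjoint J₁ J₃)
    (d₂₃ : Disjoint J₂ J₃) (c₁ : (J₁ ∩ V).Nonempty) (c₂ : (J₂ ∩ V).Nonempty)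
    (c₃ : (J₃ ∩ V).Nonempty) (e₁ : (J₁ ∩ Vᶜ).Nonempty) (e₂ : (J₂ ∩ Vᶜ).Nonempty)
    (e₃ : (J₃ ∩ Vᶜ).Nonempty) : False := by
  obtain ⟨v₁, hv₁, hv₁'⟩ := c₁
  obtain ⟨v₂, hv₂, hv₂'⟩ := c₂
  obtain ⟨v₃, hv₃, hv₃'⟩ := c₃
  obtain ⟨u₁, hu₁, hu₁'⟩ := e₁
  obtain ⟨u₂, hu₂, hu₂'⟩ := e₂
  obtain ⟨u₃, hu₃, hu₃'⟩ := e₃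
  rw [Set.disjoint_left] at d₁₂ d₁₃ d₂₃
  have n12 : slope v₁ ≠ slope v₂ := fun h => d₁₂ hv₁ (slope_injective h ▸ hv₂)
  have n13 : slope v₁ ≠ slope v₃ := fun h => d₁₃ hv₁ (slope_injective h ▸ hv₃)
  have n23 : slope v₂ ≠ slope v₃ := fun h => d₂₃ hv₂ (slope_injective h ▸ hv₃)
  have m : ∀ v ∈ V, ∀ u ∉ V, slope v ≠ slope u := fun v hv u hu h => hu (slope_injective h ▸ hv)
  have a1 := hV v₁ hv₁' v₂ hv₂' u₁ hu₁' u₂ hu₂'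
  have a2 := hV v₁ hv₁' v₂ hv₂' u₁ hu₁' u₃ hu₃'
  have a3 := hV v₁ hv₁' v₃ hv₃' u₁ hu₁' u₂ hu₂'
  have a4 := hV v₁ hv₁' v₃ hv₃' u₁ hu₁' u₃ hu₃'
  have a5 := hV v₂ hv₂' v₃ hv₃' u₁ hu₁' u₂ hu₂'
  have a6 := hV v₂ hv₂' v₃ hv₃' u₁ hu₁' u₃ hu₃'
  have b1 := h₁ v₁ hv₁ u₁ hu₁ v₂ (fun h => d₁₂ h hv₂) v₃ (fun h => d₁₃ h hv₃)
  have b2 := h₂ v₂ hv₂ u₂ hu₂ v₁ (fun h => d₁₂ hv₁ h) v₃ (fun h => d₂₃ h hv₃)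
  have b3 := h₃ v₃ hv₃ u₃ hu₃ v₁ (fun h => d₁₃ hv₁ h) v₂ (fun h => d₂₃ hv₂ h)
  have p11 := m v₁ hv₁' u₁ hu₁'
  have p12 := m v₁ hv₁' u₂ hu₂'
  have p13 := m v₁ hv₁' u₃ hu₃'
  have p21 := m v₂ hv₂' u₁ hu₁'
  have p22 := m v₂ hv₂' u₂ hu₂'
  have p23 := m v₂ hv₂' u₃ hu₃'
  have p31 := m v₃ hv₃' u₁ hu₁'
  have p32 := m v₃ hv₃' u₂ hu₂'
  have p33 := m v₃ hv₃' u₃ hu₃'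
  simp only [link_iff] at a1 a2 a3 a4 a5 a6 b1 b2 b3
  clear hV h₁ h₂ h₃ m d₁₂ d₁₃ d₂₃
  have key : ∀ v₁ v₂ v₃ u₁ u₂ u₃ : ℚ, RCyc v₁ v₂ v₃ →
      (v₁ ≠ u₁ ∧ v₂ ≠ u₁ ∧ v₃ ≠ u₁) → (v₁ ≠ u₂ ∧ v₂ ≠ u₂ ∧ v₃ ≠ u₂) →
      (v₁ ≠ u₃ ∧ v₂ ≠ u₃ ∧ v₃ ≠ u₃) →
      (¬ RLink v₁ v₃ u₁ u₂ ∧ ¬ RLink v₂ v₃ u₁ u₂) →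
      (¬ RLink v₁ v₃ u₁ u₃ ∧ ¬ RLink v₂ v₃ u₁ u₃) →
      ¬ RLink v₁ u₁ v₂ v₃ → ¬ RLink v₂ u₂ v₁ v₃ → ¬ RLink v₃ u₃ v₁ v₂ → False := by
    intro v₁ v₂ v₃ u₁ u₂ u₃ hv q1 q2 q3 r2 r3 t1 t2 t3
    have s2 := same_arc hv q1.1 q1.2.1 q1.2.2 q2.1 q2.2.1 q2.2.2 r2.1 r2.2
    have s3 := same_arc hv q1.1 q1.2.1 q1.2.2 q3.1 q3.2.1 q3.2.2 r3.1 r3.2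
    have hv' := rCyc_rot hv
    have hv'' := rCyc_rot hv'
    have w2 : ¬ RCyc v₃ u₂ v₁ := fun h => t2 (rLink_of_arc hv h)
    have w3 : ¬ RCyc v₁ u₃ v₂ := fun h => t3 (rLink_symm (rLink_of_arc hv' h))
    have w1 : ¬ RCyc v₂ u₁ v₃ := fun h => t1 (rLink_symm (rLink_of_arc hv'' h))
    have x2 : RCyc v₁ u₁ v₂ := by
      rcases s2 with s | s | s
      exacts [s.1, absurd s.1 w1, absurd s.2 w2]
    have x3 : RCyc v₃ u₁ v₁ := by
      rcases s3 with s | s | s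
      exacts [absurd s.2 w3, absurd s.1 w1, s.1]
    exact (arc_unique hv x3).1 x2
  rcases rCyc_total n12 n13 n23 with h | h
  · exact key _ _ _ _ _ _ h ⟨p11, p21, p31⟩ ⟨p12, p22, p32⟩ ⟨p13, p23, p33⟩ ⟨a3, a5⟩ ⟨a4, a6⟩
      b1 b2 b3
  · refine key _ _ _ (slope u₁) (slope u₃) (slope u₂) (rCyc_rot (rCyc_rot h))
      ⟨p11, p31, p21⟩ ⟨p13, p33, p23⟩ ⟨p12, p32, p22⟩
      ⟨a2, fun h => a6 (rLink_swap h)⟩ ⟨a1, fun h => a5 (rLink_swap h)⟩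
      (fun h => b1 (rLink_symm h)) b3 b2

end Slope

namespace Slope

variable {N : ℕ}

theorem mul_letter_eq_one {h : FreeGroup (Fin N)} {l t : Fin N × Bool} (h1 : h ∈ D l)
    (h2 : h * letter t ∉ D l) : h * letter t = 1 := by
  induction h using peel_induction generalizing l with
  | one => exact absurd h1 (one_notMem_D l)
  | mul m k hk ih =>
    obtain rfl := eq_of_mem_D (letter_mul_mem_D_iff.2 hk) h1
    rw [mul_assoc, letter_mul_mem_D_iff, not_not] at h2
    rcases eq_one_or_mem_D k with rfl | ⟨z, hz⟩
    · rw [one_mul] at h2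
      have ht : letter t ∈ D t := by
        have := letter_mul_mem_D_iff.2 (one_notMem_D (bar t))
        rwa [mul_one] at this
      obtain rfl := eq_of_mem_D ht h2
      rw [mul_one, letter_bar, mul_inv_cancel]
    · by_cases hkt : k * letter t ∈ D z
      · obtain rfl := eq_of_mem_D hkt h2
        exact absurd hz hk
      · have := ih hz hkt
        rw [this] at h2
        exact absurd h2 (one_notMem_D _)

theorem letter_mem_D (t : Fin N × Bool) : letter t ∈ D t := by
  have := letter_mul_mem_D_iff.2 (one_notMem_D (bar t))
  rwa [mul_one] at this

/-- Only finitely many translates of `D l` separate two given elements. -/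
theorem finite_separating (l : Fin N × Bool) (ξ η : FreeGroup (Fin N)) :
    {h | ¬ (h * ξ ∈ D l ↔ h * η ∈ D l)}.Finite := by
  have base : ∀ (t : Fin N × Bool) (ξ : FreeGroup (Fin N)),
      {h | ¬ (h * ξ ∈ D l ↔ h * (ξ * letter t) ∈ D l)}.Finite := by
    intro t ξ
    refine (Set.toFinite {ξ⁻¹, (ξ * letter t)⁻¹}).subset ?_
    intro h hh
    rw [Set.mem_ofPred_eq] at hh
    rw [Set.mem_insert_iff, Set.mem_singleton_iff, eq_inv_iff_mul_eq_one, eq_inv_iff_mul_eq_one]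
    by_cases h1 : h * ξ ∈ D l
    · have h2 : h * ξ * letter t ∉ D l := by rw [mul_assoc]; tauto
      right
      rw [← mul_assoc]
      exact mul_letter_eq_one h1 h2
    · left
      have h2 : h * ξ * letter t ∈ D l := by rw [mul_assoc]; tauto
      have := mul_letter_eq_one (t := bar t) h2 (by rwa [letter_bar, mul_inv_cancel_right])
      rwa [letter_bar, mul_inv_cancel_right] at this
  have main : ∀ u ξ : FreeGroup (Fin N), {h | ¬ (h * ξ ∈ D l ↔ h * (ξ * u) ∈ D l)}.Finite := by
    intro u
    induction u using peel_induction with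
    | one => intro ξ; simp
    | mul t k _ ih =>
      intro ξ
      refine ((base t ξ).union (ih (ξ * letter t))).subset ?_
      intro h hh
      rw [Set.mem_union, Set.mem_ofPred_eq, Set.mem_ofPred_eq, mul_assoc ξ]
      rw [Set.mem_ofPred_eq] at hh
      tauto
  have := main (ξ⁻¹ * η) ξ
  rwa [mul_inv_cancel_left] at this

theorem not_link_of_mem_D {l : Fin N × Bool} {a b c d : FreeGroup (Fin N)} (ha : a ∉ D l)
    (hb : b ∉ D l) (hc : c ∈ D l) (hd : d ∈ D l) : ¬ Link a b c d :=
  fun h => conv_D l c hc d hd a ha b hb (link_symm h)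

/-- The translates of the pair `c, d` separated by the pair `a, b`. -/
def lkSet (a b c d : FreeGroup (Fin N)) : Set (FreeGroup (Fin N)) := {h | Link a b (h * c) (h * d)}

theorem mem_lkSet {a b c d h : FreeGroup (Fin N)} : h ∈ lkSet a b c d ↔ Link a b (h * c) (h * d) :=
  Iff.rfl

theorem lkSet_letter_finite (s t : Fin N × Bool) : (lkSet 1 (letter s) 1 (letter t)).Finite := by
  refine (Set.toFinite {1, (letter t)⁻¹, letter s, letter s * (letter t)⁻¹}).subset ?_
  intro h hh
  rw [mem_lkSet, mul_one] at hh
  by_contra hcon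
  simp only [Set.mem_insert_iff, Set.mem_singleton_iff, not_or] at hcon
  obtain ⟨h1, h2, h3, h4⟩ := hcon
  obtain ⟨l, hl⟩ := (eq_one_or_mem_D h).resolve_left h1
  have hlt : h * letter t ∈ D l := by
    by_contra hc
    exact h2 (eq_inv_of_mul_eq_one_left (mul_letter_eq_one hl hc))
  by_cases hls : l = s
  · subst hls
    rw [← link_mul (letter l)⁻¹, mul_one, inv_mul_cancel, ← mul_assoc] at hh
    have h3' : (letter l)⁻¹ * h ≠ 1 := fun hc => h3 (inv_mul_eq_one.1 hc).symm
    obtain ⟨m, hm⟩ := (eq_one_or_mem_D ((letter l)⁻¹ * h)).resolve_left h3'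
    have hmt : (letter l)⁻¹ * h * letter t ∈ D m := by
      by_contra hc
      have := eq_inv_of_mul_eq_one_left (mul_letter_eq_one hm hc)
      exact h4 (by rw [← this, mul_inv_cancel_left])
    refine not_link_of_mem_D ?_ (one_notMem_D m) hm hmt hh
    rw [← letter_bar]
    intro hc
    obtain rfl := eq_of_mem_D hc (letter_mem_D (bar l))
    rw [← letter_bar, letter_mul_mem_D_iff, bar_bar] at hm
    exact hm hl
  · refine not_link_of_mem_D (one_notMem_D l) ?_ hl hlt hh
    intro hc
    exact hls (eq_of_mem_D hc (letter_mem_D s))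

theorem mem_lkSet_translate {a b c d h g g' : FreeGroup (Fin N)} :
    h ∈ lkSet (g * a) (g * b) (g' * c) (g' * d) ↔ g⁻¹ * h * g' ∈ lkSet a b c d := by
  rw [mem_lkSet, mem_lkSet, ← link_mul g a b]
  simp only [mul_assoc, mul_inv_cancel_left]

theorem lkSet_translate (a b c d g g' : FreeGroup (Fin N)) :
    lkSet (g * a) (g * b) (g' * c) (g' * d) = (fun h => g * h * g'⁻¹) '' lkSet a b c d := by
  ext h
  rw [mem_lkSet_translate, Set.mem_image]
  constructor
  · intro hh
    exact ⟨_, hh, by group⟩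
  · rintro ⟨k, hk, rfl⟩
    convert hk using 1
    group

theorem lkSet_swap (a b c d : FreeGroup (Fin N)) :
    lkSet c d a b = (fun h => h⁻¹) '' lkSet a b c d := by
  ext h
  rw [mem_lkSet, Set.mem_image, ← link_mul h⁻¹, inv_mul_cancel_left, inv_mul_cancel_left]
  constructor
  · intro hh
    exact ⟨h⁻¹, link_symm hh, inv_inv h⟩
  · rintro ⟨k, hk, rfl⟩
    rw [inv_inv]
    exact link_symm hk

theorem lkSet_subset (u v c d : FreeGroup (Fin N)) :
    lkSet 1 (u * v) c d ⊆ (lkSet 1 u c d ∪ lkSet (u * 1) (u * v) c d) ∪ {u * c⁻¹, u * d⁻¹} := by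
  intro h hh
  rw [mul_one]
  rcases link_mid u hh with h1 | h1 | h1 | h1
  · exact Or.inl (Or.inl h1)
  · exact Or.inl (Or.inr h1)
  · exact Or.inr (Or.inl (eq_mul_inv_of_mul_eq h1.symm))
  · exact Or.inr (Or.inr (eq_mul_inv_of_mul_eq h1.symm))

theorem lkSet_finite_translate {a b c d : FreeGroup (Fin N)} (h : (lkSet a b c d).Finite)
    (g g' : FreeGroup (Fin N)) : (lkSet (g * a) (g * b) (g' * c) (g' * d)).Finite := by
  rw [lkSet_translate]; exact h.image _

theorem lkSet_finite_left {c d : FreeGroup (Fin N)}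
    (h : ∀ s, (lkSet 1 (letter s) c d).Finite) (u : FreeGroup (Fin N)) :
    (lkSet 1 u c d).Finite := by
  induction u using peel_induction with
  | one =>
    convert Set.finite_empty
    ext h
    exact iff_of_false (not_link_self _ _ _) id
  | mul l k _ ih =>
    refine (((h l).union ?_).union (Set.toFinite _)).subset (lkSet_subset _ _ _ _)
    have := lkSet_finite_translate ih (letter l) 1
    rwa [one_mul, one_mul] at this

theorem lkSet_finite (a b c d : FreeGroup (Fin N)) : (lkSet a b c d).Finite := by
  have h1 : ∀ u v : FreeGroup (Fin N), (lkSet 1 u 1 v).Finite := by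
    intro u v
    refine lkSet_finite_left (fun s => ?_) u
    rw [lkSet_swap]
    exact (lkSet_finite_left (fun t => lkSet_letter_finite t s) v).image _
  have := lkSet_finite_translate (h1 (a⁻¹ * b) (c⁻¹ * d)) a c
  simpa using this

/-- The number of translates of the path to `v` crossing the path to `u`, suitably normalised. -/
noncomputable def lk (u v : FreeGroup (Fin N)) : ℕ := (lkSet 1 u 1 v).ncard + 2

theorem ncard_lkSet (a b c d : FreeGroup (Fin N)) :
    (lkSet a b c d).ncard + 2 = lk (a⁻¹ * b) (c⁻¹ * d) := by
  have := lkSet_translate 1 (a⁻¹ * b) 1 (c⁻¹ * d) a c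
  rw [mul_one, mul_one, mul_inv_cancel_left, mul_inv_cancel_left] at this
  rw [this, Set.ncard_image_of_injective _ (fun x y h => by simpa using h), lk]

theorem lk_comm (u v : FreeGroup (Fin N)) : lk u v = lk v u := by
  rw [lk, lk, lkSet_swap, Set.ncard_image_of_injective _ inv_injective]

theorem lk_mul_left (u u' v : FreeGroup (Fin N)) : lk (u * u') v ≤ lk u v + lk u' v := by
  have h1 : (lkSet 1 (u * u') 1 v).ncard ≤ _ :=
    Set.ncard_le_ncard (lkSet_subset u u' 1 v)
      (((lkSet_finite _ _ _ _).union (lkSet_finite _ _ _ _)).union (Set.toFinite _))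
  have h2 := Set.ncard_union_le (lkSet 1 u 1 v ∪ lkSet (u * 1) (u * u') 1 v)
    {u * 1⁻¹, u * v⁻¹}
  have h3 := Set.ncard_union_le (lkSet 1 u 1 v) (lkSet (u * 1) (u * u') 1 v)
  have h4 : ({u * 1⁻¹, u * v⁻¹} : Set (FreeGroup (Fin N))).ncard ≤ 2 :=
    (Set.ncard_insert_le _ _).trans (by simp)
  have h5 := ncard_lkSet (u * 1) (u * u') 1 v
  rw [mul_one, inv_mul_cancel_left, inv_one, one_mul] at h5
  rw [mul_one] at h3
  rw [mul_one] at h1 h2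
  simp only [lk] at h5 ⊢
  omega

theorem lk_mul_right (u v v' : FreeGroup (Fin N)) : lk u (v * v') ≤ lk u v + lk u v' := by
  rw [lk_comm, lk_comm u v, lk_comm u v']; exact lk_mul_left _ _ _

theorem lk_pow_left (u v : FreeGroup (Fin N)) (m : ℕ) : lk (u ^ (m + 1)) v ≤ (m + 1) * lk u v := by
  induction m with
  | zero => simp
  | succ m ih =>
    rw [pow_succ]
    have := lk_mul_left (u ^ (m + 1)) u v
    nlinarith

theorem lk_pow_right (u v : FreeGroup (Fin N)) (m : ℕ) : lk u (v ^ (m + 1)) ≤ (m + 1) * lk u v := by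
  rw [lk_comm, lk_comm u v]; exact lk_pow_left _ _ _

/-- Quadratic growth of the linking number along powers. -/
theorem lk_conj_pow_le (u f v : FreeGroup (Fin N)) : ∃ B C : ℕ, ∀ m : ℕ,
    lk (u * f ^ (m + 1) * v) (u * f ^ (m + 1) * v) ≤
      (m + 1) * (m + 1) * lk f f + (m + 1) * B + C := by
  refine ⟨2 * lk f u + 2 * lk f v, lk u u + 2 * lk u v + lk v v, fun m => ?_⟩
  set p := f ^ (m + 1) with hp
  have a1 := fun z => lk_mul_left (u * p) v z
  have a2 := fun z => lk_mul_left u p z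
  have b1 := fun z => lk_mul_right z (u * p) v
  have b2 := fun z => lk_mul_right z u p
  have c1 : lk p u ≤ (m + 1) * lk f u := lk_pow_left _ _ _
  have c2 : lk p v ≤ (m + 1) * lk f v := lk_pow_left _ _ _
  have c3 : lk p p ≤ (m + 1) * ((m + 1) * lk f f) :=
    (lk_pow_left _ _ _).trans (Nat.mul_le_mul_left _ (lk_pow_right _ _ _))
  have d1 := lk_comm u p
  have d2 := lk_comm v p
  have d3 := lk_comm v u
  have e1 := a1 (u * p * v)
  have e2 := a2 (u * p * v)
  have e3 := b1 u
  have e4 := b2 u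
  have e5 := b1 p
  have e6 := b2 p
  have e7 := b1 v
  have e8 := b2 v
  nlinarith

/-- The exponent sum. -/
def es (k : FreeGroup (Fin N)) : ℤ :=
  Multiplicative.toAdd (FreeGroup.lift (fun _ => Multiplicative.ofAdd (1 : ℤ)) k)

@[simp] theorem es_one : es (1 : FreeGroup (Fin N)) = 0 := by simp [es]

@[simp] theorem es_mul (k l : FreeGroup (Fin N)) : es (k * l) = es k + es l := by simp [es]

@[simp] theorem es_inv (k : FreeGroup (Fin N)) : es k⁻¹ = - es k := by simp [es]

@[simp] theorem es_zpow (k : FreeGroup (Fin N)) (m : ℤ) : es (k ^ m) = m * es k := by simp [es]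

@[simp] theorem es_pow (k : FreeGroup (Fin N)) (m : ℕ) : es (k ^ m) = m * es k := by simp [es]

@[simp] theorem es_of (i : Fin N) : es (FreeGroup.of i) = 1 := by simp [es]

end Slope

namespace Slope

variable {N : ℕ}

theorem of_commute_iff {α : Type*} {x y : α}
    (h : FreeGroup.of x * FreeGroup.of y = FreeGroup.of y * FreeGroup.of x) : x = y := by
  classical
  have := congrArg FreeGroup.toWord h
  simp only [FreeGroup.toWord_mul, FreeGroup.toWord_of, List.singleton_append] at this
  rw [FreeGroup.IsReduced.reduce_eq, FreeGroup.IsReduced.reduce_eq] at this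
  · simpa using (List.cons.inj this).1
  · simp [FreeGroup.isReduced_cons_cons]
  · simp [FreeGroup.isReduced_cons_cons]

theorem exists_zpow_of_commute {a b : FreeGroup (Fin N)} (h : a * b = b * a) :
    ∃ z : FreeGroup (Fin N), ∃ m n : ℤ, a = z ^ m ∧ b = z ^ n := by
  set H := Subgroup.closure ({a, b} : Set (FreeGroup (Fin N)))
  have hcomm : ∀ x y : H, x * y = y * x := by
    have : IsMulCommutative H := Subgroup.isMulCommutative_closure (by
      rintro x (rfl | rfl) y (rfl | rfl) <;> simp [h])
    exact fun x y => mul_comm' x y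
  let e := IsFreeGroup.toFreeGroup H
  have hcomm' : ∀ x y : FreeGroup (IsFreeGroup.Generators H), x * y = y * x := by
    intro x y
    apply e.symm.injective
    rw [map_mul, map_mul, hcomm]
  have hsub : ∀ x y : IsFreeGroup.Generators H, x = y := fun x y => of_commute_iff (hcomm' _ _)
  have hcyc : ∃ z : FreeGroup (IsFreeGroup.Generators H), ∀ x, ∃ m : ℤ, x = z ^ m := by
    rcases isEmpty_or_nonempty (IsFreeGroup.Generators H) with hE | ⟨⟨g⟩⟩
    · exact ⟨1, fun x => ⟨0, Subsingleton.elim _ _⟩⟩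
    · have : Unique (IsFreeGroup.Generators H) := ⟨⟨g⟩, fun x => hsub x g⟩
      obtain ⟨z, hz⟩ := (inferInstance : IsCyclic (FreeGroup (IsFreeGroup.Generators H)))
      refine ⟨z, fun x => ?_⟩
      obtain ⟨m, hm⟩ := hz x
      exact ⟨m, hm.symm⟩
  obtain ⟨z, hz⟩ := hcyc
  obtain ⟨m, hm⟩ := hz (e ⟨a, Subgroup.subset_closure (by simp)⟩)
  obtain ⟨n, hn⟩ := hz (e ⟨b, Subgroup.subset_closure (by simp)⟩)
  refine ⟨(e.symm z : H), m, n, ?_, ?_⟩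
  · have := congrArg e.symm hm
    rw [MulEquiv.symm_apply_apply, map_zpow] at this
    exact congrArg Subtype.val this
  · have := congrArg e.symm hn
    rw [MulEquiv.symm_apply_apply, map_zpow] at this
    exact congrArg Subtype.val this

theorem eq_one_of_commute_of_es {c r : FreeGroup (Fin N)} (h : c * r = r * c) (hr : es r ≠ 0)
    (hc : es c = 0) : c = 1 := by
  obtain ⟨z, m, n, rfl, rfl⟩ := exists_zpow_of_commute h
  rw [es_zpow] at hr hc
  have hz : es z ≠ 0 := fun h0 => hr (by rw [h0, mul_zero])
  rw [(mul_eq_zero.1 hc).resolve_right hz, zpow_zero]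

theorem eq_of_commute_of_es {c r : FreeGroup (Fin N)} (h : c * r = r * c) (hr : es r = 1)
    (hc : es c = 1) : c = r := by
  have : c * r⁻¹ = 1 := by
    apply eq_one_of_commute_of_es (r := r) _ (by omega) (by simp [hc, hr])
    rw [inv_mul_cancel_right, ← mul_assoc, ← h, mul_inv_cancel_right]
  exact mul_inv_eq_one.1 this

theorem commute_of_zpow {a b : FreeGroup (Fin N)} {m : ℤ} (hm : m ≠ 0)
    (h : a ^ m * b = b * a ^ m) : a * b = b * a := by
  have : (b * a * b⁻¹) ^ m = a ^ m := by
    rw [conj_zpow, ← h, mul_inv_cancel_right]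
  have := zpow_left_injective hm this
  exact (mul_inv_eq_iff_eq_mul.1 this).symm

theorem zpow_injective_of_es {w : FreeGroup (Fin N)} (hw : es w = 1) :
    Function.Injective fun m : ℤ => w ^ m := by
  intro m n h
  have := congrArg es h
  simpa [hw] using this

/-- Powers of distinct elements of exponent sum `1` are independent. -/
theorem zpow_mul_zpow_injective {f w : FreeGroup (Fin N)} (hf : es f = 1) (hw : es w = 1)
    (hne : w ≠ f) : Function.Injective fun p : ℤ × ℤ => f ^ p.1 * w ^ p.2 := by
  rintro ⟨i, k⟩ ⟨i', k'⟩ h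
  dsimp only at h
  have h1 : f ^ (i - i') = w ^ (k' - k) := by
    rw [sub_eq_neg_add, sub_eq_add_neg, zpow_add, zpow_add, zpow_neg, zpow_neg,
      inv_mul_eq_iff_eq_mul, ← mul_assoc, eq_mul_inv_iff_mul_eq, h]
  have h2 : i - i' = k' - k := by
    have := congrArg es h1
    simpa [hf, hw] using this
  rw [← h2] at h1
  by_cases h0 : i - i' = 0
  · exact Prod.ext (by dsimp only; omega) (by dsimp only; omega)
  · exact absurd (zpow_left_injective h0 h1).symm hne

/-- The element whose axis is used. -/
def axisEl (i j : Fin N) : FreeGroup (Fin N) := FreeGroup.of i ^ 2 * (FreeGroup.of j)⁻¹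

@[simp] theorem es_axisEl (i j : Fin N) : es (axisEl i j) = 1 := by
  simp [axisEl]

theorem axisEl_inv_mul_eq (i j : Fin N) (k : FreeGroup (Fin N)) : (axisEl i j)⁻¹ * k =
    letter (j, true) * (letter (i, false) * (letter (i, false) * k)) := by
  rw [axisEl, letter_true, letter_false, sq]; simp only [mul_inv_rev, inv_inv, mul_assoc]

theorem notMem_D_of_mem {l l' : Fin N × Bool} {k : FreeGroup (Fin N)} (h : k ∈ D l) (hne : l ≠ l') :
    k ∉ D l' := fun h' => hne (eq_of_mem_D h h')

theorem exists_mem_D {k : FreeGroup (Fin N)} (hk : k ≠ 1) : ∃ l, k ∈ D l := by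
  obtain ⟨l, k', -, -, -, h⟩ := (exists_peel k).resolve_left hk
  exact ⟨l, h⟩

theorem mul_mem_D {u : FreeGroup (Fin N)} {l t : Fin N × Bool} (hl : u ∈ D l) (ht : u⁻¹ ∈ D t)
    {y : FreeGroup (Fin N)} (hy : y ∉ D t) : u * y ∈ D l := by
  induction u using peel_induction generalizing l t with
  | one => exact absurd hl (one_notMem_D _)
  | mul s k hk ih =>
    have hu : letter s * k ∈ D s := letter_mul_mem_D_iff.2 hk
    obtain rfl := eq_of_mem_D hl hu
    rw [mul_assoc, letter_mul_mem_D_iff]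
    by_cases hk1 : k = 1
    · subst hk1
      rw [mul_one, ← letter_bar] at ht
      rw [one_mul, eq_of_mem_D (letter_mem_D _) ht]
      exact hy
    · obtain ⟨s', hs'⟩ := exists_mem_D hk1
      obtain ⟨t', ht'⟩ := exists_mem_D (inv_ne_one.2 hk1)
      have hinv : (letter l * k)⁻¹ = k⁻¹ * letter (bar l) := by rw [mul_inv_rev, letter_bar]
      have : t' = t := by
        by_contra hne
        rw [hinv] at ht
        have := mul_letter_eq_one ht' (notMem_D_of_mem ht (Ne.symm hne))
        rw [this] at ht
        exact one_notMem_D _ ht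
      subst this
      exact notMem_D_of_mem (ih hs' ht' hy) (fun h => hk (h ▸ hs'))

theorem bar_true (i : Fin N) : bar (i, true) = (i, false) := rfl

theorem bar_false (i : Fin N) : bar (i, false) = (i, true) := rfl

variable {i j : Fin N}

theorem axisEl_inv_mul_mem (hij : i < j) {k : FreeGroup (Fin N)} (h : k ∉ D (i, true)) :
    (axisEl i j)⁻¹ * k ∈ D (j, true) := by
  rw [axisEl_inv_mul_eq, letter_mul_mem_D_iff, bar_true]
  refine notMem_D_of_mem (l := (i, false)) ?_ (by simp [hij.ne])
  rw [letter_mul_mem_D_iff, bar_false]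
  refine notMem_D_of_mem (l := (i, false)) ?_ (by simp)
  rw [letter_mul_mem_D_iff, bar_false]
  exact h

theorem axisEl_inv_mul_notMem (hij : i < j) {k : FreeGroup (Fin N)} (h : k ∉ D (i, true)) :
    (axisEl i j)⁻¹ * k ∉ D (i, true) :=
  notMem_D_of_mem (axisEl_inv_mul_mem hij h) (by simp [hij.ne'])

theorem axisEl_mul_mem (hij : i < j) {k : FreeGroup (Fin N)} (h : k ∉ D (j, true)) :
    axisEl i j * k ∈ D (i, true) := by
  by_contra hc
  have := axisEl_inv_mul_mem hij hc
  rw [inv_mul_cancel_left] at this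
  exact h this

/-- The levels of an element along the axis. -/
def levels (i j : Fin N) (ξ : FreeGroup (Fin N)) : Set ℤ :=
  {m | axisEl i j ^ (-m) * ξ ∈ D (i, true)}

theorem levels_succ (hij : i < j) {ξ : FreeGroup (Fin N)} {m : ℤ} (h : m + 1 ∈ levels i j ξ) :
    m ∈ levels i j ξ := by
  by_contra hc
  have := axisEl_inv_mul_notMem hij hc
  rw [← mul_assoc, ← zpow_neg_one, ← zpow_add] at this
  apply this
  have e : -1 + -m = -(m + 1) := by ring
  rw [e]
  exact h

theorem levels_lower (hij : i < j) {ξ : FreeGroup (Fin N)} {m m' : ℤ} (h : m ∈ levels i j ξ)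
    (hm : m' ≤ m) : m' ∈ levels i j ξ := by
  induction m', hm using Int.leInductionDown with
  | base => exact h
  | pred n _ ih => exact levels_succ hij (by rwa [sub_add_cancel])

theorem levels_one (hij : i < j) (m : ℤ) : m ∈ levels i j 1 ↔ m ≤ -1 := by
  constructor
  · intro h
    by_contra hm
    have : (0 : ℤ) ∈ levels i j 1 := levels_lower hij h (by omega)
    simp only [levels, Set.mem_ofPred_eq, neg_zero, zpow_zero, mul_one] at this
    exact one_notMem_D _ this
  · intro h
    refine levels_lower hij (m := -1) ?_ h
    simp only [levels, Set.mem_ofPred_eq, neg_neg, zpow_one]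
    exact axisEl_mul_mem hij (one_notMem_D _)

theorem levels_diff_finite (ξ η : FreeGroup (Fin N)) :
    {m | ¬ (m ∈ levels i j ξ ↔ m ∈ levels i j η)}.Finite := by
  have := (finite_separating (i, true) ξ η).preimage
    (f := fun m : ℤ => axisEl i j ^ (-m)) (fun m _ m' _ h => by
      have := zpow_injective_of_es (es_axisEl i j) h
      omega)
  exact this

theorem levels_nonempty (hij : i < j) (ξ : FreeGroup (Fin N)) : (levels i j ξ).Nonempty := by
  obtain ⟨m, hm, hm'⟩ := (Set.Iic_infinite (-1 : ℤ)).exists_notMem_finite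
    (levels_diff_finite (i := i) (j := j) ξ 1)
  rw [Set.mem_ofPred_eq, not_not] at hm'
  exact ⟨m, hm'.2 ((levels_one hij m).2 hm)⟩

theorem levels_bddAbove (hij : i < j) (ξ : FreeGroup (Fin N)) : BddAbove (levels i j ξ) := by
  obtain ⟨m, hm, hm'⟩ := (Set.Ici_infinite (0 : ℤ)).exists_notMem_finite
    (levels_diff_finite (i := i) (j := j) ξ 1)
  rw [Set.mem_ofPred_eq, not_not] at hm'
  refine ⟨m, fun m' h => ?_⟩
  by_contra hlt
  have h1 := (levels_one hij m).1 (hm'.1 (levels_lower hij h (by omega)))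
  have h2 : 0 ≤ m := hm
  omega

/-- The projection to the axis. -/
noncomputable def height (i j : Fin N) (ξ : FreeGroup (Fin N)) : ℤ := sSup (levels i j ξ)

theorem le_height_iff (hij : i < j) {ξ : FreeGroup (Fin N)} {m : ℤ} :
    m ≤ height i j ξ ↔ axisEl i j ^ (-m) * ξ ∈ D (i, true) :=
  ⟨fun h => levels_lower hij (Int.csSup_mem (levels_nonempty hij ξ) (levels_bddAbove hij ξ)) h,
    fun h => le_csSup (levels_bddAbove hij ξ) h⟩

theorem height_zpow_mul (hij : i < j) (m : ℤ) (ξ : FreeGroup (Fin N)) :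
    height i j (axisEl i j ^ m * ξ) = height i j ξ + m := by
  have key : ∀ n : ℤ, n ≤ height i j (axisEl i j ^ m * ξ) ↔ n ≤ height i j ξ + m := by
    intro n
    rw [le_height_iff hij, ← mul_assoc, ← zpow_add, ← sub_le_iff_le_add, le_height_iff hij]
    ring_nf
  exact le_antisymm ((key _).1 le_rfl) ((key _).2 le_rfl)

theorem mem_D_of_height (hij : i < j) {ξ : FreeGroup (Fin N)} (h : 0 ≤ height i j ξ) :
    ξ ∈ D (i, true) := by
  have := (le_height_iff hij).1 h
  simpa using this

theorem notMem_D_of_height (hij : i < j) {ξ : FreeGroup (Fin N)} (h : height i j ξ < 0) :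
    ξ ∉ D (i, true) := by
  intro hc
  have : (0 : ℤ) ≤ height i j ξ := (le_height_iff hij).2 (by simpa using hc)
  omega

theorem mem_D_of_height_le (hij : i < j) {ξ : FreeGroup (Fin N)} (h : height i j ξ ≤ -2) :
    ξ ∈ D (j, true) := by
  have h1 := height_zpow_mul hij 1 ξ
  rw [zpow_one] at h1
  have := axisEl_inv_mul_mem hij (notMem_D_of_height hij (ξ := axisEl i j * ξ) (by omega))
  rwa [inv_mul_cancel_left] at this

/-- Points of the axis at which the axis turns in the same way as at the identity. -/
theorem crossing (hij : i < j) {a b P Q : FreeGroup (Fin N)}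
    (hPa : height i j (P⁻¹ * a) ≤ -2) (hPb : 0 ≤ height i j (P⁻¹ * b))
    (hQa : height i j (Q⁻¹ * a) < 0) (hQb : 1 ≤ height i j (Q⁻¹ * b)) :
    P⁻¹ * a ∈ D (j, true) ∧ P⁻¹ * b ∈ D (i, true) ∧
    (FreeGroup.of i ^ 2)⁻¹ * (Q⁻¹ * a) ∈ D (i, false) ∧
    (FreeGroup.of i ^ 2)⁻¹ * (Q⁻¹ * b) ∈ D (j, false) := by
  refine ⟨mem_D_of_height_le hij hPa, mem_D_of_height hij hPb, ?_, ?_⟩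
  · have := notMem_D_of_height hij hQa
    rw [sq, mul_inv_rev, mul_assoc, ← letter_false, letter_mul_mem_D_iff, bar_false]
    refine notMem_D_of_mem (l := (i, false)) ?_ (by simp)
    rw [letter_mul_mem_D_iff, bar_false]
    exact this
  · have h1 := height_zpow_mul hij (-1) (Q⁻¹ * b)
    have h2 := mem_D_of_height hij (ξ := axisEl i j ^ (-1 : ℤ) * (Q⁻¹ * b)) (by omega)
    set y := axisEl i j ^ (-1 : ℤ) * (Q⁻¹ * b) with hy
    have h3 : Q⁻¹ * b = axisEl i j * y := by rw [hy]; simp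
    rw [h3, axisEl, mul_assoc, inv_mul_cancel_left, ← letter_false, letter_mul_mem_D_iff, bar_false]
    exact notMem_D_of_mem h2 (by simp [hij.ne])

theorem link_of_mem (hij : i < j) {a b c d : FreeGroup (Fin N)} (ha : a ∈ D (j, true))
    (hb : b ∈ D (i, true)) (hc : c ∈ D (i, false)) (hd : d ∈ D (j, false)) : Link a b c d := by
  have c1 : code (i, true) < code (i, false) := by simp [code]
  have c2 : code (i, false) < code (j, true) := by
    simp only [code]
    have : (i : ℕ) < j := hij
    simp
    omega
  have c3 : code (j, true) < code (j, false) := by simp [code]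
  have d1 := slope_lt_of_code_lt hb hc c1
  have d2 := slope_lt_of_code_lt hc ha c2
  have d3 := slope_lt_of_code_lt ha hd c3
  rw [link_iff]
  unfold RLink RCyc
  grind

theorem crossing_mem_lkSet (hij : i < j) {a b P Q : FreeGroup (Fin N)}
    (hPa : height i j (P⁻¹ * a) ≤ -2) (hPb : 0 ≤ height i j (P⁻¹ * b))
    (hQa : height i j (Q⁻¹ * a) < 0) (hQb : 1 ≤ height i j (Q⁻¹ * b)) :
    P * (FreeGroup.of i ^ 2)⁻¹ * Q⁻¹ ∈ lkSet a b a b := by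
  obtain ⟨h1, h2, h3, h4⟩ := crossing hij hPa hPb hQa hQb
  rw [mem_lkSet, ← link_mul P⁻¹]
  have := link_of_mem hij h1 h2 h3 h4
  convert this using 1 <;> group

/-- A crossing point is determined by the crossing translate. -/
theorem crossing_unique (hij : i < j) {a b P Q P' Q' : FreeGroup (Fin N)}
    (hPa : height i j (P⁻¹ * a) ≤ -2) (hPb : 0 ≤ height i j (P⁻¹ * b))
    (hQa : height i j (Q⁻¹ * a) < 0) (hQb : 1 ≤ height i j (Q⁻¹ * b))
    (hPa' : height i j (P'⁻¹ * a) ≤ -2) (hPb' : 0 ≤ height i j (P'⁻¹ * b))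
    (hQa' : height i j (Q'⁻¹ * a) < 0) (hQb' : 1 ≤ height i j (Q'⁻¹ * b))
    (h : P * (FreeGroup.of i ^ 2)⁻¹ * Q⁻¹ = P' * (FreeGroup.of i ^ 2)⁻¹ * Q'⁻¹) :
    P = P' ∧ Q = Q' := by
  obtain ⟨h1, h2, h3, h4⟩ := crossing hij hPa hPb hQa hQb
  obtain ⟨k1, k2, k3, k4⟩ := crossing hij hPa' hPb' hQa' hQb'
  have hP : P = P' := by
    by_contra hne
    have hu : P'⁻¹ * P ≠ 1 := fun hc => hne (inv_mul_eq_one.1 hc).symm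
    set u := P'⁻¹ * P with hu'
    have e : ∀ x, u * (P⁻¹ * x) = P'⁻¹ * x := fun x => by rw [hu']; group
    have e' : ∀ x, u * ((FreeGroup.of i ^ 2)⁻¹ * (Q⁻¹ * x)) =
        (FreeGroup.of i ^ 2)⁻¹ * (Q'⁻¹ * x) := by
      intro x
      have : (FreeGroup.of i ^ 2)⁻¹ * Q⁻¹ = P⁻¹ * (P' * (FreeGroup.of i ^ 2)⁻¹ * Q'⁻¹) := by
        rw [← h]; group
      rw [← mul_assoc _ Q⁻¹, this, hu']; group
    rw [← e] at k1 k2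
    rw [← e'] at k3 k4
    obtain ⟨l, hl⟩ := exists_mem_D hu
    obtain ⟨t, ht⟩ := exists_mem_D (inv_ne_one.2 hu)
    have key : ∀ {s y}, y ∈ D s → u * y ∈ D s → s = t ∨ s = l := by
      intro s y hy huy
      by_cases hs : s = t
      · exact Or.inl hs
      · exact Or.inr (eq_of_mem_D huy (mul_mem_D hl ht (notMem_D_of_mem hy hs)))
    have q1 := key h1 k1
    have q2 := key h2 k2
    have q3 := key h3 k3
    have q4 := key h4 k4
    have n := hij.ne
    grind
  subst hP
  rw [mul_assoc, mul_assoc, mul_left_cancel_iff, mul_left_cancel_iff, inv_inj] at h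
  exact ⟨rfl, h⟩

end Slope

namespace Slope

variable {N : ℕ}

theorem lkSet_self_swap (a b : FreeGroup (Fin N)) : lkSet b a b a = lkSet a b a b := by
  ext h
  exact ⟨link_swap, link_swap⟩

/-- A set of crossings is no larger than the set of linked translates. -/
theorem card_le_ncard_lkSet {κ : Type*} {i j : Fin N} (hij : i < j) {a b : FreeGroup (Fin N)}
    (s : Finset κ) (P Q : κ → FreeGroup (Fin N))
    (hPa : ∀ x ∈ s, height i j ((P x)⁻¹ * a) ≤ -2) (hPb : ∀ x ∈ s, 0 ≤ height i j ((P x)⁻¹ * b))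
    (hQa : ∀ x ∈ s, height i j ((Q x)⁻¹ * a) < 0) (hQb : ∀ x ∈ s, 1 ≤ height i j ((Q x)⁻¹ * b))
    (hinj : ∀ x ∈ s, ∀ y ∈ s, P x = P y → Q x = Q y → x = y) :
    s.card ≤ (lkSet a b a b).ncard := by
  rw [← Set.ncard_coe_finset]
  refine Set.ncard_le_ncard_of_injOn (fun x => P x * (FreeGroup.of i ^ 2)⁻¹ * (Q x)⁻¹)
    (fun x hx => crossing_mem_lkSet hij (hPa x hx) (hPb x hx) (hQa x hx) (hQb x hx)) ?_
    (lkSet_finite _ _ _ _)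
  intro x hx y hy h
  obtain ⟨h1, h2⟩ := crossing_unique hij (hPa x hx) (hPb x hx) (hQa x hx) (hQb x hx)
    (hPa y hy) (hPb y hy) (hQa y hy) (hQb y hy) h
  exact hinj x hx y hy h1 h2

section count

variable {i j : Fin N} (hij : i < j) {w : FreeGroup (Fin N)} (hw : es w = 1) (hne : w ≠ axisEl i j)

include hij

theorem height_zpow_inv_mul (m : ℤ) (u ξ : FreeGroup (Fin N)) :
    height i j ((u * axisEl i j ^ m)⁻¹ * ξ) = height i j (u⁻¹ * ξ) - m := by
  rw [mul_inv_rev, ← zpow_neg, mul_assoc, height_zpow_mul hij]; ring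

theorem height_sub_le (a b : FreeGroup (Fin N)) :
    |height i j a - height i j b| ≤ (lkSet a b a b).ncard + 1 := by
  have key : ∀ a b, height i j b - height i j a ≤ ((lkSet a b a b).ncard : ℤ) + 1 := by
    intro a b
    set p := height i j a with hp
    set q := height i j b with hq
    by_cases hpq : q ≤ p + 1
    · have : (0 : ℤ) ≤ (lkSet a b a b).ncard := by positivity
      linarith
    have h1 : ∀ m : ℤ, height i j ((axisEl i j ^ m)⁻¹ * a) = p - m := fun m => by
      have := height_zpow_inv_mul hij m 1 a
      rwa [one_mul, inv_one, one_mul] at this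
    have h2 : ∀ m : ℤ, height i j ((axisEl i j ^ m)⁻¹ * b) = q - m := fun m => by
      have := height_zpow_inv_mul hij m 1 b
      rwa [one_mul, inv_one, one_mul] at this
    have := card_le_ncard_lkSet hij (a := a) (b := b) (Finset.Icc (p + 2) q)
      (fun m => axisEl i j ^ m) (fun _ => axisEl i j ^ (p + 1)) ?_ ?_ ?_ ?_ ?_
    · rw [Int.card_Icc] at this
      omega
    all_goals intro m hm
    all_goals simp only [h1, h2]
    all_goals rw [Finset.mem_Icc] at hm
    all_goals try omega
    intro m' _ h _
    exact zpow_injective_of_es (es_axisEl i j) h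
  rw [abs_le]
  have h1 := key a b
  have h2 := key b a
  rw [lkSet_self_swap] at h2
  constructor <;> linarith

/-- An element with a long projection to the axis determines the axis. -/
theorem exists_axisEl_eq {a b : FreeGroup (Fin N)} (h : height i j a + 4 ≤ height i j b) :
    ∃ k ∈ lkSet a b a b, ∃ k' ∈ lkSet a b a b, axisEl i j = k * k'⁻¹ := by
  have h1 : ∀ m : ℤ, height i j ((axisEl i j ^ m)⁻¹ * a) = height i j a - m := fun m => by
    have := height_zpow_inv_mul hij m 1 a
    rwa [one_mul, inv_one, one_mul] at this
  have h2 : ∀ m : ℤ, height i j ((axisEl i j ^ m)⁻¹ * b) = height i j b - m := fun m => by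
    have := height_zpow_inv_mul hij m 1 b
    rwa [one_mul, inv_one, one_mul] at this
  set p := height i j a
  set q := height i j b
  refine ⟨_, crossing_mem_lkSet hij (P := axisEl i j ^ (p + 3)) (Q := axisEl i j ^ (p + 1))
    ?_ ?_ ?_ ?_, _, crossing_mem_lkSet hij (P := axisEl i j ^ (p + 2)) (Q := axisEl i j ^ (p + 1))
    ?_ ?_ ?_ ?_, ?_⟩
  all_goals first | rw [h1] | rw [h2] | skip
  all_goals try omega
  group

include hw hne

theorem eventually_height_eq (ω ω' : FreeGroup (Fin N)) :
    ∃ k₀ : ℕ, ∀ k : ℤ, k₀ ≤ k.natAbs → height i j (w ^ k * ω) = height i j (w ^ k * ω') := by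
  have hfin := (finite_separating (i, true) ω ω').preimage
    (f := fun p : ℤ × ℤ => axisEl i j ^ p.1 * w ^ p.2)
    ((zpow_mul_zpow_injective (es_axisEl i j) hw hne).injOn)
  obtain ⟨B, hB⟩ := (hfin.image fun p => p.2.natAbs).bddAbove
  refine ⟨B + 1, fun k hk => ?_⟩
  have key : ∀ m : ℤ, m ≤ height i j (w ^ k * ω) ↔ m ≤ height i j (w ^ k * ω') := by
    intro m
    rw [le_height_iff hij, le_height_iff hij, ← mul_assoc, ← mul_assoc]
    by_contra hc
    have := hB ⟨(-m, k), hc, rfl⟩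
    dsimp only at this
    omega
  exact le_antisymm ((key _).1 le_rfl) ((key _).2 le_rfl)

theorem exists_limits : ∃ a b : ℤ, ∀ ω, ∃ k₀ : ℕ, ∀ k : ℕ, k₀ ≤ k →
    height i j (w ^ (k : ℤ) * ω) = a ∧ height i j (w ^ (-(k : ℤ)) * ω) = b := by
  obtain ⟨k₀, hk₀⟩ := eventually_height_eq hij hw hne 1 w
  refine ⟨height i j (w ^ (k₀ : ℤ)), height i j (w ^ (-(k₀ : ℤ))), fun ω => ?_⟩
  obtain ⟨k₁, hk₁⟩ := eventually_height_eq hij hw hne ω 1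
  have h1 : ∀ n : ℕ, height i j (w ^ ((k₀ + n : ℕ) : ℤ)) = height i j (w ^ (k₀ : ℤ)) ∧
      height i j (w ^ (-((k₀ + n : ℕ) : ℤ))) = height i j (w ^ (-(k₀ : ℤ))) := by
    intro n
    induction n with
    | zero => simp
    | succ n ih =>
      have e1 := hk₀ ((k₀ + n : ℕ) : ℤ) (by omega)
      have e2 := hk₀ (-((k₀ + (n + 1) : ℕ) : ℤ)) (by omega)
      rw [mul_one, ← zpow_add_one] at e1 e2
      rw [show -((k₀ + (n + 1) : ℕ) : ℤ) + 1 = -((k₀ + n : ℕ) : ℤ) by push_cast; ring] at e2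
      rw [show ((k₀ + n : ℕ) : ℤ) + 1 = ((k₀ + (n + 1) : ℕ) : ℤ) by push_cast; ring] at e1
      exact ⟨e1.symm.trans ih.1, e2.trans ih.2⟩
  refine ⟨k₀ + k₁, fun k hk => ?_⟩
  rw [hk₁ k (by omega), hk₁ (-k) (by omega), mul_one, mul_one]
  have := h1 (k - k₀)
  rwa [show k₀ + (k - k₀) = k by omega] at this

theorem sq_mul_le_ncard_lkSet {a b : FreeGroup (Fin N)} {p q : ℤ} (n : ℕ)
    (ha : ∀ s : ℤ, s.natAbs ≤ n → height i j (w ^ s * a) = p)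
    (hb : ∀ s : ℤ, s.natAbs ≤ n → height i j (w ^ s * b) = q) (hpq : p ≤ q) :
    (2 * n + 1) ^ 2 * (q - p - 1) ≤ ((lkSet a b a b).ncard : ℤ) := by
  rcases hpq.eq_or_lt with rfl | hpq
  · have : (0 : ℤ) ≤ (lkSet a b a b).ncard := by positivity
    nlinarith [sq_nonneg (2 * (n : ℤ) + 1)]
  have h1 : ∀ s m : ℤ, s.natAbs ≤ n → height i j ((w ^ s * axisEl i j ^ m)⁻¹ * a) = p - m := by
    intro s m hs
    rw [height_zpow_inv_mul hij, ← zpow_neg, ha _ (by omega)]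
  have h2 : ∀ s m : ℤ, s.natAbs ≤ n → height i j ((w ^ s * axisEl i j ^ m)⁻¹ * b) = q - m := by
    intro s m hs
    rw [height_zpow_inv_mul hij, ← zpow_neg, hb _ (by omega)]
  have hI : ∀ s : ℤ, s ∈ Finset.Icc (-(n : ℤ)) n → s.natAbs ≤ n := by
    intro s hs
    rw [Finset.mem_Icc] at hs
    omega
  have hinj : ∀ s m s' m' : ℤ, w ^ s * axisEl i j ^ m = w ^ s' * axisEl i j ^ m' →
      s = s' ∧ m = m' := by
    intro s m s' m' h
    have := zpow_mul_zpow_injective hw (es_axisEl i j) (Ne.symm hne)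
      (a₁ := (s, m)) (a₂ := (s', m')) h
    simpa using this
  have := card_le_ncard_lkSet hij (a := a) (b := b)
    ((Finset.Icc (-(n : ℤ)) n ×ˢ Finset.Icc (-(n : ℤ)) n) ×ˢ Finset.Icc (p + 2) q)
    (fun x => w ^ x.1.1 * axisEl i j ^ x.2) (fun x => w ^ x.1.2 * axisEl i j ^ (p + 1))
    ?_ ?_ ?_ ?_ ?_
  · simp only [Finset.card_product, Int.card_Icc] at this
    zify at this
    rw [Int.toNat_of_nonneg (by omega), Int.toNat_of_nonneg (by omega)] at this
    calc _ = _ := by ring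
      _ ≤ _ := this
  all_goals
    rintro ⟨⟨s, t⟩, m⟩ hx
    simp only [Finset.mem_product] at hx
    obtain ⟨⟨hs, ht⟩, hm⟩ := hx
    have hs := hI _ hs
    have ht := hI _ ht
    rw [Finset.mem_Icc] at hm
  · rw [h1 _ _ hs]; dsimp only at *; omega
  · rw [h2 _ _ hs]; dsimp only at *; omega
  · rw [h1 _ _ ht]; omega
  · rw [h2 _ _ ht]; omega
  · rintro ⟨⟨s', t'⟩, m'⟩ _ e1 e2
    obtain ⟨rfl, rfl⟩ := hinj _ _ _ _ e1
    obtain ⟨rfl, -⟩ := hinj _ _ _ _ e2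
    rfl

theorem abs_limits_sub_le {L : ℕ} (hL : ∃ B C : ℕ, ∀ m : ℕ,
      lk (w ^ (m + 1)) (w ^ (m + 1)) ≤ (m + 1) * (m + 1) * L + (m + 1) * B + C) {a b : ℤ}
    (h : ∃ k₀ : ℕ, ∀ k : ℕ, k₀ ≤ k →
      height i j (w ^ (k : ℤ)) = a ∧ height i j (w ^ (-(k : ℤ))) = b) : |a - b| ≤ L + 1 := by
  obtain ⟨k₀, hk₀⟩ := h
  obtain ⟨B, C, hBC⟩ := hL
  have key : ∀ n : ℕ, 1 ≤ n → (2 * n + 1) ^ 2 * (|a - b| - 1) ≤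
      ((2 * (k₀ + n)) ^ 2 * L + (2 * (k₀ + n)) * B + C : ℤ) := by
    intro n hn
    set k := k₀ + n with hk
    have h1 : ∀ s : ℤ, s.natAbs ≤ n → height i j (w ^ s * w ^ (k : ℤ)) = a := by
      intro s hs
      rw [← zpow_add, show s + k = ((s + k).toNat : ℤ) by omega]
      exact (hk₀ _ (by omega)).1
    have h2 : ∀ s : ℤ, s.natAbs ≤ n → height i j (w ^ s * w ^ (-(k : ℤ))) = b := by
      intro s hs
      rw [← zpow_add, show s + -k = -((k - s).toNat : ℤ) by omega]
      exact (hk₀ _ (by omega)).2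
    have h3 : ((lkSet (w ^ (-(k : ℤ))) (w ^ (k : ℤ)) (w ^ (-(k : ℤ))) (w ^ (k : ℤ))).ncard : ℤ) ≤
        ((2 * k) ^ 2 * L + (2 * k) * B + C : ℤ) := by
      have e1 := ncard_lkSet (w ^ (-(k : ℤ))) (w ^ (k : ℤ)) (w ^ (-(k : ℤ))) (w ^ (k : ℤ))
      rw [← zpow_neg, neg_neg, ← zpow_add, ← two_mul] at e1
      have e2 := hBC (2 * k - 1)
      rw [show 2 * k - 1 + 1 = 2 * k by omega] at e2
      have e3 : w ^ (2 * (k : ℤ)) = w ^ (2 * k) := by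
        rw [← zpow_natCast]; push_cast; rfl
      rw [e3] at e1
      rw [← e1] at e2
      zify at e2
      nlinarith
    push_cast [hk] at h3
    rcases le_total a b with hab | hab
    · have := sq_mul_le_ncard_lkSet hij hw hne n h1 h2 hab
      rw [show |a - b| = b - a by rw [abs_sub_comm, abs_of_nonneg (by omega)]]
      rw [lkSet_self_swap] at this
      push_cast [hk] at this h3
      linarith
    · have := sq_mul_le_ncard_lkSet hij hw hne n h2 h1 hab
      rw [abs_of_nonneg (by omega)]
      push_cast [hk] at this h3
      linarith
  by_contra hc
  push Not at hc
  have h1 : (L : ℤ) + 1 ≤ |a - b| - 1 := by omega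
  set n : ℕ := 8 * k₀ * L + 2 * B + 4 * k₀ ^ 2 * L + 2 * k₀ * B + C + 1 with hn
  have h2 := key n (by omega)
  have h3 : (2 * (n : ℤ) + 1) ^ 2 * (L + 1) ≤ (2 * n + 1) ^ 2 * (|a - b| - 1) :=
    mul_le_mul_of_nonneg_left h1 (sq_nonneg _)
  have h4 := h3.trans h2
  have h5 : (n : ℤ) = 8 * k₀ * L + 2 * B + 4 * k₀ ^ 2 * L + 2 * k₀ * B + C + 1 := by
    rw [hn]; push_cast; ring
  have p1 : (0 : ℤ) ≤ L := by positivity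
  have p2 : (1 : ℤ) ≤ n := by omega
  have h6 : (8 * k₀ * L + 2 * B : ℤ) * n + (4 * k₀ ^ 2 * L + 2 * k₀ * B + C) ≤ n * n := by
    have e : (0 : ℤ) ≤ 4 * k₀ ^ 2 * L + 2 * k₀ * B + C := by positivity
    calc _ ≤ (8 * k₀ * L + 2 * B : ℤ) * n + (4 * k₀ ^ 2 * L + 2 * k₀ * B + C) * n := by
          nlinarith
      _ = (n - 1) * n := by rw [h5]; ring
      _ ≤ n * n := by nlinarith
  nlinarith

end count

/-- A set whose translates are pairwise nested. -/
def Nested (H : Set (FreeGroup (Fin N))) : Prop :=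
  ∀ h, (∀ x ∈ H, h * x ∈ H) ∨ (∀ x ∈ H, h⁻¹ * x ∈ H) ∨ (∀ x ∈ H, h * x ∉ H) ∨
    (∀ x ∉ H, h * x ∈ H)

theorem nested_D (l : Fin N × Bool) : Nested (D l) := by
  intro h
  by_cases h1 : h = 1
  · subst h1
    exact Or.inl fun x hx => by rwa [one_mul]
  obtain ⟨s, hs⟩ := exists_mem_D h1
  obtain ⟨t, ht⟩ := exists_mem_D (inv_ne_one.2 h1)
  by_cases htl : t = l
  · subst htl
    by_cases hst : s = t
    · subst hst
      exact Or.inr (Or.inr (Or.inr fun x hx => mul_mem_D hs ht hx))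
    · refine Or.inr (Or.inl fun x hx => ?_)
      exact mul_mem_D ht (by rwa [inv_inv]) (notMem_D_of_mem hx (Ne.symm hst))
  · by_cases hsl : s = l
    · subst hsl
      exact Or.inl fun x hx => mul_mem_D hs ht (notMem_D_of_mem hx (Ne.symm htl))
    · exact Or.inr (Or.inr (Or.inl fun x hx =>
        notMem_D_of_mem (mul_mem_D hs ht (notMem_D_of_mem hx (Ne.symm htl))) hsl))

theorem Nested.compl {H : Set (FreeGroup (Fin N))} (hH : Nested H) : Nested Hᶜ := by
  intro h
  rcases hH h with h1 | h1 | h1 | h1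
  · refine Or.inr (Or.inl fun x hx hc => hx ?_)
    have := h1 _ hc
    rwa [mul_inv_cancel_left] at this
  · refine Or.inl fun x hx hc => hx ?_
    have := h1 _ hc
    rwa [inv_mul_cancel_left] at this
  · exact Or.inr (Or.inr (Or.inr fun x hx => h1 x (not_not.1 hx)))
  · exact Or.inr (Or.inr (Or.inl fun x hx hc => hc (h1 x hx)))

theorem Nested.translate {H : Set (FreeGroup (Fin N))} (hH : Nested H) (g : FreeGroup (Fin N)) :
    Nested {x | g * x ∈ H} := by
  intro h
  have e : ∀ x, g * (h * x) = g * h * g⁻¹ * (g * x) := fun x => by group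
  have e' : ∀ x, g * (h⁻¹ * x) = (g * h * g⁻¹)⁻¹ * (g * x) := fun x => by group
  simp only [Set.mem_ofPred_eq, e, e']
  rcases hH (g * h * g⁻¹) with h1 | h1 | h1 | h1
  · exact Or.inl fun x hx => h1 _ hx
  · exact Or.inr (Or.inl fun x hx => h1 _ hx)
  · exact Or.inr (Or.inr (Or.inl fun x hx => h1 _ hx))
  · exact Or.inr (Or.inr (Or.inr fun x hx => h1 _ hx))

theorem Nested.disjoint {H : Set (FreeGroup (Fin N))} (hH : Nested H) (hne : H.Nonempty)
    {w : FreeGroup (Fin N)}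
    (hw : ∀ ω, ∃ k₀ : ℕ, ∀ k : ℕ, k₀ ≤ k → w ^ (k : ℤ) * ω ∉ H ∧ w ^ (-(k : ℤ)) * ω ∉ H)
    {n : ℕ} (hn : n ≠ 0) : ∀ x ∈ H, w ^ n * x ∉ H := by
  rcases hH (w ^ n) with h1 | h1 | h1 | h1
  · obtain ⟨ω, hω⟩ := hne
    obtain ⟨k₀, hk₀⟩ := hw ω
    have : ∀ m : ℕ, (w ^ n) ^ m * ω ∈ H := by
      intro m
      induction m with
      | zero => simpa using hω
      | succ m ih => rw [pow_succ', mul_assoc]; exact h1 _ ih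
    refine absurd (this k₀) ?_
    have := (hk₀ (n * k₀) (Nat.le_mul_of_pos_left _ (by omega))).1
    rwa [zpow_natCast, pow_mul] at this
  · obtain ⟨ω, hω⟩ := hne
    obtain ⟨k₀, hk₀⟩ := hw ω
    have : ∀ m : ℕ, ((w ^ n) ^ m)⁻¹ * ω ∈ H := by
      intro m
      induction m with
      | zero => simpa using hω
      | succ m ih => rw [pow_succ, mul_inv_rev, mul_assoc]; exact h1 _ ih
    refine absurd (this k₀) ?_
    have := (hk₀ (n * k₀) (Nat.le_mul_of_pos_left _ (by omega))).2
    rwa [zpow_neg, zpow_natCast, pow_mul] at this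
  · exact h1
  · obtain ⟨k₀, hk₀⟩ := hw 1
    have := h1 _ (hk₀ k₀ le_rfl).1
    have h2 := (hk₀ (n + k₀) (by omega)).1
    rw [← mul_assoc, ← zpow_natCast w n, ← zpow_add] at this
    push_cast at h2
    exact absurd this h2

theorem Conv.translate {V : Set (FreeGroup (Fin N))} (h : Conv V) (g : FreeGroup (Fin N)) :
    Conv {x | g * x ∈ V} := by
  intro a ha b hb c hc d hd hl
  exact h _ ha _ hb _ hc _ hd ((link_mul g _ _ _ _).2 hl)

theorem setOf_le_height {i j : Fin N} (hij : i < j) (m : ℤ) :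
    {ξ | m ≤ height i j ξ} = {ξ | axisEl i j ^ (-m) * ξ ∈ D (i, true)} := by
  ext ξ
  exact le_height_iff hij

theorem conv_height {i j : Fin N} (hij : i < j) (m : ℤ) : Conv {ξ | m ≤ height i j ξ} := by
  rw [setOf_le_height hij]
  exact (conv_D _).translate _

theorem nested_height {i j : Fin N} (hij : i < j) (m : ℤ) : Nested {ξ | m ≤ height i j ξ} := by
  rw [setOf_le_height hij]
  exact (nested_D _).translate _

theorem exists_height_eq {i j : Fin N} (hij : i < j) (m : ℤ) : ∃ ξ, height i j ξ = m :=
  ⟨axisEl i j ^ (m - height i j 1) * 1, by rw [height_zpow_mul hij]; ring⟩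

theorem height_axisEl_pow {i j : Fin N} (hij : i < j) (m : ℤ) :
    height i j (axisEl i j ^ m) = m - 1 := by
  have h1 : height i j (1 : FreeGroup (Fin N)) = -1 :=
    le_antisymm ((levels_one hij _).1 ((le_height_iff hij).1 le_rfl))
      ((le_height_iff hij).2 ((levels_one hij _).2 le_rfl))
  have := height_zpow_mul hij m 1
  rw [mul_one, h1] at this
  rw [this]; ring

end Slope

namespace Slope

variable {N : ℕ}

/-- A group acting on a free group, containing its left translations as a normal subgroup, and
preserving the cyclic order. -/
structure PointPush (N : ℕ) (G : Type) [Group G] [MulAction G (FreeGroup (Fin N))] where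
  ι : FreeGroup (Fin N) →* G
  ι_smul : ∀ k u : FreeGroup (Fin N), ι k • u = k * u
  conj : ∀ g w, ∃ w', es w' = es w ∧ g * ι w * g⁻¹ = ι w'
  cyc : ∀ (g : G) (a b c : FreeGroup (Fin N)), Cyc (g • a) (g • b) (g • c) ↔ Cyc a b c

namespace PointPush

variable {G : Type} [Group G] [MulAction G (FreeGroup (Fin N))] (A : PointPush N G)

theorem ι_injective : Function.Injective A.ι := by
  intro a b h
  have := congrArg (fun g : G => g • (1 : FreeGroup (Fin N))) h
  simpa [A.ι_smul] using this

/-- The action by conjugation on the translations. -/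
noncomputable def α (g : G) (w : FreeGroup (Fin N)) : FreeGroup (Fin N) := (A.conj g w).choose

theorem es_α (g : G) (w : FreeGroup (Fin N)) : es (A.α g w) = es w := (A.conj g w).choose_spec.1

theorem ι_α (g : G) (w : FreeGroup (Fin N)) : A.ι (A.α g w) = g * A.ι w * g⁻¹ :=
  (A.conj g w).choose_spec.2.symm

theorem α_mul (g : G) (w w' : FreeGroup (Fin N)) : A.α g (w * w') = A.α g w * A.α g w' := by
  apply A.ι_injective
  rw [map_mul, A.ι_α, A.ι_α, A.ι_α, map_mul]; group

theorem α_zpow (g : G) (w : FreeGroup (Fin N)) (m : ℤ) : A.α g (w ^ m) = A.α g w ^ m := by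
  apply A.ι_injective
  rw [map_zpow, A.ι_α, A.ι_α, map_zpow, conj_zpow]

theorem α_inv_α (g : G) (w : FreeGroup (Fin N)) : A.α g⁻¹ (A.α g w) = w := by
  apply A.ι_injective
  rw [A.ι_α, A.ι_α]; group

theorem α_α_inv (g : G) (w : FreeGroup (Fin N)) : A.α g (A.α g⁻¹ w) = w := by
  apply A.ι_injective
  rw [A.ι_α, A.ι_α]; group

theorem smul_mul (g : G) (k u : FreeGroup (Fin N)) : g • (k * u) = A.α g k * g • u := by
  rw [← A.ι_smul, ← A.ι_smul, A.ι_α, smul_smul, smul_smul]; group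

include A in
theorem smul_link (g : G) (a b c d : FreeGroup (Fin N)) :
    Link (g • a) (g • b) (g • c) (g • d) ↔ Link a b c d := by
  unfold Link; simp only [A.cyc]

theorem α_mem_lkSet {g : G} {a b c d h : FreeGroup (Fin N)} :
    A.α g h ∈ lkSet (g • a) (g • b) (g • c) (g • d) ↔ h ∈ lkSet a b c d := by
  rw [mem_lkSet, ← A.smul_mul, ← A.smul_mul, A.smul_link, mem_lkSet]

include A in
theorem ncard_lkSet_smul (g : G) (a b c d : FreeGroup (Fin N)) :
    (lkSet (g • a) (g • b) (g • c) (g • d)).ncard = (lkSet a b c d).ncard := by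
  have : lkSet (g • a) (g • b) (g • c) (g • d) = A.α g '' lkSet a b c d := by
    ext h
    constructor
    · intro hh
      refine ⟨A.α g⁻¹ h, ?_, A.α_α_inv g h⟩
      rwa [← A.α_mem_lkSet (g := g), A.α_α_inv]
    · rintro ⟨h, hh, rfl⟩
      exact A.α_mem_lkSet.2 hh
  rw [this, Set.ncard_image_of_injective]
  intro x y h
  rw [← A.α_inv_α g x, h, A.α_inv_α]

include A in
theorem conv_smul {V : Set (FreeGroup (Fin N))} (hV : Conv V) (g : G) : Conv {x | g • x ∈ V} := by
  intro a ha b hb c hc d hd hl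
  exact hV _ ha _ hb _ hc _ hd ((A.smul_link g _ _ _ _).2 hl)

section axis

variable {i j : Fin N} (hij : i < j)

include A hij

theorem abs_height_smul_sub_le (g : G) (a b : FreeGroup (Fin N)) :
    |height i j (g • a) - height i j (g • b)| ≤ (lkSet a b a b).ncard + 1 := by
  rw [← A.ncard_lkSet_smul g]
  exact height_sub_le hij _ _

theorem finite_far (a b : FreeGroup (Fin N)) :
    {r | ∃ g : G, g * A.ι (axisEl i j) * g⁻¹ = r ∧
      4 ≤ |height i j (g⁻¹ • a) - height i j (g⁻¹ • b)|}.Finite := by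
  have key : ∀ a b : FreeGroup (Fin N), {r | ∃ g : G, g * A.ι (axisEl i j) * g⁻¹ = r ∧
      height i j (g⁻¹ • a) + 4 ≤ height i j (g⁻¹ • b)}.Finite := by
    intro a b
    refine (((lkSet_finite a b a b).prod (lkSet_finite a b a b)).image
      (fun p => A.ι (p.1 * p.2⁻¹))).subset ?_
    rintro r ⟨g, rfl, h⟩
    obtain ⟨k, hk, k', hk', e⟩ := exists_axisEl_eq hij h
    refine ⟨(A.α g k, A.α g k'), ⟨?_, ?_⟩, ?_⟩
    · rw [← A.α_mem_lkSet (g := g), smul_inv_smul, smul_inv_smul] at hk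
      exact hk
    · rw [← A.α_mem_lkSet (g := g), smul_inv_smul, smul_inv_smul] at hk'
      exact hk'
    · dsimp only
      rw [e, map_mul, map_inv, A.ι_α, A.ι_α, map_mul, map_inv]
      group
  refine ((key a b).union (key b a)).subset ?_
  rintro r ⟨g, hr, h⟩
  rcases le_abs.1 h with h | h
  · exact Or.inr ⟨g, hr, by linarith⟩
  · exact Or.inl ⟨g, hr, by linarith⟩

theorem exists_commute_bound : ∃ C : ℕ, ∀ g : G,
    g * A.ι (axisEl i j) = A.ι (axisEl i j) * g → ∀ ξ η : FreeGroup (Fin N),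
    |(height i j (g • ξ) - height i j (g • η)) - (height i j ξ - height i j η)| ≤ C := by
  set y := letter (i, false)
  set C₀ := (lkSet 1 y 1 y).ncard + 1 with hC₀
  refine ⟨2 * (C₀ + 3), fun g hg ξ η => ?_⟩
  have hα : A.α g (axisEl i j) = axisEl i j := by
    apply A.ι_injective
    rw [A.ι_α, hg, mul_inv_cancel_right]
  have hα' : ∀ (m : ℤ) (ξ : FreeGroup (Fin N)),
      g • (axisEl i j ^ m * ξ) = axisEl i j ^ m * g • ξ := by
    intro m ξ
    rw [A.smul_mul, A.α_zpow, hα]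
  have h1 := A.abs_height_smul_sub_le hij g 1 y
  rw [abs_le] at h1
  have hlink : ∀ a ∈ D (i, true), ∀ b ∈ D (j, true), Link a b 1 y := by
    intro a ha b hb
    have hy : y ∈ D (i, false) := letter_mem_D _
    have n1 : a ≠ 1 := fun h => one_notMem_D _ (h ▸ ha)
    have d0 := slope_one_lt_of_ne n1
    have d1 := slope_lt_of_code_lt ha hy (by simp [code])
    have d2 := slope_lt_of_code_lt hy hb (by
      simp only [code]
      have : (i : ℕ) < j := hij
      simp
      omega)
    rw [link_iff]
    unfold RLink RCyc
    grind
  have key : ∀ ξ : FreeGroup (Fin N), height i j ξ = 0 →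
      |height i j (g • ξ) - height i j (g • (1 : FreeGroup (Fin N)))| ≤ C₀ + 2 := by
    intro ξ hξ
    have hξ' : height i j (axisEl i j ^ (-2 : ℤ) * ξ) = -2 := by
      rw [height_zpow_mul hij, hξ]; rfl
    have hl := hlink ξ (mem_D_of_height hij hξ.ge) _ (mem_D_of_height_le hij hξ'.le)
    have hgξ' : height i j (g • (axisEl i j ^ (-2 : ℤ) * ξ)) = height i j (g • ξ) - 2 := by
      rw [hα', height_zpow_mul hij]; ring
    have hconv : ∀ m, Conv {x : FreeGroup (Fin N) | m ≤ height i j (g • x)} := fun m =>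
      A.conv_smul (conv_height hij m) g
    rw [abs_le]
    constructor
    · by_contra hc
      push Not at hc
      refine (hconv (min (height i j (g • (1 : FreeGroup (Fin N)))) (height i j (g • y)))).compl
        _ ?_ _ ?_ _ ?_ _ ?_ hl
      · simp only [Set.mem_compl_iff, Set.mem_ofPred_eq]; omega
      · simp only [Set.mem_compl_iff, Set.mem_ofPred_eq]; omega
      · simp only [Set.mem_compl_iff, Set.mem_ofPred_eq]; omega
      · simp only [Set.mem_compl_iff, Set.mem_ofPred_eq]; omega
    · by_contra hc
      push Not at hc
      refine hconv (max (height i j (g • (1 : FreeGroup (Fin N)))) (height i j (g • y)) + 1)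
        _ ?_ _ ?_ _ ?_ _ ?_ hl
      · simp only [Set.mem_ofPred_eq]; omega
      · simp only [Set.mem_ofPred_eq]; omega
      · simp only [Set.mem_ofPred_eq]; omega
      · simp only [Set.mem_ofPred_eq]; omega
  have key' : ∀ ξ : FreeGroup (Fin N), |height i j (g • ξ) - height i j ξ -
      height i j (g • (1 : FreeGroup (Fin N)))| ≤ C₀ + 2 := by
    intro ξ
    have h := key (axisEl i j ^ (-height i j ξ) * ξ) (by rw [height_zpow_mul hij]; ring)
    rw [hα', height_zpow_mul hij] at h
    convert h using 2
    ring
  have h2 := key' ξ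
  have h3 := key' η
  rw [abs_le] at h2 h3 ⊢
  push_cast at *
  constructor <;> linarith

theorem exists_axis_limits (g : G) (hne : A.α g (axisEl i j) ≠ axisEl i j) : ∃ a b : ℤ,
    |a - b| ≤ lk (axisEl i j) (axisEl i j) + 1 ∧ ∀ ω, ∃ k₀ : ℕ, ∀ k : ℕ, k₀ ≤ k →
      height i j (A.α g (axisEl i j) ^ (k : ℤ) * ω) = a ∧
      height i j (A.α g (axisEl i j) ^ (-(k : ℤ)) * ω) = b := by
  set w := A.α g (axisEl i j) with hw
  have hes : es w = 1 := by rw [hw, A.es_α, es_axisEl]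
  obtain ⟨a, b, h⟩ := exists_limits hij hes hne
  refine ⟨a, b, abs_limits_sub_le hij hes hne (L := lk (axisEl i j) (axisEl i j)) ?_ ?_, h⟩
  · set ω := g⁻¹ • (1 : FreeGroup (Fin N)) with hω
    obtain ⟨B, C, hBC⟩ := lk_conj_pow_le ω⁻¹ (axisEl i j) ω
    refine ⟨B, C, fun m => (le_of_eq ?_).trans (hBC m)⟩
    have e : g⁻¹ • w ^ (m + 1) = axisEl i j ^ (m + 1) * ω := by
      have : w ^ (m + 1) = w ^ ((m + 1 : ℕ) : ℤ) * 1 := by rw [zpow_natCast, mul_one]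
      rw [this, A.smul_mul, A.α_zpow, hw, A.α_inv_α, zpow_natCast]
    have h1 := A.ncard_lkSet_smul g⁻¹ 1 (w ^ (m + 1)) 1 (w ^ (m + 1))
    rw [e, ← hω] at h1
    have h2 := ncard_lkSet ω (axisEl i j ^ (m + 1) * ω) ω (axisEl i j ^ (m + 1) * ω)
    rw [h1, ← mul_assoc] at h2
    rw [← h2, lk]
  · obtain ⟨k₀, hk₀⟩ := h 1
    refine ⟨k₀, fun k hk => ?_⟩
    have := hk₀ k hk
    rwa [mul_one, mul_one] at this

theorem exists_partition (g : G) (hne : A.α g (axisEl i j) ≠ axisEl i j) :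
    ∃ Y : Set (FreeGroup (Fin N)),
      (∀ ξ ∉ Y, ∀ η ∉ Y, |height i j ξ - height i j η| ≤ lk (axisEl i j) (axisEl i j) + 5) ∧
      ∀ ξ ∈ Y, ∀ η ∈ Y, |height i j (g⁻¹ • ξ) - height i j (g⁻¹ • η)| ≤
        lk (axisEl i j) (axisEl i j) + 5 := by
  obtain ⟨a, b, hab, hlim⟩ := A.exists_axis_limits hij g hne
  have hne' : A.α g⁻¹ (axisEl i j) ≠ axisEl i j := by
    intro h
    apply hne
    conv_lhs => rw [← h, A.α_α_inv]
  obtain ⟨a', b', hab', hlim'⟩ := A.exists_axis_limits hij g⁻¹ hne'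
  set w := A.α g (axisEl i j) with hw
  set M := max a b + 1 with hM
  set M' := min a b with hM'
  set J := {ξ : FreeGroup (Fin N) | M ≤ height i j ξ} with hJ
  set K := {ξ : FreeGroup (Fin N) | M' ≤ height i j ξ}ᶜ with hK
  have hgw : ∀ (n : ℕ) (x : FreeGroup (Fin N)),
      height i j (g⁻¹ • (w ^ n * x)) = height i j (g⁻¹ • x) + n := by
    intro n x
    rw [← zpow_natCast, A.smul_mul, A.α_zpow, hw, A.α_inv_α, height_zpow_mul hij]
  have diam : ∀ H : Set (FreeGroup (Fin N)), Nested H → Conv H → H.Nonempty →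
      (∀ ω, ∃ k₀ : ℕ, ∀ k : ℕ, k₀ ≤ k → w ^ (k : ℤ) * ω ∉ H ∧ w ^ (-(k : ℤ)) * ω ∉ H) →
      ∀ ξ ∈ H, ∀ η ∈ H, height i j (g⁻¹ • η) ≤ height i j (g⁻¹ • ξ) + 2 := by
    intro H hH hc hn hesc ξ hξ η hη
    by_contra hlt
    push Not at hlt
    have hd : ∀ n m : ℕ, n < m →
        Disjoint {x | (w ^ n)⁻¹ * x ∈ H} {x | (w ^ m)⁻¹ * x ∈ H} := by
      intro n m hnm
      rw [Set.disjoint_left]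
      intro x hx hx'
      have := hH.disjoint hn hesc (n := m - n) (by omega) _ hx'
      apply this
      rw [← mul_assoc, ← zpow_natCast, ← zpow_natCast, ← zpow_neg, ← zpow_add]
      rw [show ((m - n : ℕ) : ℤ) + -(m : ℤ) = -(n : ℤ) by omega, zpow_neg, zpow_natCast]
      exact hx
    set V := {x : FreeGroup (Fin N) | height i j (g⁻¹ • η) ≤ height i j (g⁻¹ • x)} with hV
    have hin : ∀ n : ℕ, ({x | (w ^ n)⁻¹ * x ∈ H} ∩ V).Nonempty := by
      intro n
      refine ⟨w ^ n * η, ?_, ?_⟩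
      · simpa using hη
      · rw [hV, Set.mem_ofPred_eq, hgw]; omega
    have hout : ∀ n : ℕ, n ≤ 2 → ({x | (w ^ n)⁻¹ * x ∈ H} ∩ Vᶜ).Nonempty := by
      intro n hn
      refine ⟨w ^ n * ξ, ?_, ?_⟩
      · simpa using hξ
      · rw [hV, Set.mem_compl_iff, Set.mem_ofPred_eq, hgw]; omega
    exact not_three_crossing (A.conv_smul (conv_height hij _) g⁻¹) (hc.translate _)
      (hc.translate _) (hc.translate _) (hd 0 1 (by omega)) (hd 0 2 (by omega)) (hd 1 2 (by omega))
      (hin 0) (hin 1) (hin 2) (hout 0 (by omega)) (hout 1 (by omega)) (hout 2 le_rfl)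
  have hJesc : ∀ ω, ∃ k₀ : ℕ, ∀ k : ℕ, k₀ ≤ k →
      w ^ (k : ℤ) * ω ∉ J ∧ w ^ (-(k : ℤ)) * ω ∉ J := by
    intro ω
    obtain ⟨k₀, hk₀⟩ := hlim ω
    refine ⟨k₀, fun k hk => ?_⟩
    obtain ⟨e1, e2⟩ := hk₀ k hk
    simp only [hJ, Set.mem_ofPred_eq, e1, e2]
    omega
  have hKesc : ∀ ω, ∃ k₀ : ℕ, ∀ k : ℕ, k₀ ≤ k →
      w ^ (k : ℤ) * ω ∉ K ∧ w ^ (-(k : ℤ)) * ω ∉ K := by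
    intro ω
    obtain ⟨k₀, hk₀⟩ := hlim ω
    refine ⟨k₀, fun k hk => ?_⟩
    obtain ⟨e1, e2⟩ := hk₀ k hk
    simp only [hK, Set.mem_compl_iff, Set.mem_ofPred_eq, e1, e2]
    omega
  have hJdiam := diam J (nested_height hij _) (conv_height hij _)
    (by obtain ⟨ξ, h⟩ := exists_height_eq hij M; exact ⟨ξ, h.ge⟩) hJesc
  have hKdiam := diam K (nested_height hij _).compl (conv_height hij _).compl
    (by
      obtain ⟨ξ, h⟩ := exists_height_eq hij (M' - 1)
      refine ⟨ξ, ?_⟩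
      simp only [hK, Set.mem_compl_iff, Set.mem_ofPred_eq]; omega) hKesc
  obtain ⟨k₀, hk₀⟩ := hlim' (g⁻¹ • (1 : FreeGroup (Fin N)))
  set k := k₀ + M.natAbs + M'.natAbs + 2 with hk
  obtain ⟨e1, e2⟩ := hk₀ k (by omega)
  rw [← A.α_zpow, ← A.smul_mul, mul_one] at e1 e2
  have hkJ : axisEl i j ^ (k : ℤ) ∈ J := by
    rw [hJ, Set.mem_ofPred_eq, height_axisEl_pow hij]; omega
  have hkK : axisEl i j ^ (-(k : ℤ)) ∈ K := by
    rw [hK, Set.mem_compl_iff, Set.mem_ofPred_eq, height_axisEl_pow hij]; omega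
  rw [abs_le] at hab hab'
  refine ⟨J ∪ K, fun ξ hξ η hη => ?_, fun ξ hξ η hη => ?_⟩
  · simp only [Set.mem_union, not_or, hJ, hK, Set.mem_compl_iff, Set.mem_ofPred_eq] at hξ hη
    rw [abs_le]
    omega
  · rw [abs_le]
    rcases hξ with hξ | hξ <;> rcases hη with hη | hη
    · have h1 := hJdiam _ hξ _ hη
      have h2 := hJdiam _ hη _ hξ
      omega
    · have h1 := hJdiam _ hξ _ hkJ
      have h2 := hJdiam _ hkJ _ hξ
      have h3 := hKdiam _ hη _ hkK
      have h4 := hKdiam _ hkK _ hη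
      omega
    · have h1 := hJdiam _ hη _ hkJ
      have h2 := hJdiam _ hkJ _ hη
      have h3 := hKdiam _ hξ _ hkK
      have h4 := hKdiam _ hkK _ hξ
      omega
    · have h1 := hKdiam _ hξ _ hη
      have h2 := hKdiam _ hη _ hξ
      omega

end axis

end PointPush

end Slope

namespace Slope

variable {N : ℕ}

/-- The exponent sum in one generator. -/
def esAt (m : Fin N) (k : FreeGroup (Fin N)) : ℤ :=
  Multiplicative.toAdd
    (FreeGroup.lift (fun i => Multiplicative.ofAdd (if i = m then 1 else 0 : ℤ)) k)

@[simp] theorem esAt_mul (m : Fin N) (k l : FreeGroup (Fin N)) :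
    esAt m (k * l) = esAt m k + esAt m l := by simp [esAt]

@[simp] theorem esAt_inv (m : Fin N) (k : FreeGroup (Fin N)) : esAt m k⁻¹ = - esAt m k := by
  simp [esAt]

@[simp] theorem esAt_pow (m : Fin N) (k : FreeGroup (Fin N)) (n : ℕ) :
    esAt m (k ^ n) = n * esAt m k := by simp [esAt]

@[simp] theorem esAt_of (m i : Fin N) : esAt m (FreeGroup.of i) = if i = m then 1 else 0 := by
  simp [esAt]

theorem of_pow_mul_pow_injective {i j : Fin N} (hij : i ≠ j) : Function.Injective
    fun q : ℕ × ℕ => FreeGroup.of i ^ q.1 * (FreeGroup.of j : FreeGroup (Fin N)) ^ q.2 := by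
  rintro ⟨p, q⟩ ⟨p', q'⟩ h
  have h1 := congrArg (esAt i) h
  have h2 := congrArg (esAt j) h
  simp [hij, hij.symm] at h1 h2
  exact Prod.ext h1 h2

theorem axisEl_ne_of {i j : Fin N} (hij : i < j) (m : Fin N) : FreeGroup.of m ≠ axisEl i j := by
  intro h
  have h1 := congrArg (esAt j) h
  simp only [axisEl, esAt_mul, esAt_pow, esAt_inv, esAt_of, hij.ne, if_true, if_false] at h1
  split_ifs at h1 <;> omega

theorem of_not_commute_axisEl {i j : Fin N} (hij : i < j) (m : Fin N) :
    FreeGroup.of m * axisEl i j ≠ axisEl i j * FreeGroup.of m := fun h =>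
  axisEl_ne_of hij m (eq_of_commute_of_es h (es_axisEl i j) (es_of m))

namespace PointPush

variable {G : Type} [Group G] [MulAction G (FreeGroup (Fin N))] (A : PointPush N G)

theorem α_one (g : G) : A.α g 1 = 1 := by
  apply A.ι_injective; rw [A.ι_α]; simp

theorem α_inv (g : G) (w : FreeGroup (Fin N)) : A.α g w⁻¹ = (A.α g w)⁻¹ := by
  apply A.ι_injective
  rw [A.ι_α, map_inv, map_inv, A.ι_α]; group

theorem α_eq_self {g : G} (h : ∀ m, A.α g (FreeGroup.of m) = FreeGroup.of m)
    (w : FreeGroup (Fin N)) : A.α g w = w := by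
  induction w using FreeGroup.induction_on with
  | C1 => exact A.α_one g
  | of m => exact h m
  | inv_of m ih => rw [A.α_inv, ih]
  | mul a b iha ihb => rw [A.α_mul, iha, ihb]

/-- The conjugates of the chosen translation. -/
def Axis (i j : Fin N) : Type := {r : G // ∃ g, g * A.ι (axisEl i j) * g⁻¹ = r}

variable (i j : Fin N)

instance : MulAction G (A.Axis i j) where
  smul g r := ⟨g * r.1 * g⁻¹, by
    obtain ⟨a, ha⟩ := r.2
    exact ⟨g * a, by rw [← ha]; group⟩⟩
  one_smul r := Subtype.ext (show (1 : G) * r.1 * (1 : G)⁻¹ = r.1 by simp)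
  mul_smul g h r := Subtype.ext
    (show (g * h) * r.1 * (g * h)⁻¹ = g * (h * r.1 * h⁻¹) * g⁻¹ by group)

theorem coe_smul (g : G) (r : A.Axis i j) : (g • r).1 = g * r.1 * g⁻¹ := rfl

variable {i j}

/-- The values of the distance along an axis. -/
def distSet (r : A.Axis i j) (ξ η : FreeGroup (Fin N)) : Set ℕ :=
  {n | ∃ g : G, g * A.ι (axisEl i j) * g⁻¹ = r.1 ∧
    n = (height i j (g⁻¹ • ξ) - height i j (g⁻¹ • η)).natAbs}

/-- The distance along an axis. -/
noncomputable def dist (r : A.Axis i j) (ξ η : FreeGroup (Fin N)) : ℕ := sSup (A.distSet r ξ η)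

variable {A}

theorem dist_le {r : A.Axis i j} {ξ η : FreeGroup (Fin N)} {n : ℕ}
    (h : ∀ g : G, g * A.ι (axisEl i j) * g⁻¹ = r.1 →
      (height i j (g⁻¹ • ξ) - height i j (g⁻¹ • η)).natAbs ≤ n) : A.dist r ξ η ≤ n := by
  obtain ⟨g, hg⟩ := r.2
  refine csSup_le ⟨_, g, hg, rfl⟩ ?_
  rintro _ ⟨g, hg, rfl⟩
  exact h g hg

theorem le_dist (hij : i < j) {r : A.Axis i j} {g : G}
    (hg : g * A.ι (axisEl i j) * g⁻¹ = r.1) (ξ η : FreeGroup (Fin N)) :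
    (height i j (g⁻¹ • ξ) - height i j (g⁻¹ • η)).natAbs ≤ A.dist r ξ η := by
  refine le_csSup ⟨(lkSet ξ η ξ η).ncard + 1, ?_⟩ ⟨g, hg, rfl⟩
  rintro _ ⟨g, -, rfl⟩
  have := A.abs_height_smul_sub_le hij g⁻¹ ξ η
  rw [Int.abs_eq_natAbs] at this
  exact_mod_cast this

theorem dist_le_add {C : ℕ} (hC : ∀ g : G,
      g * A.ι (axisEl i j) = A.ι (axisEl i j) * g → ∀ ξ η : FreeGroup (Fin N),
      |(height i j (g • ξ) - height i j (g • η)) - (height i j ξ - height i j η)| ≤ C)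
    {r : A.Axis i j} {g : G} (hg : g * A.ι (axisEl i j) * g⁻¹ = r.1) (ξ η : FreeGroup (Fin N)) :
    A.dist r ξ η ≤ (height i j (g⁻¹ • ξ) - height i j (g⁻¹ • η)).natAbs + C := by
  refine dist_le fun g' hg' => ?_
  have hcomm : (g'⁻¹ * g) * A.ι (axisEl i j) = A.ι (axisEl i j) * (g'⁻¹ * g) := by
    rw [← hg'] at hg
    have := congrArg (fun x => g'⁻¹ * x * g) hg
    simpa [mul_assoc] using this
  have := hC _ hcomm (g⁻¹ • ξ) (g⁻¹ • η)
  simp only [smul_smul] at this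
  rw [mul_assoc, mul_inv_cancel, mul_one, Int.abs_eq_natAbs] at this
  omega

theorem le_dist_pow (hij : i < j) (r : A.Axis i j) (ξ : FreeGroup (Fin N)) (n : ℕ) :
    n ≤ A.dist r ξ (r.1 ^ n • ξ) := by
  obtain ⟨g, hg⟩ := r.2
  have := le_dist hij hg ξ (r.1 ^ n • ξ)
  have e : g⁻¹ • r.1 ^ n • ξ = axisEl i j ^ (n : ℤ) * g⁻¹ • ξ := by
    rw [← hg, conj_pow, smul_smul, ← A.ι_smul, smul_smul, map_zpow, zpow_natCast]
    group
  rw [e, height_zpow_mul hij] at this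
  omega

variable (A) in
/-- The distances along the axes. -/
noncomputable def coarseSystem (hij : i < j) : CoarseSystem G (FreeGroup (Fin N)) (A.Axis i j) where
  d := A.dist
  θ := lk (axisEl i j) (axisEl i j) + 5 + (A.exists_commute_bound hij).choose
  T₀ := 4
  dist_self r ξ := le_antisymm (dist_le fun g _ => by simp) (Nat.zero_le _)
  dist_comm r ξ η := le_antisymm
    (dist_le fun g hg => by have := le_dist hij hg η ξ; omega)
    (dist_le fun g hg => by have := le_dist hij hg ξ η; omega)
  dist_tri r ξ η ζ := dist_le fun g hg => by
    have := le_dist hij hg ξ η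
    have := le_dist hij hg η ζ
    omega
  smul_eq g r ξ η := by
    apply le_antisymm
    · refine dist_le fun h hh => ?_
      have := le_dist hij (r := r) (g := g⁻¹ * h) (by
        rw [coe_smul] at hh
        have := congrArg (fun x => g⁻¹ * x * g) hh
        simpa [mul_assoc] using this) ξ η
      simpa [smul_smul] using this
    · refine dist_le fun h hh => ?_
      have := le_dist hij (r := g • r) (g := g * h) (by rw [coe_smul, ← hh]; group) (g • ξ) (g • η)
      simpa [smul_smul] using this
  unbounded r ξ K := ⟨r.1 ^ (K + 1) • ξ, le_dist_pow hij r ξ (K + 1)⟩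
  finite_ge ξ η := by
    refine Set.Finite.of_finite_image ((A.finite_far hij ξ η).subset ?_)
      (Subtype.val_injective.injOn)
    rintro _ ⟨r, hr, rfl⟩
    by_contra hc
    have : A.dist r ξ η ≤ 3 := dist_le fun g hg => by
      by_contra hlt
      refine hc ⟨g, hg, ?_⟩
      rw [Int.abs_eq_natAbs]
      omega
    rw [Set.mem_ofPred_eq] at hr
    omega
  partition r s hrs := by
    obtain ⟨a, ha⟩ := r.2
    obtain ⟨b, hb⟩ := s.2
    have hne : A.α (a⁻¹ * b) (axisEl i j) ≠ axisEl i j := by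
      intro h
      apply hrs
      apply Subtype.ext
      have := A.ι_α (a⁻¹ * b) (axisEl i j)
      rw [h] at this
      rw [← ha, ← hb]
      conv_lhs => rw [this]
      group
    obtain ⟨Y, h1, h2⟩ := A.exists_partition hij _ hne
    have hC := (A.exists_commute_bound hij).choose_spec
    refine ⟨{ξ | a⁻¹ • ξ ∈ Y}, fun ξ hξ η hη => ?_, fun ξ hξ η hη => ?_⟩
    · refine (dist_le_add hC ha ξ η).trans ?_
      have := h1 _ hξ _ hη
      rw [Int.abs_eq_natAbs] at this
      omega
    · refine (dist_le_add hC hb ξ η).trans ?_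
      have := h2 _ hξ _ hη
      simp only [smul_smul, mul_inv_rev, inv_inv, mul_assoc, mul_inv_cancel, mul_one] at this
      rw [Int.abs_eq_natAbs] at this
      omega

variable (A) in
/-- The axis through a conjugate by a power of a generator. -/
def axisAt (i j : Fin N) (p : Fin N × Fin 4) : A.Axis i j :=
  ⟨A.ι (FreeGroup.of p.1 ^ (p.2 : ℕ)) * A.ι (axisEl i j) * (A.ι (FreeGroup.of p.1 ^ (p.2 : ℕ)))⁻¹,
    _, rfl⟩

theorem axisAt_injective (hij : i < j) (m : Fin N) {t t' : Fin 4}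
    (h : A.axisAt i j (m, t) = A.axisAt i j (m, t')) : t = t' := by
  by_contra hne
  have h1 := congrArg Subtype.val h
  simp only [axisAt] at h1
  rw [← map_inv, ← map_inv, ← map_mul, ← map_mul, ← map_mul, ← map_mul] at h1
  have h2 := A.ι_injective h1
  refine of_not_commute_axisEl hij m (commute_of_zpow (m := (t : ℤ) - t') (by omega) ?_)
  rw [zpow_sub, zpow_natCast, zpow_natCast]
  have e := congrArg (fun x => (FreeGroup.of m ^ (t' : ℕ))⁻¹ * x * FreeGroup.of m ^ (t : ℕ)) h2
  have e' : (FreeGroup.of m ^ (t' : ℕ))⁻¹ * FreeGroup.of m ^ (t : ℕ) =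
      FreeGroup.of m ^ (t : ℕ) * (FreeGroup.of m ^ (t' : ℕ))⁻¹ := by
    rw [← zpow_natCast, ← zpow_natCast, ← zpow_neg, ← zpow_add, ← zpow_add, add_comm]
  rw [← e']
  simpa [mul_assoc] using e

theorem α_of_eq {g : G} {m : Fin N} {t t' : Fin 4} (hne : t ≠ t')
    (h : g • A.axisAt i j (m, t) = A.axisAt i j (m, t))
    (h' : g • A.axisAt i j (m, t') = A.axisAt i j (m, t')) :
    A.α g (FreeGroup.of m) = FreeGroup.of m := by
  have key : ∀ t : Fin 4, g • A.axisAt i j (m, t) = A.axisAt i j (m, t) →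
      A.α g (FreeGroup.of m ^ (t : ℤ) * axisEl i j * (FreeGroup.of m ^ (t : ℤ))⁻¹) =
      FreeGroup.of m ^ (t : ℤ) * axisEl i j * (FreeGroup.of m ^ (t : ℤ))⁻¹ := by
    intro t h
    have h1 := congrArg Subtype.val h
    rw [coe_smul] at h1
    simp only [axisAt] at h1
    apply A.ι_injective
    rw [A.ι_α, map_mul, map_mul, map_inv, zpow_natCast]
    exact h1
  set x : FreeGroup (Fin N) := FreeGroup.of m
  set r := x ^ (t : ℤ) * axisEl i j * (x ^ (t : ℤ))⁻¹ with hr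
  set d : ℤ := (t' : ℤ) - t with hd
  have e : x ^ (t' : ℤ) * axisEl i j * (x ^ (t' : ℤ))⁻¹ = x ^ d * r * (x ^ d)⁻¹ := by
    rw [hr, show (t' : ℤ) = d + t by omega, zpow_add]; group
  have k1 := key t h
  have k2 := key t' h'
  rw [← hr] at k1
  rw [e, A.α_mul, A.α_mul, A.α_inv, k1, A.α_zpow] at k2
  have hc : (x ^ d)⁻¹ * A.α g x ^ d = 1 := by
    refine eq_one_of_commute_of_es (r := r) ?_ (by simp [hr]) ?_
    · have := congrArg (fun z => (x ^ d)⁻¹ * z * A.α g x ^ d) k2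
      simpa [mul_assoc] using this
    · simp [A.es_α, x]
  have : A.α g x ^ d = x ^ d := (inv_mul_eq_one.1 hc).symm
  exact zpow_left_injective (by omega) this

theorem strongGeneric (hij : i < j)
    (hfaith : ∀ g : G, (∀ w, g * A.ι w = A.ι w * g) → es (g • (1 : FreeGroup (Fin N))) = 0 → g = 1)
    {S : Set G} (hS : S.Finite) (hgen : Subgroup.closure S = ⊤) :
    StrongGenericFreeGroupProperty S := by
  classical
  have hnorm : A.ι.range.Normal := ⟨by
    rintro _ ⟨w, rfl⟩ g
    obtain ⟨w', -, h⟩ := A.conj g w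
    exact ⟨w', h.symm⟩⟩
  have hχ : ∀ g h : G, es ((g * h) • (1 : FreeGroup (Fin N))) =
      es (g • (1 : FreeGroup (Fin N))) + es (h • (1 : FreeGroup (Fin N))) := by
    intro g h
    have := A.smul_mul g (h • (1 : FreeGroup (Fin N))) 1
    rw [mul_one] at this
    rw [mul_smul, this, es_mul, A.es_α, add_comm]
  have hmem : ∀ g : G, g ∈ Subgroup.centralizer (A.ι.range : Set G) ↔
      ∀ w, g * A.ι w = A.ι w * g := by
    intro g
    rw [Subgroup.mem_centralizer_iff]
    constructor
    · exact fun h w => (h _ ⟨w, rfl⟩).symm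
    · rintro h _ ⟨w, rfl⟩
      exact (h w).symm
  refine AxisSystem.strongGeneric (A.coarseSystem hij).toAxisSystem (1 : FreeGroup (Fin N))
    (fun r => r.1) (fun g r => rfl) (fun r => Subtype.ext (by rw [coe_smul]; group))
    (fun r ξ n => (le_dist_pow hij r ξ n).trans
      (CoarseSystem.dist_le_exact (A := A.coarseSystem hij) r ξ _))
    (Finset.univ.image (A.axisAt i j)) ?_ (Subgroup.centralizer (A.ι.range : Set G)) ?_
    (fun g => es (g • (1 : FreeGroup (Fin N)))) hχ ?_ (a := A.ι (FreeGroup.of i))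
    (b := A.ι (FreeGroup.of j)) ?_ hS hgen
  · have h1 : ((Finset.univ : Finset (Fin 4)).image fun t => A.axisAt i j (i, t)).card = 4 := by
      rw [Finset.card_image_of_injective _ fun t t' h => axisAt_injective hij i h]
      rfl
    have h2 : (Finset.univ : Finset (Fin 4)).image (fun t => A.axisAt i j (i, t)) ⊆
        Finset.univ.image (A.axisAt i j) := by
      intro r hr
      obtain ⟨t, -, rfl⟩ := Finset.mem_image.1 hr
      exact Finset.mem_image_of_mem _ (Finset.mem_univ _)
    have := Finset.card_le_card h2
    omega
  · intro g V hV hcard hfix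
    rw [hmem]
    have hα : ∀ w, A.α g w = w := A.α_eq_self fun m => by
      have hlarge : 2 ≤ ((Finset.univ : Finset (Fin 4)).filter
          fun t => A.axisAt i j (m, t) ∈ V).card := by
        have h1 := hcard (Finset.univ.image (A.axisAt i j) \ V) (fun r => by simp)
        have h2 : (((Finset.univ : Finset (Fin 4)).filter
            fun t => A.axisAt i j (m, t) ∉ V).image fun t => A.axisAt i j (m, t)) ⊆
            Finset.univ.image (A.axisAt i j) \ V := by
          intro r hr
          obtain ⟨t, ht, rfl⟩ := Finset.mem_image.1 hr
          exact Finset.mem_sdiff.2 ⟨Finset.mem_image_of_mem _ (Finset.mem_univ _),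
            (Finset.mem_filter.1 ht).2⟩
        have h3 := Finset.card_le_card h2
        rw [Finset.card_image_of_injective _ fun t t' h => axisAt_injective hij m h] at h3
        have h4 := Finset.card_filter_add_card_filter_not (s := (Finset.univ : Finset (Fin 4)))
          (fun t => A.axisAt i j (m, t) ∈ V)
        rw [Finset.card_univ, Fintype.card_fin] at h4
        omega
      obtain ⟨t, ht, t', ht', hne⟩ := Finset.one_lt_card.1 hlarge
      exact α_of_eq hne (hfix _ (Finset.mem_filter.1 ht).2) (hfix _ (Finset.mem_filter.1 ht').2)
    intro w
    have := A.ι_α g w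
    rw [hα] at this
    conv_rhs => rw [this, inv_mul_cancel_right]
  · intro g hg h hh e
    have hgh := mul_mem (inv_mem hh) hg
    have h1 := hfaith (h⁻¹ * g) ((hmem _).1 hgh) (by
      have h2 := hχ h (h⁻¹ * g)
      rw [mul_inv_cancel_left] at h2
      have e : es (g • (1 : FreeGroup (Fin N))) = es (h • (1 : FreeGroup (Fin N))) := e
      omega)
    exact (inv_mul_eq_one.1 h1).symm
  · intro p q h
    dsimp only at h
    rw [← map_pow, ← map_pow, ← map_pow, ← map_pow, ← map_mul, ← map_mul] at h
    exact of_pow_mul_pow_injective hij.ne (A.ι_injective h)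

end PointPush

end Slope

namespace Slope

variable {N : ℕ}

/-- The generators of a free group, extended by `1` to all natural numbers. -/
def X (m : ℕ) : FreeGroup (Fin N) := if h : m < N then FreeGroup.of ⟨m, h⟩ else 1

theorem X_coe (m : Fin N) : X (m : ℕ) = FreeGroup.of m := by simp [X]

theorem X_of_lt {m : ℕ} (h : m < N) : X m = FreeGroup.of (⟨m, h⟩ : Fin N) := by simp [X, h]

theorem X_of_le {m : ℕ} (h : N ≤ m) : (X m : FreeGroup (Fin N)) = 1 := by simp [X, h]

/-- The homomorphism with prescribed values on the generators. -/
def liftX {H : Type*} [Group H] (f : ℕ → H) : FreeGroup (Fin N) →* H :=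
  FreeGroup.lift fun m => f m

theorem liftX_X {H : Type*} [Group H] (f : ℕ → H) {m : ℕ} (h : m < N) :
    liftX f (X m : FreeGroup (Fin N)) = f m := by
  rw [X_of_lt h, liftX, FreeGroup.lift_apply_of]

theorem hom_ext_X {H : Type*} [Group H] {f g : FreeGroup (Fin N) →* H}
    (h : ∀ m, m < N → f (X m) = g (X m)) : f = g :=
  FreeGroup.ext_hom _ _ fun m => by rw [← X_coe]; exact h m m.2

/-- The Artin endomorphism. -/
def artin (i : ℕ) : FreeGroup (Fin N) →* FreeGroup (Fin N) :=
  liftX fun m => if m = i then X (i + 1) else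
    if m = i + 1 then (X (i + 1))⁻¹ * X i * X (i + 1) else X m

/-- The inverse of the Artin endomorphism. -/
def artinInv (i : ℕ) : FreeGroup (Fin N) →* FreeGroup (Fin N) :=
  liftX fun m => if m = i then X i * X (i + 1) * (X i)⁻¹ else if m = i + 1 then X i else X m

theorem artin_X {i : ℕ} (hi : i + 1 < N) (m : ℕ) : artin i (X m : FreeGroup (Fin N)) =
    if m = i then X (i + 1) else
      if m = i + 1 then (X (i + 1))⁻¹ * X i * X (i + 1) else X m := by
  by_cases hm : m < N
  · rw [artin, liftX_X _ hm]
  · rw [X_of_le (by omega), map_one, if_neg (by omega), if_neg (by omega)]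

theorem artinInv_X {i : ℕ} (hi : i + 1 < N) (m : ℕ) : artinInv i (X m : FreeGroup (Fin N)) =
    if m = i then X i * X (i + 1) * (X i)⁻¹ else if m = i + 1 then X i else X m := by
  by_cases hm : m < N
  · rw [artinInv, liftX_X _ hm]
  · rw [X_of_le (by omega), map_one, if_neg (by omega), if_neg (by omega)]

theorem artinInv_artin {i : ℕ} (hi : i + 1 < N) (w : FreeGroup (Fin N)) :
    artinInv i (artin i w) = w := by
  have : (artinInv i).comp (artin i) = MonoidHom.id (FreeGroup (Fin N)) := by
    apply hom_ext_X
    intro m _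
    simp only [MonoidHom.comp_apply, MonoidHom.id_apply, artin_X hi]
    split_ifs with h1 h2 <;> simp_all [artinInv_X hi, mul_assoc]
  exact DFunLike.congr_fun this w

theorem artin_artinInv {i : ℕ} (hi : i + 1 < N) (w : FreeGroup (Fin N)) :
    artin i (artinInv i w) = w := by
  have : (artin i).comp (artinInv i) = MonoidHom.id (FreeGroup (Fin N)) := by
    apply hom_ext_X
    intro m _
    simp only [MonoidHom.comp_apply, MonoidHom.id_apply, artinInv_X hi]
    split_ifs with h1 h2 <;> simp_all [artin_X hi, mul_assoc]
  exact DFunLike.congr_fun this w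

/-- The Artin automorphism. -/
def artinAut (i : ℕ) : MulAut (FreeGroup (Fin N)) :=
  if h : i + 1 < N then
    { toFun := artin i
      invFun := artinInv i
      left_inv := artinInv_artin h
      right_inv := artin_artinInv h
      map_mul' := map_mul _ }
  else 1

theorem artinAut_apply {i : ℕ} (h : i + 1 < N) (w : FreeGroup (Fin N)) :
    artinAut i w = artin i w := by rw [artinAut, dif_pos h]; rfl

theorem artinAut_X {i : ℕ} (hi : i + 1 < N) (m : ℕ) : artinAut i (X m : FreeGroup (Fin N)) =
    if m = i then X (i + 1) else
      if m = i + 1 then (X (i + 1))⁻¹ * X i * X (i + 1) else X m := by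
  rw [artinAut_apply hi, artin_X hi]

theorem mulAut_ext_X {f g : MulAut (FreeGroup (Fin N))} (h : ∀ m, m < N → f (X m) = g (X m)) :
    f = g := by
  have : f.toMonoidHom = g.toMonoidHom := hom_ext_X h
  ext1 w
  exact DFunLike.congr_fun this w

theorem artinAut_X_self {i : ℕ} (hi : i + 1 < N) :
    artinAut i (X i : FreeGroup (Fin N)) = X (i + 1) := by
  simp [artinAut_X hi]

theorem artinAut_X_succ {i : ℕ} (hi : i + 1 < N) :
    artinAut i (X (i + 1) : FreeGroup (Fin N)) = (X (i + 1))⁻¹ * X i * X (i + 1) := by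
  simp [artinAut_X hi]

theorem artinAut_X_of_ne {i m : ℕ} (h1 : m ≠ i) (h2 : m ≠ i + 1) :
    artinAut i (X m : FreeGroup (Fin N)) = X m := by
  by_cases hi : i + 1 < N
  · simp [artinAut_X hi, h1, h2]
  · rw [artinAut, dif_neg hi]; rfl

theorem artinAut_comm {i j : ℕ} (hij : i + 1 < j) :
    (artinAut i * artinAut j : MulAut (FreeGroup (Fin N))) = artinAut j * artinAut i := by
  by_cases hj : j + 1 < N
  · have hi : i + 1 < N := by omega
    apply mulAut_ext_X
    intro m _
    have e1 := artinAut_X_self hi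
    have e2 := artinAut_X_succ hi
    have e3 := artinAut_X_self hj
    have e4 := artinAut_X_succ hj
    have f1 : artinAut i (X j : FreeGroup (Fin N)) = X j :=
      artinAut_X_of_ne (by omega) (by omega)
    have f2 : artinAut i (X (j + 1) : FreeGroup (Fin N)) = X (j + 1) :=
      artinAut_X_of_ne (by omega) (by omega)
    have f3 : artinAut j (X i : FreeGroup (Fin N)) = X i :=
      artinAut_X_of_ne (by omega) (by omega)
    have f4 : artinAut j (X (i + 1) : FreeGroup (Fin N)) = X (i + 1) :=
      artinAut_X_of_ne (by omega) (by omega)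
    simp only [MulAut.mul_apply]
    by_cases h1 : m = i
    · subst h1; simp only [e1, f3, f4]
    by_cases h2 : m = i + 1
    · subst h2; simp only [e2, f3, f4, map_mul, map_inv]
    by_cases h3 : m = j
    · subst h3; simp only [e3, f1, f2]
    by_cases h4 : m = j + 1
    · subst h4; simp only [e4, f1, f2, map_mul, map_inv]
    rw [artinAut_X_of_ne h3 h4, artinAut_X_of_ne h1 h2, artinAut_X_of_ne h3 h4]
  · have : (artinAut j : MulAut (FreeGroup (Fin N))) = 1 := by rw [artinAut, dif_neg hj]
    rw [this, mul_one, one_mul]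

theorem artinAut_braid {i : ℕ} (hi : i + 2 < N) :
    (artinAut i * artinAut (i + 1) * artinAut i : MulAut (FreeGroup (Fin N))) =
      artinAut (i + 1) * artinAut i * artinAut (i + 1) := by
  have h1 : i + 1 < N := by omega
  have h2 : i + 1 + 1 < N := by omega
  apply mulAut_ext_X
  intro m _
  simp only [MulAut.mul_apply]
  have e1 := artinAut_X_self h1
  have e2 := artinAut_X_succ h1
  have e3 := artinAut_X_self h2
  have e4 := artinAut_X_succ h2
  have e5 : artinAut i (X (i + 1 + 1) : FreeGroup (Fin N)) = X (i + 1 + 1) :=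
    artinAut_X_of_ne (by omega) (by omega)
  have e6 : artinAut (i + 1) (X i : FreeGroup (Fin N)) = X i :=
    artinAut_X_of_ne (by omega) (by omega)
  by_cases hm1 : m = i
  · subst hm1
    simp only [e1, e3, e5, e6]
  by_cases hm2 : m = i + 1
  · subst hm2
    simp only [e1, e2, e3, e4, e5, e6, map_mul, map_inv]
  by_cases hm3 : m = i + 1 + 1
  · subst hm3
    simp only [e2, e3, e4, e5, e6, map_mul, map_inv]
    group
  have f1 : artinAut i (X m : FreeGroup (Fin N)) = X m := artinAut_X_of_ne hm1 hm2
  have f2 : artinAut (i + 1) (X m : FreeGroup (Fin N)) = X m := artinAut_X_of_ne hm2 hm3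
  simp only [f1, f2]

theorem es_X {m : ℕ} (h : m < N) : es (X m : FreeGroup (Fin N)) = 1 := by rw [X_of_lt h, es_of]

theorem es_artinAut (i : ℕ) (w : FreeGroup (Fin N)) : es (artinAut i w) = es w := by
  by_cases hi : i + 1 < N
  · induction w using FreeGroup.induction_on with
    | C1 => simp
    | of m =>
      rw [← X_coe, artinAut_X hi, es_X m.2]
      split_ifs
      · exact es_X hi
      · simp [es_X (show i < N by omega)]
      · exact es_X m.2
    | inv_of m ih => rw [map_inv, es_inv, es_inv, ih]
    | mul a b iha ihb => rw [map_mul, es_mul, es_mul, iha, ihb]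
  · rw [artinAut, dif_neg hi]; rfl

/-- The initial products of generators. -/
def prodX : ℕ → FreeGroup (Fin N)
  | 0 => 1
  | m + 1 => prodX m * X m

theorem es_prodX {m : ℕ} (h : m ≤ N) : es (prodX m : FreeGroup (Fin N)) = m := by
  induction m with
  | zero => simp [prodX]
  | succ m ih => rw [prodX, es_mul, ih (by omega), es_X (by omega)]; push_cast; ring

theorem artinAut_prodX (i : ℕ) :
    artinAut i (prodX N : FreeGroup (Fin N)) = prodX N := by
  by_cases hi : i + 1 < N
  · have h1 : ∀ m, m ≤ i → artinAut i (prodX m : FreeGroup (Fin N)) = prodX m := by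
      intro m
      induction m with
      | zero => intro _; simp [prodX]
      | succ m ih =>
        intro h
        rw [prodX, map_mul, ih (by omega), artinAut_X_of_ne (by omega) (by omega)]
    have h2 : ∀ m, artinAut i (prodX (i + 2 + m) : FreeGroup (Fin N)) = prodX (i + 2 + m) := by
      intro m
      induction m with
      | zero =>
        simp only [prodX, map_mul, h1 i le_rfl, artinAut_X_self hi, artinAut_X_succ hi]
        group
      | succ m ih =>
        rw [← add_assoc, prodX, map_mul, ih, artinAut_X_of_ne (by omega) (by omega)]
    have := h2 (N - (i + 2))
    rwa [show i + 2 + (N - (i + 2)) = N by omega] at this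
  · rw [artinAut, dif_neg hi]; rfl

end Slope

namespace BraidGroup

variable {n : ℕ}

/-- The Artin generators. -/
def gen (i : Fin (n - 1)) : BraidGroup n := PresentedGroup.of (rels := braidRels n) i

/-- The Artin generators, extended by `1` to all natural numbers. -/
def σ (i : ℕ) : BraidGroup n := if h : i < n - 1 then gen ⟨i, h⟩ else 1

theorem σ_of_lt {i : ℕ} (h : i < n - 1) : σ i = gen (n := n) ⟨i, h⟩ := dif_pos h

theorem σ_of_le {i : ℕ} (h : n - 1 ≤ i) : (σ i : BraidGroup n) = 1 := dif_neg (by omega)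

theorem σ_comm {i j : ℕ} (hij : i + 1 < j) : (σ i * σ j : BraidGroup n) = σ j * σ i := by
  by_cases hj : j < n - 1
  · have hi : i < n - 1 := by omega
    rw [σ_of_lt hi, σ_of_lt hj]
    have : (PresentedGroup.mk (braidRels n)) (FreeGroup.of ⟨i, hi⟩ * FreeGroup.of ⟨j, hj⟩ *
        (FreeGroup.of ⟨j, hj⟩ * FreeGroup.of ⟨i, hi⟩)⁻¹) = 1 :=
      PresentedGroup.one_of_mem (Or.inl ⟨⟨i, hi⟩, ⟨j, hj⟩, by dsimp only; omega, rfl⟩)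
    rw [map_mul, map_inv, mul_inv_eq_one, map_mul, map_mul] at this
    exact this
  · rw [σ_of_le (i := j) (by omega), mul_one, one_mul]

theorem σ_braid {i : ℕ} (hi : i + 2 < n) :
    (σ i * σ (i + 1) * σ i : BraidGroup n) = σ (i + 1) * σ i * σ (i + 1) := by
  have h0 : i < n - 1 := by omega
  have h1 : i + 1 < n - 1 := by omega
  rw [σ_of_lt h0, σ_of_lt h1]
  have : (PresentedGroup.mk (braidRels n)) (FreeGroup.of ⟨i, h0⟩ * FreeGroup.of ⟨i + 1, h1⟩ *
      FreeGroup.of ⟨i, h0⟩ * (FreeGroup.of ⟨i + 1, h1⟩ * FreeGroup.of ⟨i, h0⟩ *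
      FreeGroup.of ⟨i + 1, h1⟩)⁻¹) = 1 :=
    PresentedGroup.one_of_mem (Or.inr ⟨⟨i, h0⟩, ⟨i + 1, h1⟩, rfl, rfl⟩)
  rw [map_mul, map_inv, mul_inv_eq_one, map_mul, map_mul, map_mul, map_mul] at this
  exact this

/-- The homomorphism from a braid group determined by a solution of the braid relations. -/
def hom {H : Type*} [Group H] (f : ℕ → H)
    (hcomm : ∀ i j, i + 1 < j → j + 1 < n → f i * f j = f j * f i)
    (hbraid : ∀ i, i + 2 < n → f i * f (i + 1) * f i = f (i + 1) * f i * f (i + 1)) :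
    BraidGroup n →* H :=
  PresentedGroup.toGroup (rels := braidRels n) (f := fun i : Fin (n - 1) => f i) (by
    rintro r (⟨i, j, hij, rfl⟩ | ⟨i, j, hij, rfl⟩)
    · simp only [map_mul, map_inv, FreeGroup.lift_apply_of, mul_inv_eq_one]
      have h1 := i.2
      have h2 := j.2
      rcases Nat.lt_or_ge (i : ℕ) j with h | h
      · exact hcomm _ _ (by omega) (by omega)
      · exact (hcomm _ _ (by omega) (by omega)).symm
    · simp only [map_mul, map_inv, FreeGroup.lift_apply_of, mul_inv_eq_one, hij]
      have h2 := j.2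
      exact hbraid _ (by omega))

theorem hom_σ {H : Type*} [Group H] {f : ℕ → H}
    {hcomm : ∀ i j, i + 1 < j → j + 1 < n → f i * f j = f j * f i}
    {hbraid : ∀ i, i + 2 < n → f i * f (i + 1) * f i = f (i + 1) * f i * f (i + 1)} {i : ℕ}
    (hi : i + 1 < n) : hom f hcomm hbraid (σ i) = f i := by
  rw [σ_of_lt (by omega)]
  exact PresentedGroup.toGroup.of _

theorem induction_left {p : BraidGroup n → Prop} (one : p 1)
    (mul : ∀ i g, i + 1 < n → p g → p (σ i * g))
    (inv_mul : ∀ i g, i + 1 < n → p g → p ((σ i)⁻¹ * g)) (g : BraidGroup n) : p g := by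
  have hg : g ∈ Subgroup.closure (Set.range (PresentedGroup.of (rels := braidRels n))) := by
    rw [PresentedGroup.closure_range_of]; trivial
  induction hg using Subgroup.closure_induction_left with
  | one => exact one
  | mul_left x hx y _ ih =>
    obtain ⟨i, rfl⟩ := hx
    have := i.2
    rw [show PresentedGroup.of (rels := braidRels n) i = σ (n := n) i from (σ_of_lt i.2).symm]
    exact mul _ _ (by omega) ih
  | inv_mul_cancel x hx y _ ih =>
    obtain ⟨i, rfl⟩ := hx
    have := i.2
    rw [show PresentedGroup.of (rels := braidRels n) i = σ (n := n) i from (σ_of_lt i.2).symm]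
    exact inv_mul _ _ (by omega) ih

end BraidGroup

namespace Slope

variable {N : ℕ}

/-- The Artin representation. -/
def rho (N : ℕ) : BraidGroup N →* MulAut (FreeGroup (Fin N)) :=
  BraidGroup.hom artinAut (fun _ _ h _ => artinAut_comm h) fun _ h => artinAut_braid h

theorem rho_σ {i : ℕ} (hi : i + 1 < N) : rho N (BraidGroup.σ i) = artinAut i :=
  BraidGroup.hom_σ hi

/-- The value of an Artin generator in the coset representation. -/
def cosetFun (i : ℕ) (x : ℕ × FreeGroup (Fin N)) : ℕ × FreeGroup (Fin N) :=
  if x.1 < i then (x.1, artinAut (i - 1) x.2)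
  else if x.1 = i then (i + 1, x.2)
  else if x.1 = i + 1 then (i, X i * x.2)
  else if x.1 ≤ N then (x.1, artinAut i x.2) else x

theorem cosetFun_of_lt {i j : ℕ} (h : j < i) (u : FreeGroup (Fin N)) :
    cosetFun i (j, u) = (j, artinAut (i - 1) u) := by simp [cosetFun, h]

theorem cosetFun_self (i : ℕ) (u : FreeGroup (Fin N)) : cosetFun i (i, u) = (i + 1, u) := by
  simp [cosetFun]

theorem cosetFun_succ (i : ℕ) (u : FreeGroup (Fin N)) :
    cosetFun i (i + 1, u) = (i, X i * u) := by
  simp [cosetFun]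

theorem cosetFun_of_gt {i j : ℕ} (h : i + 1 < j) (hj : j ≤ N) (u : FreeGroup (Fin N)) :
    cosetFun i (j, u) = (j, artinAut i u) := by
  have h1 : ¬ j < i := by omega
  have h2 : j ≠ i := by omega
  have h3 : j ≠ i + 1 := by omega
  simp [cosetFun, h1, h2, h3, hj]

theorem cosetFun_of_large {i j : ℕ} (h : i + 1 < j) (hj : N < j) (u : FreeGroup (Fin N)) :
    cosetFun i (j, u) = (j, u) := by
  have h1 : ¬ j < i := by omega
  have h2 : j ≠ i := by omega
  have h3 : j ≠ i + 1 := by omega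
  have h4 : ¬ j ≤ N := by omega
  simp [cosetFun, h1, h2, h3, h4]

/-- The inverse of `cosetFun`. -/
def cosetInv (i : ℕ) (x : ℕ × FreeGroup (Fin N)) : ℕ × FreeGroup (Fin N) :=
  if x.1 < i then (x.1, (artinAut (i - 1))⁻¹ x.2)
  else if x.1 = i then (i + 1, (X i)⁻¹ * x.2)
  else if x.1 = i + 1 then (i, x.2)
  else if x.1 ≤ N then (x.1, (artinAut i)⁻¹ x.2) else x

/-- The coset representation of an Artin generator. -/
def cosetPerm (N : ℕ) (i : ℕ) : Equiv.Perm (ℕ × FreeGroup (Fin N)) where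
  toFun := cosetFun i
  invFun := cosetInv i
  left_inv := by
    rintro ⟨j, u⟩
    unfold cosetFun cosetInv
    split_ifs <;> simp_all
  right_inv := by
    rintro ⟨j, u⟩
    unfold cosetFun cosetInv
    split_ifs <;> simp_all

theorem cosetPerm_apply (i : ℕ) (x : ℕ × FreeGroup (Fin N)) :
    cosetPerm N i x = cosetFun i x := rfl

theorem cosetPerm_comm {i k : ℕ} (h : i + 1 < k) (hk : k < N) :
    cosetPerm N i * cosetPerm N k = cosetPerm N k * cosetPerm N i := by
  ext1 ⟨j, u⟩
  simp only [Equiv.Perm.mul_apply, cosetPerm_apply]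
  have comm {a b : ℕ} (h : a + 1 < b) : artinAut a (artinAut b u) = artinAut b (artinAut a u) :=
    DFunLike.congr_fun (artinAut_comm h) u
  rcases lt_trichotomy j i with h1 | rfl | h1
  · simp (disch := omega) only [cosetFun_of_lt]
    rw [comm (by omega)]
  · simp (disch := omega) only [cosetFun_of_lt, cosetFun_self]
  rcases Nat.eq_or_lt_of_le (Nat.succ_le_of_lt h1) with rfl | h2
  · simp (disch := omega) only [Nat.succ_eq_add_one, cosetFun_of_lt, cosetFun_succ, map_mul,
      artinAut_X_of_ne]
  rcases Nat.lt_or_ge N j with hN | hN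
  · simp (disch := omega) only [cosetFun_of_large]
  rcases lt_trichotomy j k with h3 | rfl | h3
  · simp (disch := omega) only [cosetFun_of_lt, cosetFun_of_gt]
    rw [comm (by omega)]
  · simp (disch := omega) only [cosetFun_self, cosetFun_of_gt]
  rcases Nat.eq_or_lt_of_le (Nat.succ_le_of_lt h3) with rfl | h4
  · simp (disch := omega) only [Nat.succ_eq_add_one, cosetFun_of_gt, cosetFun_succ, map_mul,
      artinAut_X_of_ne]
  · simp (disch := omega) only [cosetFun_of_gt]
    rw [comm (by omega)]

theorem cosetPerm_braid {i : ℕ} (hi : i + 1 < N) :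
    cosetPerm N i * cosetPerm N (i + 1) * cosetPerm N i =
      cosetPerm N (i + 1) * cosetPerm N i * cosetPerm N (i + 1) := by
  ext1 ⟨j, u⟩
  simp only [Equiv.Perm.mul_apply, cosetPerm_apply]
  have braid {a : ℕ} (h : a + 2 < N) : artinAut a (artinAut (a + 1) (artinAut a u)) =
      artinAut (a + 1) (artinAut a (artinAut (a + 1) u)) :=
    DFunLike.congr_fun (artinAut_braid h) u
  rcases lt_trichotomy j i with h1 | rfl | h1
  · obtain ⟨i, rfl⟩ : ∃ i', i = i' + 1 := ⟨i - 1, by omega⟩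
    simp (disch := omega) only [cosetFun_of_lt, Nat.add_sub_cancel, braid]
  · simp (disch := omega) only [cosetFun_of_lt, cosetFun_of_gt, cosetFun_self, Nat.add_sub_cancel]
  rcases Nat.eq_or_lt_of_le (Nat.succ_le_of_lt h1) with rfl | h2
  · simp (disch := omega) only [Nat.succ_eq_add_one, cosetFun_of_lt, cosetFun_succ, cosetFun_self,
      cosetFun_of_gt, map_mul, artinAut_X_self, Nat.add_sub_cancel]
  rcases Nat.eq_or_lt_of_le (Nat.succ_le_of_lt h2) with rfl | h3
  · simp (disch := omega) only [Nat.succ_eq_add_one, cosetFun_of_lt, cosetFun_succ,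
      cosetFun_of_gt, map_mul, artinAut_X_self, artinAut_X_succ, Nat.add_sub_cancel]
    group
  rcases Nat.lt_or_ge N j with hN | hN
  · simp (disch := omega) only [cosetFun_of_large]
  · simp (disch := omega) only [cosetFun_of_gt, braid]

/-- The coset representation of the braid group. -/
def coset (N : ℕ) : BraidGroup (N + 1) →* Equiv.Perm (ℕ × FreeGroup (Fin N)) :=
  BraidGroup.hom (cosetPerm N) (fun _ _ h h' => cosetPerm_comm h (by omega))
    fun _ h => cosetPerm_braid (by omega)

theorem coset_σ {i : ℕ} (hi : i < N) (x : ℕ × FreeGroup (Fin N)) :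
    coset N (BraidGroup.σ i) x = cosetFun i x := by
  rw [coset, BraidGroup.hom_σ (by omega)]; rfl

end Slope

namespace BraidGroup

open Slope

variable {N : ℕ}

/-- The inclusion of a braid group in the next one. -/
def stab (N : ℕ) : BraidGroup N →* BraidGroup (N + 1) :=
  hom σ (fun _ _ h _ => σ_comm h) fun _ h => σ_braid (by omega)

theorem stab_σ {i : ℕ} (hi : i + 1 < N) : stab N (σ i) = σ i := hom_σ hi

/-- The coset representatives `σ_j⁻¹ ⋯ σ_{N-1}⁻¹`. -/
def τ (j : ℕ) : BraidGroup (N + 1) := if j < N then (σ j)⁻¹ * τ (j + 1) else 1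
termination_by N - j

theorem τ_of_lt {j : ℕ} (h : j < N) : (τ j : BraidGroup (N + 1)) = (σ j)⁻¹ * τ (j + 1) := by
  rw [τ, if_pos h]

theorem τ_of_le {j : ℕ} (h : N ≤ j) : (τ j : BraidGroup (N + 1)) = 1 := by
  rw [τ, if_neg (by omega)]

theorem σ_mul_τ {i : ℕ} (hi : i < N) : (σ i * τ i : BraidGroup (N + 1)) = τ (i + 1) := by
  rw [τ_of_lt hi, mul_inv_cancel_left]

theorem commute_σ_σ {i j : ℕ} (h : i + 1 < j) : Commute (σ i : BraidGroup (N + 1)) (σ j) :=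
  σ_comm h

theorem commute_σ_τ {i j : ℕ} (h : i + 1 < j) : Commute (σ i : BraidGroup (N + 1)) (τ j) := by
  induction hd : N - j generalizing j with
  | zero => rw [τ_of_le (by omega)]; exact Commute.one_right _
  | succ d ih =>
    rw [τ_of_lt (by omega)]
    exact (commute_σ_σ h).inv_right.mul_right (ih (by omega) (by omega))

theorem σ_succ_mul_τ {i j : ℕ} (h : j ≤ i) (hi : i + 1 < N) :
    (σ (i + 1) * τ j : BraidGroup (N + 1)) = τ j * σ i := by
  induction hd : i - j generalizing j with
  | zero =>
    obtain rfl : j = i := by omega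
    rw [τ_of_lt (by omega), τ_of_lt hi]
    have h1 := commute_σ_τ (N := N) (i := j) (j := j + 1 + 1) (by omega)
    have h2 : (σ (j + 1) * (σ j)⁻¹ * (σ (j + 1))⁻¹ : BraidGroup (N + 1)) =
        (σ j)⁻¹ * (σ (j + 1))⁻¹ * σ j := by
      rw [mul_inv_eq_iff_eq_mul, mul_inv_eq_iff_eq_mul, mul_assoc, mul_assoc, mul_assoc,
        eq_inv_mul_iff_mul_eq, eq_inv_mul_iff_mul_eq, ← mul_assoc, ← mul_assoc,
        σ_braid (by omega)]
    calc _ = σ (j + 1) * (σ j)⁻¹ * (σ (j + 1))⁻¹ * τ (j + 1 + 1) := by simp only [mul_assoc]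
      _ = _ := by rw [h2, mul_assoc, h1.eq]; simp only [mul_assoc]
  | succ d ih =>
    rw [τ_of_lt (by omega), mul_assoc, ← ih (by omega) (by omega), ← mul_assoc, ← mul_assoc,
      (commute_σ_σ (show j + 1 < i + 1 by omega)).symm.inv_right.eq]

/-- The generators of the point-pushing subgroup. -/
def push (k : ℕ) : BraidGroup (N + 1) := (τ (k + 1))⁻¹ * (σ k * σ k) * τ (k + 1)

theorem σ_mul_τ_succ {i : ℕ} (hi : i < N) :
    (σ i * τ (i + 1) : BraidGroup (N + 1)) = τ i * push i := by
  rw [push, τ_of_lt hi]; group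

theorem conj_push {m : ℕ} (hm : m + 1 < N) :
    (σ m * push m * (σ m)⁻¹ : BraidGroup (N + 1)) = push (m + 1) := by
  have h1 : Commute (σ m : BraidGroup (N + 1)) (τ (m + 1 + 1)) := commute_σ_τ (by omega)
  have h2 : (σ m * σ (m + 1) * σ m : BraidGroup (N + 1)) = σ (m + 1) * (σ m * σ (m + 1)) := by
    rw [σ_braid (by omega), mul_assoc]
  have h3 : SemiconjBy (σ m * σ (m + 1) : BraidGroup (N + 1)) (σ m * σ m)
      (σ (m + 1) * σ (m + 1)) := SemiconjBy.mul_right h2 h2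
  have h4 := h1.inv_right
  rw [push, push, τ_of_lt hm]
  generalize (τ (m + 1 + 1) : BraidGroup (N + 1)) = t at *
  generalize (σ m : BraidGroup (N + 1)) = a at *
  generalize (σ (m + 1) : BraidGroup (N + 1)) = b at *
  have h5 : b * b = a * b * (a * a) * (a * b)⁻¹ := eq_mul_inv_of_mul_eq h3.eq.symm
  have h6 : a⁻¹ * t⁻¹ = t⁻¹ * a⁻¹ := h1.inv_inv.eq
  rw [h5]
  calc _ = a * t⁻¹ * (b * (a * a)) * b⁻¹ * (t * a⁻¹) := by group
    _ = t⁻¹ * a * (b * (a * a)) * b⁻¹ * (a⁻¹ * t) := by rw [h4.eq, (h1.symm.inv_right).eq]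
    _ = _ := by group

theorem conj_push_succ {m : ℕ} (hm : m + 1 < N) :
    (σ m * push (m + 1) * (σ m)⁻¹ : BraidGroup (N + 1)) =
      (push (m + 1))⁻¹ * push m * push (m + 1) := by
  have h1 : Commute (σ m : BraidGroup (N + 1)) (τ (m + 1 + 1)) := commute_σ_τ (by omega)
  have h2 : (σ (m + 1) * σ m * σ (m + 1) : BraidGroup (N + 1)) = σ m * (σ (m + 1) * σ m) := by
    rw [← σ_braid (by omega), mul_assoc]
  have h3 : SemiconjBy (σ (m + 1) * σ m : BraidGroup (N + 1)) (σ (m + 1) * σ (m + 1))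
      (σ m * σ m) := SemiconjBy.mul_right h2 h2
  have h4 := h1.inv_right
  rw [push, push, τ_of_lt hm]
  generalize (τ (m + 1 + 1) : BraidGroup (N + 1)) = t at *
  generalize (σ m : BraidGroup (N + 1)) = a at *
  generalize (σ (m + 1) : BraidGroup (N + 1)) = b at *
  have h5 : a * a = b * a * (b * b) * (b * a)⁻¹ := eq_mul_inv_of_mul_eq h3.eq.symm
  rw [h5]
  calc _ = a * t⁻¹ * (b * b) * (t * a⁻¹) := by group
    _ = t⁻¹ * a * (b * b) * (a⁻¹ * t) := by rw [h4.eq, (h1.symm.inv_right).eq]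
    _ = _ := by group

theorem conj_push_of_ne {m k : ℕ} (hm : m + 1 < N) (h1 : k ≠ m) (h2 : k ≠ m + 1) :
    (σ m * push k * (σ m)⁻¹ : BraidGroup (N + 1)) = push k := by
  rw [mul_inv_eq_iff_eq_mul, push]
  rcases Nat.lt_or_ge k m with h | h
  · have h3 : SemiconjBy (τ (k + 1) : BraidGroup (N + 1)) (σ m) (σ (m + 1)) :=
      (σ_succ_mul_τ (by omega) hm).symm
    have h4 : Commute (σ (m + 1) : BraidGroup (N + 1)) (σ k) := (commute_σ_σ (by omega)).symm
    have h5 := h4.mul_right h4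
    rw [← mul_assoc, ← mul_assoc, ← h3.inv_symm_left.eq, mul_assoc _ (σ (m + 1)), h5.eq,
      mul_assoc _ (τ (k + 1)), h3.eq]
    simp only [mul_assoc]
  · have h3 : Commute (σ m : BraidGroup (N + 1)) (τ (k + 1)) := commute_σ_τ (by omega)
    have h4 : Commute (σ m : BraidGroup (N + 1)) (σ k) := commute_σ_σ (by omega)
    exact ((h3.inv_right.mul_right (h4.mul_right h4)).mul_right h3).eq

/-- The point-pushing homomorphism. -/
def pushHom (N : ℕ) : FreeGroup (Fin N) →* BraidGroup (N + 1) := liftX push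

theorem pushHom_X {k : ℕ} (hk : k < N) : pushHom N (X k) = push k := liftX_X _ hk

theorem conj_pushHom {m : ℕ} (hm : m + 1 < N) (w : FreeGroup (Fin N)) :
    σ m * pushHom N w * (σ m)⁻¹ = pushHom N (artinAut m w) := by
  have : (MulAut.conj (σ m)).toMonoidHom.comp (pushHom N) =
      (pushHom N).comp (artinAut m).toMonoidHom := by
    apply hom_ext_X
    intro k hk
    change σ m * pushHom N (X k) * (σ m)⁻¹ = pushHom N (artinAut m (X k))
    by_cases h1 : k = m
    · subst h1
      rw [artinAut_X_self hm, pushHom_X hk, pushHom_X hm, conj_push hm]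
    by_cases h2 : k = m + 1
    · subst h2
      simp only [artinAut_X_succ hm, pushHom_X hk, pushHom_X (show m < N by omega), map_mul,
        map_inv, conj_push_succ hm]
    rw [artinAut_X_of_ne h1 h2, pushHom_X hk, conj_push_of_ne hm h1 h2]
  exact DFunLike.congr_fun this w

theorem stab_mul_pushHom (b : BraidGroup N) (w : FreeGroup (Fin N)) :
    stab N b * pushHom N w = pushHom N (rho N b w) * stab N b := by
  induction b using induction_left generalizing w with
  | one => simp
  | mul i g hi ih =>
    rw [map_mul, mul_assoc, ih, ← mul_assoc, stab_σ hi, mul_inv_eq_iff_eq_mul.1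
      (conj_pushHom hi _), map_mul, rho_σ hi, mul_assoc]
    rfl
  | inv_mul i g hi ih =>
    have h := conj_pushHom hi ((artinAut i)⁻¹ (rho N g w))
    rw [MulAut.apply_inv_self, mul_inv_eq_iff_eq_mul] at h
    rw [map_mul, mul_assoc, ih, map_inv, stab_σ hi, map_mul, map_inv, rho_σ hi, MulAut.mul_apply,
      inv_mul_eq_iff_eq_mul, ← mul_assoc, ← mul_assoc, h]
    simp only [mul_assoc, mul_inv_cancel_left]

theorem exists_normal_form (g : BraidGroup (N + 1)) :
    ∃ j k b, j ≤ N ∧ g = τ j * pushHom N k * stab N b := by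
  induction g using induction_left with
  | one => exact ⟨N, 1, 1, le_rfl, by simp [τ_of_le le_rfl]⟩
  | mul i g hi ih =>
    obtain ⟨j, k, b, hj, rfl⟩ := ih
    have key {m : ℕ} (hm : m + 1 < N) (h : (σ i * τ j : BraidGroup (N + 1)) = τ j * σ m) :
        σ i * (τ j * pushHom N k * stab N b) =
          τ j * pushHom N (artinAut m k) * stab N (σ m * b) := by
      rw [← conj_pushHom hm, map_mul, stab_σ hm, ← mul_assoc, ← mul_assoc, h]
      group
    rcases lt_trichotomy j i with h1 | rfl | h1
    · obtain ⟨i, rfl⟩ : ∃ i', i = i' + 1 := ⟨i - 1, by omega⟩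
      exact ⟨j, _, _, hj, key (by omega) (σ_succ_mul_τ (by omega) (by omega))⟩
    · exact ⟨j + 1, k, b, by omega, by rw [← mul_assoc, ← mul_assoc, σ_mul_τ (by omega)]⟩
    rcases Nat.eq_or_lt_of_le (Nat.succ_le_of_lt h1) with rfl | h2
    · refine ⟨i, X i * k, b, by omega, ?_⟩
      rw [Nat.succ_eq_add_one, ← mul_assoc, ← mul_assoc, σ_mul_τ_succ (by omega), map_mul,
        pushHom_X (by omega)]
      simp only [mul_assoc]
    · exact ⟨j, _, _, hj, key (by omega) (commute_σ_τ h2)⟩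
  | inv_mul i g hi ih =>
    obtain ⟨j, k, b, hj, rfl⟩ := ih
    have key {m : ℕ} (hm : m + 1 < N) (h : (σ i * τ j : BraidGroup (N + 1)) = τ j * σ m) :
        (σ i)⁻¹ * (τ j * pushHom N k * stab N b) =
          τ j * pushHom N ((artinAut m)⁻¹ k) * stab N ((σ m)⁻¹ * b) := by
      rw [inv_mul_eq_iff_eq_mul, ← mul_assoc, ← mul_assoc, h]
      have := conj_pushHom hm ((artinAut m)⁻¹ k)
      rw [MulAut.apply_inv_self] at this
      rw [← this, map_mul, map_inv, stab_σ hm]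
      group
    rcases lt_trichotomy j i with h1 | rfl | h1
    · obtain ⟨i, rfl⟩ : ∃ i', i = i' + 1 := ⟨i - 1, by omega⟩
      exact ⟨j, _, _, hj, key (by omega) (σ_succ_mul_τ (by omega) (by omega))⟩
    · refine ⟨j + 1, (X j)⁻¹ * k, b, by omega, ?_⟩
      rw [inv_mul_eq_iff_eq_mul, ← mul_assoc, ← mul_assoc, σ_mul_τ_succ (by omega), map_mul,
        map_inv, pushHom_X (by omega)]
      group
    rcases Nat.eq_or_lt_of_le (Nat.succ_le_of_lt h1) with rfl | h2
    · exact ⟨i, k, b, by omega, by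
        rw [Nat.succ_eq_add_one, ← mul_assoc, ← mul_assoc, ← τ_of_lt (by omega)]⟩
    · exact ⟨j, _, _, hj, key (by omega) (commute_σ_τ h2)⟩

theorem coset_τ {j : ℕ} (hj : j ≤ N) (u : FreeGroup (Fin N)) :
    coset N (τ j) (N, u) = (j, u) := by
  induction hd : N - j generalizing j with
  | zero => rw [τ_of_le (by omega), map_one, Equiv.Perm.one_apply, show j = N by omega]
  | succ d ih =>
    rw [τ_of_lt (by omega), map_mul, Equiv.Perm.mul_apply, ih (by omega) (by omega), map_inv,
      Equiv.Perm.inv_eq_iff_eq, coset_σ (by omega), cosetFun_self]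

theorem coset_pushHom (k u : FreeGroup (Fin N)) : coset N (pushHom N k) (N, u) = (N, k * u) := by
  induction k using FreeGroup.induction_on generalizing u with
  | C1 => simp
  | of k =>
    rw [← X_coe, pushHom_X k.2, push]
    simp only [map_mul, map_inv, Equiv.Perm.mul_apply, coset_τ (show (k : ℕ) + 1 ≤ N from k.2),
      coset_σ k.2, cosetFun_succ, cosetFun_self]
    rw [Equiv.Perm.inv_eq_iff_eq, coset_τ (show (k : ℕ) + 1 ≤ N from k.2)]
  | inv_of k ih =>
    rw [map_inv, map_inv, Equiv.Perm.inv_eq_iff_eq, ih, mul_inv_cancel_left]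
  | mul a b iha ihb => rw [map_mul, map_mul, Equiv.Perm.mul_apply, ihb, iha, mul_assoc]

theorem coset_stab (b : BraidGroup N) (u : FreeGroup (Fin N)) :
    coset N (stab N b) (N, u) = (N, rho N b u) := by
  induction b using induction_left generalizing u with
  | one => simp
  | mul i g hi ih =>
    rw [map_mul, map_mul, Equiv.Perm.mul_apply, ih, stab_σ hi, coset_σ (by omega),
      cosetFun_of_gt hi le_rfl, map_mul, rho_σ hi]
    rfl
  | inv_mul i g hi ih =>
    rw [map_mul, map_mul, Equiv.Perm.mul_apply, ih, map_inv, map_inv, stab_σ hi,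
      Equiv.Perm.inv_eq_iff_eq, coset_σ (by omega), cosetFun_of_gt hi le_rfl, map_mul, map_inv,
      rho_σ hi, MulAut.mul_apply, MulAut.apply_inv_self]

theorem coset_normal_form {j : ℕ} (hj : j ≤ N) (k : FreeGroup (Fin N)) (b : BraidGroup N)
    (u : FreeGroup (Fin N)) :
    coset N (τ j * pushHom N k * stab N b) (N, u) = (j, k * rho N b u) := by
  simp only [map_mul, Equiv.Perm.mul_apply, coset_stab, coset_pushHom, coset_τ hj]

theorem cosetFun_fst (i : ℕ) (x : ℕ × FreeGroup (Fin N)) :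
    (cosetFun i x).1 = Equiv.swap i (i + 1) x.1 := by
  unfold cosetFun
  split_ifs with h1 h2 h3 h4
  · rw [Equiv.swap_apply_of_ne_of_ne] <;> omega
  · rw [h2, Equiv.swap_apply_left]
  · rw [h3, Equiv.swap_apply_right]
  · rw [Equiv.swap_apply_of_ne_of_ne h2 h3]
  · rw [Equiv.swap_apply_of_ne_of_ne h2 h3]

theorem coset_fst {π : BraidGroup (N + 1) →* Equiv.Perm (Fin (N + 1))}
    (hπ : ∀ i (h : i < N), π (σ i) = Equiv.swap ⟨i, by omega⟩ ⟨i + 1, by omega⟩)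
    (g : BraidGroup (N + 1)) (j : Fin (N + 1)) (u : FreeGroup (Fin N)) :
    (coset N g (j, u)).1 = π g j := by
  have hswap (i : ℕ) (h : i < N) (x : Fin (N + 1)) :
      ((π (σ i) x : Fin (N + 1)) : ℕ) = Equiv.swap i (i + 1) (x : ℕ) := by
    rw [hπ i h]
    simp only [Equiv.swap_apply_def, Fin.ext_iff]
    split_ifs <;> rfl
  induction g using induction_left with
  | one => simp
  | mul i g hi ih =>
    rw [map_mul, map_mul, Equiv.Perm.mul_apply, Equiv.Perm.mul_apply, coset_σ (by omega),
      cosetFun_fst, ih, hswap i (by omega)]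
  | inv_mul i g hi ih =>
    rw [map_mul, map_mul, Equiv.Perm.mul_apply, Equiv.Perm.mul_apply, map_inv, map_inv]
    set y := (coset N (σ i))⁻¹ (coset N g (j, u)) with hy
    have h1 : cosetFun i y = coset N g (j, u) := by
      rw [← coset_σ (by omega), hy]; simp
    have h2 := hswap i (by omega) ((π (σ i))⁻¹ (π g j))
    rw [← Equiv.Perm.mul_apply, mul_inv_cancel, Equiv.Perm.one_apply, ← ih, ← h1,
      cosetFun_fst] at h2
    exact (Equiv.swap i (i + 1)).injective h2

end BraidGroup

namespace BraidGroup

open Slope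

variable {N : ℕ}

/-- The homomorphism killing the `j`-th generator and renumbering the others. -/
def kill (j : ℕ) : FreeGroup (Fin (N + 1)) →* FreeGroup (Fin N) :=
  liftX fun m => if m < j then X m else if m = j then 1 else X (m - 1)

theorem kill_X_of_lt {j m : ℕ} (h : m < j) (hj : j ≤ N) :
    kill j (X m : FreeGroup (Fin (N + 1))) = X m := by
  rw [kill, liftX_X _ (by omega), if_pos h]

theorem kill_X_self (j : ℕ) : kill j (X j : FreeGroup (Fin (N + 1))) = 1 := by
  rcases Nat.lt_or_ge N j with h | h
  · rw [X_of_le (by omega), map_one]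
  · rw [kill, liftX_X _ (by omega), if_neg (by omega), if_pos rfl]

theorem kill_X_of_gt {j m : ℕ} (h : j ≤ m) :
    kill j (X (m + 1) : FreeGroup (Fin (N + 1))) = X m := by
  rcases Nat.lt_or_ge m N with h' | h'
  · rw [kill, liftX_X _ (by omega), if_neg (by omega), if_neg (by omega), Nat.add_sub_cancel]
  · rw [X_of_le (by omega), X_of_le h', map_one]

theorem kill_artinAut_of_lt {i j : ℕ} (h : j ≤ i) (hi : i + 1 < N)
    (w : FreeGroup (Fin (N + 1))) :
    kill j (artinAut (i + 1) w) = artinAut i (kill j w) := by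
  have : (kill (N := N) j).comp (artinAut (i + 1)).toMonoidHom =
      (artinAut i).toMonoidHom.comp (kill j) := by
    apply hom_ext_X
    intro m hm
    change kill j (artinAut (i + 1) (X m)) = artinAut i (kill j (X m))
    by_cases h1 : m = i + 1
    · subst h1
      simp (disch := omega) only [artinAut_X_self, kill_X_of_gt]
    by_cases h2 : m = i + 1 + 1
    · subst h2
      simp (disch := omega) only [artinAut_X_succ, kill_X_of_gt, map_mul, map_inv]
    rw [artinAut_X_of_ne h1 h2]
    rcases lt_trichotomy m j with h3 | rfl | h3
    · simp (disch := omega) only [kill_X_of_lt, artinAut_X_of_ne]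
    · simp only [kill_X_self, map_one]
    · obtain ⟨m, rfl⟩ : ∃ m', m = m' + 1 := ⟨m - 1, by omega⟩
      simp (disch := omega) only [kill_X_of_gt, artinAut_X_of_ne]
  exact DFunLike.congr_fun this w

theorem kill_artinAut_of_gt {i j : ℕ} (h : i + 1 < j) (hj : j ≤ N)
    (w : FreeGroup (Fin (N + 1))) : kill j (artinAut i w) = artinAut i (kill j w) := by
  have : (kill (N := N) j).comp (artinAut i).toMonoidHom =
      (artinAut i).toMonoidHom.comp (kill j) := by
    apply hom_ext_X
    intro m hm
    change kill j (artinAut i (X m)) = artinAut i (kill j (X m))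
    by_cases h1 : m = i
    · subst h1
      simp (disch := omega) only [artinAut_X_self, kill_X_of_lt]
    by_cases h2 : m = i + 1
    · subst h2
      simp (disch := omega) only [artinAut_X_succ, kill_X_of_lt, map_mul, map_inv]
    rw [artinAut_X_of_ne h1 h2]
    rcases lt_trichotomy m j with h3 | rfl | h3
    · simp (disch := omega) only [kill_X_of_lt, artinAut_X_of_ne]
    · simp only [kill_X_self, map_one]
    · obtain ⟨m, rfl⟩ : ∃ m', m = m' + 1 := ⟨m - 1, by omega⟩
      simp (disch := omega) only [kill_X_of_gt, artinAut_X_of_ne]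
  exact DFunLike.congr_fun this w

theorem kill_succ_artinAut {i : ℕ} (hi : i < N) (w : FreeGroup (Fin (N + 1))) :
    kill (i + 1) (artinAut i w) = kill i w := by
  have : (kill (N := N) (i + 1)).comp (artinAut i).toMonoidHom = kill i := by
    apply hom_ext_X
    intro m hm
    change kill (i + 1) (artinAut i (X m)) = kill i (X m)
    by_cases h1 : m = i
    · subst h1
      simp (disch := omega) only [artinAut_X_self, kill_X_self]
    by_cases h2 : m = i + 1
    · subst h2
      simp (disch := omega) only [artinAut_X_succ, kill_X_self, kill_X_of_lt, kill_X_of_gt,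
        map_mul, map_inv, inv_one, one_mul, mul_one]
    rw [artinAut_X_of_ne h1 h2]
    rcases Nat.lt_or_ge m i with h3 | h3
    · simp (disch := omega) only [kill_X_of_lt]
    · obtain ⟨m, rfl⟩ : ∃ m', m = m' + 1 := ⟨m - 1, by omega⟩
      simp (disch := omega) only [kill_X_of_gt]
  exact DFunLike.congr_fun this w

theorem kill_artinAut_self {i : ℕ} (hi : i < N) (w : FreeGroup (Fin (N + 1))) :
    kill i (artinAut i w) = kill (i + 1) w := by
  have : (kill (N := N) i).comp (artinAut i).toMonoidHom = kill (i + 1) := by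
    apply hom_ext_X
    intro m hm
    change kill i (artinAut i (X m)) = kill (i + 1) (X m)
    by_cases h1 : m = i
    · subst h1
      simp (disch := omega) only [artinAut_X_self, kill_X_of_lt, kill_X_of_gt]
    by_cases h2 : m = i + 1
    · subst h2
      simp (disch := omega) only [artinAut_X_succ, kill_X_self, map_mul, map_inv, mul_one,
        inv_mul_cancel]
    rw [artinAut_X_of_ne h1 h2]
    rcases Nat.lt_or_ge m i with h3 | h3
    · simp (disch := omega) only [kill_X_of_lt]
    · obtain ⟨m, rfl⟩ : ∃ m', m = m' + 1 := ⟨m - 1, by omega⟩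
      simp (disch := omega) only [kill_X_of_gt]
  exact DFunLike.congr_fun this w

/-- The correspondence between conjugates of generators and points of the coset
representation. -/
def Rel (w : FreeGroup (Fin (N + 1))) (x : ℕ × FreeGroup (Fin N)) : Prop :=
  ∃ W : FreeGroup (Fin (N + 1)), ∃ j ≤ N, w = W * X j * W⁻¹ ∧ x = (j, (kill j W)⁻¹)

theorem cosetFun_kill {i j : ℕ} (hi : i < N) (hj : j ≤ N) (h1 : j ≠ i) (h2 : j ≠ i + 1)
    (W : FreeGroup (Fin (N + 1))) :
    cosetFun i (j, (kill j W)⁻¹) = (j, (kill j (artinAut i W))⁻¹) := by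
  rcases lt_trichotomy j i with h | h | h
  · obtain ⟨i, rfl⟩ : ∃ i', i = i' + 1 := ⟨i - 1, by omega⟩
    rw [cosetFun_of_lt h, kill_artinAut_of_lt (by omega) hi, map_inv, Nat.add_sub_cancel]
  · exact absurd h h1
  · rw [cosetFun_of_gt (by omega) hj, kill_artinAut_of_gt (by omega) hj, map_inv]

theorem cosetFun_kill_self {i : ℕ} (hi : i < N) (W : FreeGroup (Fin (N + 1))) :
    cosetFun i (i, (kill i W)⁻¹) = (i + 1, (kill (i + 1) (artinAut i W))⁻¹) := by
  rw [cosetFun_self, kill_succ_artinAut hi]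

theorem cosetFun_kill_succ {i : ℕ} (hi : i < N) (W : FreeGroup (Fin (N + 1))) :
    cosetFun i (i + 1, (kill (i + 1) W)⁻¹) = (i, (kill i (artinAut i W * (X (i + 1))⁻¹))⁻¹) := by
  rw [cosetFun_succ, map_mul, kill_artinAut_self hi, map_inv, kill_X_of_gt le_rfl, mul_inv_rev,
    inv_inv]

theorem Rel.artinAut {i : ℕ} (hi : i < N) {w : FreeGroup (Fin (N + 1))}
    {x : ℕ × FreeGroup (Fin N)} (h : Rel w x) : Rel (artinAut i w) (cosetFun i x) := by
  obtain ⟨W, j, hj, rfl, rfl⟩ := h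
  by_cases h1 : j = i
  · subst h1
    refine ⟨_, j + 1, hi, ?_, cosetFun_kill_self hi W⟩
    simp only [map_mul, map_inv, artinAut_X_self (show j + 1 < N + 1 by omega)]
  by_cases h2 : j = i + 1
  · subst h2
    refine ⟨_, i, hi.le, ?_, cosetFun_kill_succ hi W⟩
    simp only [map_mul, map_inv, artinAut_X_succ (show i + 1 < N + 1 by omega)]
    group
  refine ⟨_, j, hj, ?_, cosetFun_kill hi hj h1 h2 W⟩
  simp only [map_mul, map_inv, artinAut_X_of_ne h1 h2]

theorem Rel.of_artinAut {i : ℕ} (hi : i < N) {w : FreeGroup (Fin (N + 1))}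
    {x : ℕ × FreeGroup (Fin N)} (h : Rel (Slope.artinAut i w) (cosetFun i x)) : Rel w x := by
  obtain ⟨W, j, hj, hw, hx⟩ := h
  have inj : Function.Injective (cosetFun (N := N) i) := (cosetPerm N i).injective
  by_cases h1 : j = i + 1
  · subst h1
    obtain ⟨V, rfl⟩ := (Slope.artinAut i).surjective W
    refine ⟨V, i, hi.le, (Slope.artinAut i).injective ?_, inj ?_⟩
    · rw [hw]
      simp only [map_mul, map_inv, artinAut_X_self (show i + 1 < N + 1 by omega)]
    · rw [hx, cosetFun_kill_self hi]
  by_cases h2 : j = i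
  · subst h2
    obtain ⟨V, hV⟩ := (Slope.artinAut j).surjective (W * X (j + 1))
    obtain rfl : W = Slope.artinAut j V * (X (j + 1))⁻¹ := by rw [hV, mul_inv_cancel_right]
    refine ⟨V, j + 1, hi, (Slope.artinAut j).injective ?_, inj ?_⟩
    · rw [hw]
      simp only [map_mul, map_inv, artinAut_X_succ (show j + 1 < N + 1 by omega)]
      group
    · rw [hx, cosetFun_kill_succ hi]
  obtain ⟨V, rfl⟩ := (Slope.artinAut i).surjective W
  refine ⟨V, j, hj, (Slope.artinAut i).injective ?_, inj ?_⟩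
  · rw [hw]
    simp only [map_mul, map_inv, artinAut_X_of_ne h2 h1]
  · rw [hx, cosetFun_kill hi hj h2 h1]

theorem Rel.rho (g : BraidGroup (N + 1)) {w : FreeGroup (Fin (N + 1))}
    {x : ℕ × FreeGroup (Fin N)} (h : Rel w x) : Rel (rho (N + 1) g w) (coset N g x) := by
  induction g using induction_left with
  | one => simpa
  | mul i g hi ih =>
    rw [map_mul, map_mul, Equiv.Perm.mul_apply, MulAut.mul_apply, rho_σ hi,
      coset_σ (by omega)]
    exact ih.artinAut (by omega)
  | inv_mul i g hi ih =>
    apply Rel.of_artinAut (i := i) (by omega)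
    rw [← coset_σ (by omega), ← Equiv.Perm.mul_apply, ← map_mul, mul_inv_cancel_left, ← rho_σ hi,
      ← MulAut.mul_apply, ← map_mul, mul_inv_cancel_left]
    exact ih

theorem kill_eq_one_of_commute {V : FreeGroup (Fin (N + 1))} {j : ℕ} (hj : j ≤ N)
    (h : V * X j = X j * V) : kill j V = 1 := by
  obtain ⟨z, m, n, rfl, hz⟩ := exists_zpow_of_commute h
  have hn : n ≠ 0 := by
    rintro rfl
    have := congrArg es hz
    rw [es_X (by omega)] at this
    simp at this
  have h1 : kill j z ^ n = 1 ^ n := by rw [← map_zpow, ← hz, kill_X_self, one_zpow]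
  rw [map_zpow, zpow_left_injective hn h1, one_zpow]

theorem coset_eq_of_rho_eq_one {g : BraidGroup (N + 1)} (hg : rho (N + 1) g = 1)
    (u : FreeGroup (Fin N)) : coset N g (N, u) = (N, u) := by
  obtain ⟨W, rfl⟩ : ∃ W : FreeGroup (Fin (N + 1)), u = (kill N W)⁻¹ := by
    have : (kill (N := N) N).comp (liftX X) = MonoidHom.id _ := hom_ext_X fun m hm => by
      rw [MonoidHom.comp_apply, liftX_X _ hm, kill_X_of_lt hm le_rfl, MonoidHom.id_apply]
    have h := DFunLike.congr_fun this u⁻¹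
    refine ⟨liftX X u⁻¹, ?_⟩
    exact (inv_eq_iff_eq_inv.2 h).symm
  obtain ⟨W', j, hj, h1, h2⟩ := Rel.rho g ⟨W, N, le_rfl, rfl, rfl⟩
  rw [hg, MulAut.one_apply] at h1
  rw [h2]
  obtain rfl : j = N := by
    by_contra hne
    have := congrArg (esAt (⟨j, by omega⟩ : Fin (N + 1))) h1
    rw [X_of_lt (show j < N + 1 by omega), X_of_lt (show N < N + 1 by omega)] at this
    simp [Ne.symm hne] at this
  have h3 : kill j (W⁻¹ * W') = 1 := by
    refine kill_eq_one_of_commute le_rfl ?_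
    rw [eq_mul_inv_iff_mul_eq] at h1
    rw [mul_assoc, inv_mul_eq_iff_eq_mul, ← h1]
    group
  rw [map_mul, map_inv, inv_mul_eq_one] at h3
  rw [h3]

theorem rho_injective : Function.Injective (rho N) := by
  rw [injective_iff_map_eq_one]
  induction N with
  | zero =>
    intro g _
    induction g using induction_left with
    | one => rfl
    | mul i g hi _ => omega
    | inv_mul i g hi _ => omega
  | succ N ih =>
    intro g hg
    obtain ⟨j, k, b, hj, rfl⟩ := exists_normal_form g
    have h (u) := (coset_normal_form hj k b u).symm.trans (coset_eq_of_rho_eq_one hg u)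
    have h1 := h 1
    rw [map_one, mul_one, Prod.mk_inj] at h1
    obtain ⟨rfl, rfl⟩ := h1
    have hb : b = 1 := ih b (by
      ext1 u
      have := (Prod.mk_inj.1 (h u)).2
      rwa [one_mul] at this)
    rw [hb, τ_of_le le_rfl, map_one, map_one, one_mul, one_mul]

end BraidGroup

namespace Slope

variable {N : ℕ}

/-- The lower ends of the intervals of slopes after applying an Artin automorphism. -/
def warpLo (i c : ℤ) : ℚ :=
  if c = 2 * i then 3 * c - 1 / 2 else if c = 2 * i + 1 then 3 * c - 16 / 5 else
    if c = 2 * i + 2 then 3 * c - 43 / 7 else if c = 2 * i + 3 then 3 * c - 7 else 3 * c - 1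

/-- The upper ends of the intervals of slopes after applying an Artin automorphism. -/
def warpHi (i c : ℤ) : ℚ :=
  if c = 2 * i then 3 * c - 1 / 4 else if c = 2 * i + 1 then 3 * c - 22 / 7 else
    if c = 2 * i + 2 then 3 * c - 5 else 3 * c + 1

theorem warpHi_le_warpLo (i : ℤ) {c d : ℤ} (h : c < d) : warpHi i c ≤ warpLo i d := by
  have key : ∀ e : ℤ, c + e ≤ d → (c : ℚ) + e ≤ d := fun e he => by exact_mod_cast he
  have h1 := key 1 (by omega)
  unfold warpHi warpLo
  rcases (by omega : c + 1 = d ∨ c + 2 = d ∨ c + 3 = d ∨ c + 4 ≤ d) with h2 | h2 | h2 | h2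
  · have h3 := key 1 (by omega)
    push_cast at h3
    split_ifs <;> first | (exfalso; omega) | linarith
  · have h3 := key 2 (by omega)
    push_cast at h3
    split_ifs <;> first | (exfalso; omega) | linarith
  · have h3 := key 3 (by omega)
    push_cast at h3
    split_ifs <;> first | (exfalso; omega) | linarith
  · have h3 := key 4 (by omega)
    push_cast at h3
    split_ifs <;> first | (exfalso; omega) | linarith

theorem lt_warpLo (i : ℤ) {c : ℤ} (h : 0 ≤ c) : -10 < warpLo i c := by
  have : (0 : ℚ) ≤ c := by exact_mod_cast h
  unfold warpLo
  split_ifs <;> linarith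

/-- The words whose slope lies in the warped interval of a letter. -/
def InWarp (i : ℤ) (l : Fin N × Bool) (y : FreeGroup (Fin N)) : Prop :=
  warpLo i (code l) < slope y ∧ slope y < warpHi i (code l)

theorem inv_mem_of_lt {a x : ℚ} (ha : 0 < a) (h : x < -a) : -a⁻¹ < x⁻¹ ∧ x⁻¹ < 0 := by
  have hx : x < 0 := by linarith
  refine ⟨?_, inv_lt_zero.2 hx⟩
  rw [← inv_neg]
  exact (inv_lt_inv_of_neg (by linarith) hx).2 h

theorem inv_mem_of_gt {a x : ℚ} (ha : 0 < a) (h : a < x) : 0 < x⁻¹ ∧ x⁻¹ < a⁻¹ :=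
  ⟨inv_pos.2 (by linarith), (inv_lt_inv₀ (by linarith) ha).2 h⟩

theorem inv_of_neg_lt {a x : ℚ} (h : -a < x) : x⁻¹ < -a⁻¹ ∨ 0 ≤ x⁻¹ := by
  rcases lt_or_ge x 0 with hx | hx
  · left
    rw [← inv_neg]
    exact (inv_lt_inv_of_neg hx (by linarith)).2 h
  · right
    exact inv_nonneg.2 hx

theorem inv_mem_Ioo {a b x : ℚ} (ha : 0 < a) (h : a < x) (h' : x < b) : b⁻¹ < x⁻¹ ∧ x⁻¹ < a⁻¹ :=
  ⟨(inv_lt_inv₀ (by linarith) (by linarith)).2 h', (inv_lt_inv₀ (by linarith) ha).2 h⟩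

theorem warp_bounds_self {p z : ℚ} (h : z < p - 1 / 5 ∨ p - 1 / 7 < z) :
    p - 1 / 2 < p - (p + 6 - (p + 3 - (z - p)⁻¹ - (p + 9))⁻¹ - (p + 3))⁻¹ ∧
      p - (p + 6 - (p + 3 - (z - p)⁻¹ - (p + 9))⁻¹ - (p + 3))⁻¹ < p - 1 / 4 := by
  set y := p + 3 - (z - p)⁻¹ - (p + 9) with hy
  have h1 : y < -1 ∨ 1 < y := by
    rcases h with h | h
    · have := inv_mem_of_lt (a := 1 / 5) (x := z - p) (by norm_num) (by linarith)
      simp only [one_div, inv_inv] at this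
      left; linarith
    · have := inv_of_neg_lt (a := 1 / 7) (x := z - p) (by linarith)
      simp only [one_div, inv_inv] at this
      rcases this with h | h
      · right; linarith
      · left; linarith
  have h2 := abs_lt.1 (abs_inv_lt_one h1)
  have h3 := inv_mem_Ioo (a := 2) (b := 4) (x := p + 6 - y⁻¹ - (p + 3)) (by norm_num)
    (by linarith) (by linarith)
  constructor <;> linarith

theorem warp_bounds_self_inv {p z : ℚ} (h : z < p - 1 / 2 ∨ p - 1 / 4 < z) :
    p - 1 / 5 < p - (p + 9 - (p + 3 - (z - p)⁻¹ - (p + 6))⁻¹ - (p + 3))⁻¹ ∧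
      p - (p + 9 - (p + 3 - (z - p)⁻¹ - (p + 6))⁻¹ - (p + 3))⁻¹ < p - 1 / 7 := by
  set y := p + 3 - (z - p)⁻¹ - (p + 6) with hy
  have h1 : y < -1 ∨ 1 < y := by
    rcases h with h | h
    · have := inv_mem_of_lt (a := 1 / 2) (x := z - p) (by norm_num) (by linarith)
      simp only [one_div, inv_inv] at this
      left; linarith
    · have := inv_of_neg_lt (a := 1 / 4) (x := z - p) (by linarith)
      simp only [one_div, inv_inv] at this
      rcases this with h | h
      · right; linarith
      · left; linarith
  have h2 := abs_lt.1 (abs_inv_lt_one h1)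
  have h3 := inv_mem_Ioo (a := 5) (b := 7) (x := p + 9 - y⁻¹ - (p + 3)) (by norm_num)
    (by linarith) (by linarith)
  constructor <;> linarith

theorem warp_bounds_succ {p z : ℚ} (h : z < p + 2 ∨ p + 10 < z) :
    p - 1 / 7 < p - (z - (p + 3))⁻¹ ∧ p - (z - (p + 3))⁻¹ < p + 1 := by
  rcases h with h | h
  · have := inv_mem_of_lt (a := 1) (x := z - (p + 3)) (by norm_num) (by linarith)
    constructor <;> linarith
  · have := inv_mem_of_gt (a := 7) (x := z - (p + 3)) (by norm_num) (by linarith)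
    constructor <;> linarith

theorem warp_bounds_succ_inv {p z : ℚ} (h : z < p - 1 / 7 ∨ p + 1 < z) :
    p + 2 < p + 3 - (z - p)⁻¹ ∧ p + 3 - (z - p)⁻¹ < p + 10 := by
  rcases h with h | h
  · have := inv_mem_of_lt (a := 1 / 7) (x := z - p) (by norm_num) (by linarith)
    simp only [one_div, inv_inv] at this
    constructor <;> linarith
  · have := inv_mem_of_gt (a := 1) (x := z - p) (by norm_num) (by linarith)
    constructor <;> linarith

theorem code_true (m : Fin N) : code (m, true) = 2 * (m : ℕ) := by simp [code]

theorem code_false (m : Fin N) : code (m, false) = 2 * (m : ℕ) + 1 := by simp [code]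

theorem warp_self (i : ℤ) :
    warpLo i (2 * i) = 6 * i - 1 / 2 ∧ warpHi i (2 * i) = 6 * i - 1 / 4 := by
  unfold warpLo warpHi
  split_ifs <;> first | (exfalso; omega) | (push_cast; constructor <;> ring)

theorem warp_self_inv (i : ℤ) : warpLo i (2 * i + 1) = 6 * i - 1 / 5 ∧
    warpHi i (2 * i + 1) = 6 * i - 1 / 7 := by
  unfold warpLo warpHi
  split_ifs <;> first | (exfalso; omega) | (push_cast; constructor <;> ring)

theorem warp_succ (i : ℤ) : warpLo i (2 * i + 2) = 6 * i - 1 / 7 ∧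
    warpHi i (2 * i + 2) = 6 * i + 1 := by
  unfold warpLo warpHi
  split_ifs <;> first | (exfalso; omega) | (push_cast; constructor <;> ring)

theorem warp_succ_inv (i : ℤ) : warpLo i (2 * i + 3) = 6 * i + 2 ∧
    warpHi i (2 * i + 3) = 6 * i + 10 := by
  unfold warpLo warpHi
  split_ifs <;> first | (exfalso; omega) | (push_cast; constructor <;> ring)

theorem warp_of_ne {i : ℕ} {l : Fin N × Bool} (h1 : (l.1 : ℕ) ≠ i) (h2 : (l.1 : ℕ) ≠ i + 1) :
    warpLo i (code l) = center l - 1 ∧ warpHi i (code l) = center l + 1 := by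
  have : code l < 2 * i ∨ 2 * i + 4 ≤ code l := by unfold code; split <;> omega
  rw [warpLo, warpHi, center, if_neg (by omega), if_neg (by omega), if_neg (by omega),
    if_neg (by omega), if_neg (by omega), if_neg (by omega), if_neg (by omega)]
  exact ⟨rfl, rfl⟩

theorem inWarp_artinInv {i : ℕ} (hi : i + 1 < N) {l : Fin N × Bool} {y : FreeGroup (Fin N)}
    (hy : slope y < warpLo i (code (bar l)) ∨ warpHi i (code (bar l)) < slope y) :
    InWarp i l (artinInv i (letter l) * y) := by
  obtain ⟨a, ha⟩ : ∃ a : Fin N, (a : ℕ) = i := ⟨⟨i, by omega⟩, rfl⟩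
  obtain ⟨b, hb⟩ : ∃ b : Fin N, (b : ℕ) = i + 1 := ⟨⟨i + 1, hi⟩, rfl⟩
  have hXa : X i = letter (a, true) := by rw [← ha, X_coe, letter_true]
  have hXb : X (i + 1) = letter (b, true) := by rw [← hb, X_coe, letter_true]
  have ca : code (a, true) = 2 * i := by rw [code_true, ha]
  have ca' : code (a, false) = 2 * i + 1 := by rw [code_false, ha]
  have cb : code (b, true) = 2 * i + 2 := by rw [code_true, hb]; push_cast; ring
  have cb' : code (b, false) = 2 * i + 3 := by rw [code_false, hb]; push_cast; ring
  have ka : center (a, true) = 6 * i := by rw [center, ca]; push_cast; ring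
  have ka' : center (a, false) = 6 * i + 3 := by rw [center, ca']; push_cast; ring
  have kb : center (b, true) = 6 * i + 6 := by rw [center, cb]; push_cast; ring
  have kb' : center (b, false) = 6 * i + 9 := by rw [center, cb']; push_cast; ring
  have inv (m : Fin N) : (letter (m, true))⁻¹ = letter (m, false) := (letter_bar _).symm
  have inv' (m : Fin N) : (letter (m, false))⁻¹ = letter (m, true) := (letter_bar _).symm
  have bt (m : Fin N) : bar (m, true) = (m, false) := rfl
  have bf (m : Fin N) : bar (m, false) = (m, true) := rfl
  have ea : artinInv i (letter (a, true)) =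
      letter (a, true) * letter (b, true) * letter (a, false) := by
    rw [← hXa, artinInv_X hi, if_pos rfl, hXa, hXb, inv]
  have ea' : artinInv i (letter (a, false)) =
      letter (a, true) * letter (b, false) * letter (a, false) := by
    rw [← inv a, map_inv, ea, mul_inv_rev, mul_inv_rev, inv', inv, inv, mul_assoc]
  have eb : artinInv i (letter (b, true)) = letter (a, true) := by
    rw [← hXb, artinInv_X hi, if_neg (by omega), if_pos rfl, hXa]
  have eb' : artinInv i (letter (b, false)) = letter (a, false) := by
    rw [← inv b, map_inv, eb, inv]
  unfold InWarp
  by_cases h1 : l.1 = a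
  · obtain ⟨m, _ | _⟩ := l <;> obtain rfl : m = a := h1
    · rw [bf, ca, (warp_self i).1, (warp_self i).2] at hy
      rw [ca', (warp_self_inv i).1, (warp_self_inv i).2, ea']
      simp only [mul_assoc, slope_letter_mul, bt, bf, ka, ka', kb, kb']
      exact warp_bounds_self_inv hy
    · rw [bt, ca', (warp_self_inv i).1, (warp_self_inv i).2] at hy
      rw [ca, (warp_self i).1, (warp_self i).2, ea]
      simp only [mul_assoc, slope_letter_mul, bt, bf, ka, ka', kb, kb']
      exact warp_bounds_self hy
  by_cases h2 : l.1 = b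
  · obtain ⟨m, _ | _⟩ := l <;> obtain rfl : m = b := h2
    · rw [bf, cb, (warp_succ i).1, (warp_succ i).2] at hy
      rw [cb', (warp_succ_inv i).1, (warp_succ_inv i).2, eb']
      simp only [slope_letter_mul, bf, ka, ka']
      exact warp_bounds_succ_inv hy
    · rw [bt, cb', (warp_succ_inv i).1, (warp_succ_inv i).2] at hy
      rw [cb, (warp_succ i).1, (warp_succ i).2, eb]
      simp only [slope_letter_mul, bt, ka, ka']
      exact warp_bounds_succ hy
  have h1' : (l.1 : ℕ) ≠ i := fun h => h1 (Fin.ext (h.trans ha.symm))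
  have h2' : (l.1 : ℕ) ≠ i + 1 := fun h => h2 (Fin.ext (h.trans hb.symm))
  have el : artinInv i (letter l) = letter l := by
    have : artinInv i (X l.1 : FreeGroup (Fin N)) = X l.1 := by
      rw [artinInv_X hi, if_neg h1', if_neg h2']
    obtain ⟨m, _ | _⟩ := l
    · rw [X_coe, ← letter_true] at this
      rw [← inv, map_inv, this]
    · rwa [X_coe, ← letter_true] at this
  rw [(warp_of_ne (l := bar l) h1' h2').1, (warp_of_ne (l := bar l) h1' h2').2] at hy
  rw [(warp_of_ne h1' h2').1, (warp_of_ne h1' h2').2, el]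
  exact mem_D.1 (letter_mul_mem_D hy)

theorem inWarp_of_mem_D {i : ℕ} (hi : i + 1 < N) {l : Fin N × Bool} {k : FreeGroup (Fin N)}
    (h : k ∈ D l) : InWarp i l (artinInv i k) := by
  induction k using peel_induction generalizing l with
  | one => exact absurd h (one_notMem_D l)
  | mul s k hk ih =>
    obtain rfl := eq_of_mem_D h (letter_mul_mem_D_iff.2 hk)
    rw [map_mul]
    apply inWarp_artinInv hi
    rcases eq_or_ne k 1 with rfl | hk1
    · left
      rw [map_one, slope_one]
      exact lt_warpLo _ (code_nonneg _)
    · obtain ⟨t, ht⟩ := exists_mem_D hk1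
      have h1 := ih ht
      rcases lt_trichotomy (code t) (code (bar l)) with h2 | h2 | h2
      · left; exact h1.2.trans_le (warpHi_le_warpLo _ h2)
      · rw [code_injective h2] at ht; exact absurd ht hk
      · right; exact (warpHi_le_warpLo _ h2).trans_lt h1.1

theorem slope_artinInv_lt {i : ℕ} (hi : i + 1 < N) {a b : FreeGroup (Fin N)}
    (h : slope a < slope b) (hab : ∀ l, a ∈ D l → b ∉ D l) :
    slope (artinInv i a) < slope (artinInv i b) := by
  rcases eq_or_ne b 1 with rfl | hb
  · rcases eq_or_ne a 1 with rfl | ha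
    · exact absurd h (lt_irrefl _)
    · exact absurd h (slope_one_lt_of_ne ha).not_gt
  obtain ⟨t, ht⟩ := exists_mem_D hb
  have h2 := inWarp_of_mem_D hi ht
  rcases eq_or_ne a 1 with rfl | ha
  · rw [map_one, slope_one]
    exact (lt_warpLo _ (code_nonneg _)).trans h2.1
  obtain ⟨s, hs⟩ := exists_mem_D ha
  have h1 := inWarp_of_mem_D hi hs
  rcases lt_trichotomy (code s) (code t) with h3 | h3 | h3
  · exact h1.2.trans_le ((warpHi_le_warpLo _ h3).trans h2.1.le)
  · rw [code_injective h3] at hs; exact absurd ht (hab _ hs)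
  · exact absurd h (slope_lt_of_code_lt ht hs h3).not_gt

theorem norm_letter_inv_mul_le (l : Fin N × Bool) (k : FreeGroup (Fin N)) :
    ((letter l)⁻¹ * k).norm ≤ k.norm + 1 := by
  have h1 := FreeGroup.norm_mul_le (letter l)⁻¹ k
  have h2 : (letter l)⁻¹.norm ≤ 1 := by
    rw [FreeGroup.norm_inv_eq, letter]; exact FreeGroup.norm_mk_le
  omega

theorem norm_letter_inv_mul_of_mem {l : Fin N × Bool} {k : FreeGroup (Fin N)} (h : k ∈ D l) :
    ((letter l)⁻¹ * k).norm + 1 = k.norm := by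
  rcases exists_peel k with rfl | ⟨m, k', rfl, h1, -, h3⟩
  · exact absurd h (one_notMem_D l)
  · obtain rfl := eq_of_mem_D h h3
    rwa [inv_mul_cancel_left]

theorem Cyc.artinInv {i : ℕ} (hi : i + 1 < N) {a b c : FreeGroup (Fin N)} (h : Cyc a b c) :
    Cyc (artinInv i a) (artinInv i b) (artinInv i c) := by
  induction hn : a.norm + b.norm + c.norm using Nat.strong_induction_on generalizing a b c with
  | _ n ih =>
    by_cases hl : ∃ l, (a ∈ D l ∧ b ∈ D l) ∨ (b ∈ D l ∧ c ∈ D l) ∨ (c ∈ D l ∧ a ∈ D l)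
    · obtain ⟨l, hl⟩ := hl
      have h1 := (cyc_mul (letter l)⁻¹ a b c).2 h
      have h2 := ih _ (by
        have ha := norm_letter_inv_mul_le l a
        have hb := norm_letter_inv_mul_le l b
        have hc := norm_letter_inv_mul_le l c
        rcases hl with ⟨h3, h4⟩ | ⟨h3, h4⟩ | ⟨h3, h4⟩ <;>
        · have h3 := norm_letter_inv_mul_of_mem h3
          have h4 := norm_letter_inv_mul_of_mem h4
          omega) h1 rfl
      rwa [map_mul, map_mul, map_mul, cyc_mul] at h2
    · have hab : ∀ l, a ∈ D l → b ∉ D l := fun l h1 h2 => hl ⟨l, Or.inl ⟨h1, h2⟩⟩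
      have hbc : ∀ l, b ∈ D l → c ∉ D l := fun l h1 h2 => hl ⟨l, Or.inr (Or.inl ⟨h1, h2⟩)⟩
      have hca : ∀ l, c ∈ D l → a ∉ D l := fun l h1 h2 => hl ⟨l, Or.inr (Or.inr ⟨h1, h2⟩)⟩
      rcases h with ⟨h1, h2⟩ | ⟨h1, h2⟩ | ⟨h1, h2⟩
      · exact Or.inl ⟨slope_artinInv_lt hi h1 hab, slope_artinInv_lt hi h2 hbc⟩
      · exact Or.inr (Or.inl ⟨slope_artinInv_lt hi h1 hbc, slope_artinInv_lt hi h2 hca⟩)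
      · exact Or.inr (Or.inr ⟨slope_artinInv_lt hi h1 hca, slope_artinInv_lt hi h2 hab⟩)

theorem cyc_iff_of_imp {f : FreeGroup (Fin N) → FreeGroup (Fin N)}
    (hf : ∀ a b c, Cyc a b c → Cyc (f a) (f b) (f c)) (a b c : FreeGroup (Fin N)) :
    Cyc (f a) (f b) (f c) ↔ Cyc a b c := by
  refine ⟨fun h => ?_, hf a b c⟩
  have asymm {x y z : ℚ} (h : RCyc x y z) (h' : RCyc z y x) : False := by
    unfold RCyc at h h'; grind
  have hab : slope a ≠ slope b := fun e => by
    rw [slope_injective e] at h; unfold Cyc RCyc at h; grind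
  have hac : slope a ≠ slope c := fun e => by
    rw [slope_injective e] at h; unfold Cyc RCyc at h; grind
  have hbc : slope b ≠ slope c := fun e => by
    rw [slope_injective e] at h; unfold Cyc RCyc at h; grind
  exact (rCyc_total hab hac hbc).resolve_right fun h' => asymm h (hf c b a h')

theorem cyc_artinAut (i : ℕ) (a b c : FreeGroup (Fin N)) :
    Cyc (artinAut i a) (artinAut i b) (artinAut i c) ↔ Cyc a b c := by
  by_cases hi : i + 1 < N
  · have h := cyc_iff_of_imp (fun _ _ _ => Cyc.artinInv hi) (artinAut i a) (artinAut i b)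
      (artinAut i c)
    simp only [artinAut_apply hi, artinInv_artin hi] at h ⊢
    exact h.symm
  · rw [artinAut, dif_neg hi]; rfl

theorem cyc_rho (g : BraidGroup N) (a b c : FreeGroup (Fin N)) :
    Cyc (rho N g a) (rho N g b) (rho N g c) ↔ Cyc a b c := by
  induction g using BraidGroup.induction_left with
  | one => simp
  | mul i g hi ih =>
    rw [map_mul, rho_σ hi]
    exact (cyc_artinAut i _ _ _).trans ih
  | inv_mul i g hi ih =>
    rw [← ih, ← cyc_artinAut i, map_mul, map_inv, rho_σ hi]
    simp only [MulAut.mul_apply, MulAut.apply_inv_self]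

end Slope

namespace BraidGroup

open Slope

variable {N : ℕ}

theorem es_rho (b : BraidGroup N) (w : FreeGroup (Fin N)) : es (rho N b w) = es w := by
  induction b using induction_left with
  | one => rw [map_one, MulAut.one_apply]
  | mul i g hi ih => rw [map_mul, MulAut.mul_apply, rho_σ hi, es_artinAut, ih]
  | inv_mul i g hi ih =>
    rw [map_mul, MulAut.mul_apply, map_inv, rho_σ hi,
      ← es_artinAut i ((artinAut i)⁻¹ _), MulAut.apply_inv_self, ih]

theorem rho_prodX (b : BraidGroup N) : rho N b (prodX N) = prodX N := by
  induction b using induction_left with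
  | one => rw [map_one, MulAut.one_apply]
  | mul i g hi ih => rw [map_mul, MulAut.mul_apply, rho_σ hi, ih, artinAut_prodX]
  | inv_mul i g hi ih =>
    rw [map_mul, MulAut.mul_apply, map_inv, rho_σ hi, ih]
    nth_rewrite 1 [← artinAut_prodX i]
    rw [MulAut.inv_apply_self]

theorem pushHom_injective : Function.Injective (pushHom N) := by
  intro k l h
  have := congrArg (fun g => (coset N g (N, 1)).2) h
  simpa [coset_pushHom] using this

section Kernel

variable {π : BraidGroup (N + 1) →* Equiv.Perm (Fin (N + 1))}
  (hπ : ∀ i (h : i < N), π (σ i) = Equiv.swap ⟨i, by omega⟩ ⟨i + 1, by omega⟩)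

include hπ

theorem pushHom_mem_ker (w : FreeGroup (Fin N)) : pushHom N w ∈ π.ker := by
  have : π.comp (pushHom N) = 1 := by
    apply hom_ext_X
    intro k hk
    change π (pushHom N (X k)) = 1
    rw [pushHom_X hk, push, map_mul, map_mul, map_mul, hπ k hk, Equiv.swap_mul_self, mul_one,
      map_inv, inv_mul_cancel]
  exact DFunLike.congr_fun this w

theorem coset_fst_of_mem_ker {g : BraidGroup (N + 1)} (hg : g ∈ π.ker) (u : FreeGroup (Fin N)) :
    (coset N g (N, u)).1 = N := by
  have := coset_fst hπ g (Fin.last N) u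
  rwa [MonoidHom.mem_ker.1 hg] at this

theorem exists_normal_form_of_mem_ker {g : BraidGroup (N + 1)} (hg : g ∈ π.ker) :
    ∃ k b, g = pushHom N k * stab N b := by
  obtain ⟨j, k, b, hj, rfl⟩ := exists_normal_form g
  have := coset_fst_of_mem_ker hπ hg 1
  rw [coset_normal_form hj] at this
  exact ⟨k, b, by rw [τ_of_le (le_of_eq this.symm), one_mul]⟩

/-- The action of the pure braid group on the fibre group of the map forgetting the last strand. -/
abbrev kerAction : MulAction π.ker (FreeGroup (Fin N)) where
  smul g u := (coset N g (N, u)).2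
  one_smul u := by
    change (coset N ((1 : π.ker) : BraidGroup (N + 1)) (N, u)).2 = u
    rw [OneMemClass.coe_one, map_one, Equiv.Perm.one_apply]
  mul_smul g h u := by
    change (coset N ((g * h : π.ker) : BraidGroup (N + 1)) (N, u)).2 =
      (coset N g (N, (coset N h (N, u)).2)).2
    rw [Subgroup.coe_mul, map_mul, Equiv.Perm.mul_apply]
    congr 2
    exact Prod.ext (coset_fst_of_mem_ker hπ h.2 u) rfl

theorem kerAction_eq {g : π.ker} {k : FreeGroup (Fin N)} {b : BraidGroup N}
    (h : (g : BraidGroup (N + 1)) = pushHom N k * stab N b) (u : FreeGroup (Fin N)) :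
    letI := kerAction hπ
    g • u = k * rho N b u := by
  change (coset N g (N, u)).2 = _
  rw [h, map_mul, Equiv.Perm.mul_apply, coset_stab, coset_pushHom]

/-- The point-pushing subgroup of the pure braid group. -/
def kerPointPush : letI := kerAction hπ; PointPush N π.ker :=
  letI := kerAction hπ
  { ι := (pushHom N).codRestrict π.ker (pushHom_mem_ker hπ)
    ι_smul := fun k u => by
      rw [kerAction_eq hπ (k := k) (b := 1) (by rw [map_one, mul_one]; rfl), map_one,
        MulAut.one_apply]
    conj := fun g w => by
      obtain ⟨k, b, h⟩ := exists_normal_form_of_mem_ker hπ g.2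
      refine ⟨k * rho N b w * k⁻¹, by simp [es_rho], Subtype.ext ?_⟩
      change (g : BraidGroup (N + 1)) * pushHom N w * (g : BraidGroup (N + 1))⁻¹ = pushHom N _
      have := stab_mul_pushHom b w
      rw [h, mul_assoc (pushHom N k), this, map_mul, map_mul, map_inv]
      group
    cyc := fun g a b c => by
      obtain ⟨k, β, h⟩ := exists_normal_form_of_mem_ker hπ g.2
      rw [kerAction_eq hπ h, kerAction_eq hπ h, kerAction_eq hπ h, cyc_mul, cyc_rho] }

theorem hasStrongGenericFreeGroupProperty_ker (hN : 2 ≤ N) :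
    HasStrongGenericFreeGroupProperty π.ker := by
  intro S hS hgen
  let := kerAction hπ
  refine PointPush.strongGeneric (A := kerPointPush hπ) (i := ⟨0, by omega⟩) (j := ⟨1, by omega⟩)
    (by simp) (fun g hg h1 => ?_) hS hgen
  obtain ⟨k, b, h⟩ := exists_normal_form_of_mem_ker hπ g.2
  rw [kerAction_eq hπ h, map_one, mul_one] at h1
  have key (w : FreeGroup (Fin N)) : k * rho N b w = w * k := by
    have := congrArg (fun g : π.ker => (g : BraidGroup (N + 1))) (hg w)
    change (g : BraidGroup (N + 1)) * pushHom N w = pushHom N w * g at this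
    rw [h, mul_assoc, stab_mul_pushHom, ← mul_assoc, ← mul_assoc, mul_left_inj, ← map_mul,
      ← map_mul] at this
    exact pushHom_injective this
  have hk : k = 1 := by
    refine eq_one_of_commute_of_es (r := prodX N) ?_ ?_ h1
    · rw [← key, rho_prodX]
    · rw [es_prodX le_rfl]; omega
  have hb : b = 1 := by
    apply rho_injective
    ext1 w
    have := key w
    rwa [hk, one_mul, mul_one] at this
  exact Subtype.ext (by rw [h, hk, hb, map_one, map_one, mul_one]; rfl)

end Kernel

end BraidGroup

/-- For every `n ≥ 3`, the pure braid group `Pₙ` — the kernel of the surjective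
homomorphism from `Bₙ` onto the symmetric group `Sym(n)` sending each Artin generator `σᵢ`
to the transposition `(i, i+1)` — satisfies the strong generic free group property with
respect to every finite generating set. -/
theorem pureBraidGroup_hasStrongGenericFreeGroupProperty (n : ℕ) (hn : 3 ≤ n)
    (π : BraidGroup n →* Equiv.Perm (Fin n))
    (hπof : ∀ i : Fin (n - 1),
      π (PresentedGroup.of (rels := braidRels n) i) =
        Equiv.swap ⟨(i : ℕ), by have := i.isLt; omega⟩
          ⟨(i : ℕ) + 1, by have := i.isLt; omega⟩)
    (hπsurj : Function.Surjective π) :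
    HasStrongGenericFreeGroupProperty π.ker := by
  obtain ⟨N, rfl⟩ : ∃ N, n = N + 1 := ⟨n - 1, by omega⟩
  refine BraidGroup.hasStrongGenericFreeGroupProperty_ker (fun i h => ?_) (by omega)
  rw [BraidGroup.σ_of_lt h]
  exact hπof ⟨i, h⟩
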